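/- arXiv:2004.02534 — 5 statements merged into one kernel-verified Lean document; each statement's English description precedes it below -/
import Mathlib

section
/- For every integer n ≥ 2, the Baumslag–Solitar group BS(1,n) admits a strongly aperiodic subshift of finite type: there exist a finite alphabet A and a finite set F of forbidden patterns over BS(1,n) such that the SFT X_F is nonempty and every configuration in X_F has trivial stabilizer. -/
/-- The Baumslag–Solitar relation `b a^m b⁻¹ (a^n)⁻¹` in the free group on two generators. -/
def BSrel (m n : ℤ) : Set (FreeGroup (Fin 2)) :=
  {FreeGroup.of 1 * FreeGroup.of 0 ^ m * (FreeGroup.of 1)⁻¹ * (FreeGroup.of 0 ^ n)⁻¹}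

/-- The Baumslag–Solitar group `BS(m,n) = ⟨a, b ∣ b a^m b⁻¹ = a^n⟩`. -/
abbrev BS (m n : ℤ) : Type := PresentedGroup (BSrel m n)

/-- A pattern: a finite subset of the group together with a labelling by the alphabet. -/
structure Pattern (G A : Type) where
  supp : Finset G
  data : supp → A

/-- The pattern `p` appears in the configuration `x : A^G`. -/
def Appears {G A : Type} [Group G] (p : Pattern G A) (x : G → A) : Prop :=
  ∃ g : G, ∀ h : p.supp, x (g⁻¹ * (h : G)) = p.data h

/-- The subshift of finite type defined by the (finite) set of forbidden patterns `F`. -/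
def SFT {G A : Type} [Group G] (F : Set (Pattern G A)) : Set (G → A) :=
  {x | ∀ p ∈ F, ¬ Appears p x}

/-- A finite-window local rule defines a subshift of finite type. -/
theorem exists_finite_forall_mem_SFT_iff {G A : Type} [Group G] [Finite A] (S : Finset G)
    (R : (G → A) → Prop) (hR : ∀ x y : G → A, (∀ h ∈ S, x h = y h) → (R x ↔ R y)) :
    ∃ F : Set (Pattern G A), F.Finite ∧
      ∀ x : G → A, x ∈ SFT F ↔ ∀ g : G, R fun h => x (g * h) := by
  refine ⟨(fun q : S → A => (⟨S, q⟩ : Pattern G A)) ''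
    {q | ∀ x : G → A, (∀ h : S, x h = q h) → ¬ R x}, (Set.toFinite _).image _, fun x => ?_⟩
  constructor
  · intro hx g
    by_contra hg
    refine hx ⟨S, fun h => x (g * h)⟩ ⟨fun h => x (g * h), fun y hy hRy => hg ?_, rfl⟩
      ⟨g⁻¹, fun h => by simp⟩
    exact (hR _ _ fun h hh => hy ⟨h, hh⟩).1 hRy
  · rintro hx _ ⟨q, hq, rfl⟩ ⟨g, hg⟩
    exact hq _ hg (hx g⁻¹)

/-- Integer data on a group with elements `a`, `b` such that `b * a = a ^ n * b`: a colour `t`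
counting modulo `n` along `a`, a multiplier `p / 3` constant along `a`, and digits `d` with bounded
carries `c`, such that the digits over `g * b` represent `p / 3` times the number represented by the
digits over `g`. -/
structure MultiplierRule {G : Type} [Group G] (n : ℕ) (a b : G) (t p d c : G → ℤ) : Prop where
  colour : ∀ g, (n : ℤ) ∣ t (g * a) - t g - 1
  const : ∀ g, p (g * a) = p g
  mult : ∀ g, p g = 2 ∨ p g = 6
  two_le : ∀ g, 2 ≤ d g
  le_six : ∀ g, d g ≤ 6
  carry : ∀ g, |c g| ≤ 3 * n + 6
  step : ∀ g, p g * ∑ i ∈ Finset.range n, d (g * a ^ i) =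
    3 * n * d (g * b) + c (g * a ^ n) - c g

section Relation

variable {G : Type} [Group G] {n : ℕ} {a b : G}

theorem mul_zpow_of_rel (hab : b * a = a ^ n * b) (k : ℕ) (j : ℤ) :
    b ^ k * a ^ j = a ^ ((n : ℤ) ^ k * j) * b ^ k := by
  have h1 : ∀ j : ℤ, b * a ^ j = a ^ ((n : ℤ) * j) * b := fun j => by
    have h : SemiconjBy b a (a ^ n) := hab
    have := (h.zpow_right j).eq
    rwa [← zpow_natCast, ← zpow_mul] at this
  induction k generalizing j with
  | zero => simp
  | succ k ih =>
    rw [pow_succ, mul_assoc, h1, ← mul_assoc, ih, mul_assoc]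
    congr 2
    ring

theorem exists_eq_inv_pow_mul_zpow_mul_pow (hab : b * a = a ^ n * b)
    (htop : Subgroup.closure {a, b} = ⊤) (g : G) :
    ∃ (i : ℕ) (j : ℤ) (m : ℕ), g = (b ^ i)⁻¹ * a ^ j * b ^ m := by
  have hg : g ∈ Subgroup.closure {a, b} := htop ▸ Subgroup.mem_top g
  have ha : ∀ (i : ℕ) (j e : ℤ) (m : ℕ), ∃ (i' : ℕ) (j' : ℤ) (m' : ℕ),
      (b ^ i)⁻¹ * a ^ j * b ^ m * a ^ e = (b ^ i')⁻¹ * a ^ j' * b ^ m' := fun i j e m =>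
    ⟨i, j + (n : ℤ) ^ m * e, m, by
      rw [mul_assoc _ (b ^ m), mul_zpow_of_rel hab, zpow_add]; group⟩
  induction hg using Subgroup.closure_induction_right with
  | one => exact ⟨0, 0, 0, by simp⟩
  | mul_right x y _ hy ih =>
    obtain ⟨i, j, m, rfl⟩ := ih
    rcases hy with rfl | rfl
    · simpa using ha i j 1 m
    · exact ⟨i, j, m + 1, by rw [pow_succ]; group⟩
  | mul_inv_cancel x y _ hy ih =>
    obtain ⟨i, j, m, rfl⟩ := ih
    rcases hy with rfl | rfl
    · simpa using ha i j (-1) m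
    · cases m with
      | succ m => exact ⟨i, j, m, by rw [pow_succ]; group⟩
      | zero =>
        refine ⟨i + 1, n * j, 0, ?_⟩
        have h := mul_zpow_of_rel hab 1 j
        simp only [pow_one] at h
        rw [eq_mul_inv_of_mul_eq h.symm, pow_succ']
        group

namespace MultiplierRule

variable {t p d c : G → ℤ}

theorem colour_mul_pow (h : MultiplierRule n a b t p d c) (g : G) (j : ℕ) :
    (n : ℤ) ∣ t (g * a ^ j) - t g - j := by
  induction j with
  | zero => simp
  | succ j ih =>
    obtain ⟨u, hu⟩ := ih
    obtain ⟨v, hv⟩ := h.colour (g * a ^ j)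
    rw [mul_assoc, ← pow_succ] at hv
    exact ⟨u + v, by push_cast; linarith⟩

theorem colour_mul_zpow (h : MultiplierRule n a b t p d c) (g : G) (j : ℤ) :
    (n : ℤ) ∣ t (g * a ^ j) - t g - j := by
  obtain ⟨m, rfl | rfl⟩ := j.eq_nat_or_neg
  · simpa using h.colour_mul_pow g m
  · have := h.colour_mul_pow (g * a ^ (-(m : ℤ))) m
    rw [mul_assoc, ← zpow_natCast, ← zpow_add, neg_add_cancel, zpow_zero, mul_one] at this
    obtain ⟨u, hu⟩ := this
    exact ⟨-u, by linarith⟩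

theorem mult_mul_pow (h : MultiplierRule n a b t p d c) (g : G) (j : ℕ) :
    p (g * a ^ j) = p g := by
  induction j with
  | zero => simp
  | succ j ih => rw [pow_succ, ← mul_assoc, h.const, ih]

theorem mult_mul_sum (h : MultiplierRule n a b t p d c) (hab : b * a = a ^ n * b) (g : G)
    (M : ℕ) :
    p g * ∑ i ∈ Finset.range (n * M), d (g * a ^ i) =
      3 * n * ∑ i ∈ Finset.range M, d (g * b * a ^ i) + c (g * a ^ (n * M)) - c g := by
  induction M with
  | zero => simp
  | succ M ih =>
    have hs := h.step (g * a ^ (n * M))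
    have hb : g * a ^ (n * M) * b = g * b * a ^ M := by
      have := mul_zpow_of_rel hab 1 M
      rw [pow_one, pow_one, zpow_natCast] at this
      rw [mul_assoc, mul_assoc, this]
      norm_cast
    rw [h.mult_mul_pow, hb] at hs
    simp only [mul_assoc g, ← pow_add] at hs
    rw [Nat.mul_succ, Finset.sum_range_add, mul_add, ih, hs, Finset.sum_range_succ]
    simp only [mul_assoc g]
    ring

theorem exists_sum_bound (h : MultiplierRule n a b t p d c) (hab : b * a = a ^ n * b) (k : ℕ)
    (g : G) :
    ∃ (e : ℕ) (C : ℤ), ∀ M : ℕ,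
      |2 ^ k * 3 ^ e * ∑ i ∈ Finset.range (n ^ k * M), d (g * a ^ i) -
        (3 * n) ^ k * ∑ i ∈ Finset.range M, d (g * b ^ k * a ^ i)| ≤ C := by
  induction k generalizing g with
  | zero => exact ⟨0, 0, by simp⟩
  | succ k ih =>
    obtain ⟨e, C, hC⟩ := ih (g * b)
    obtain ⟨f, hf⟩ : ∃ f : ℕ, p g = 2 * 3 ^ f :=
      (h.mult g).elim (fun h => ⟨0, by simpa using h⟩) fun h => ⟨1, by simpa using h⟩
    refine ⟨e + f, 3 * n * C + 2 ^ k * 3 ^ e * (2 * (3 * n + 6)), fun M => ?_⟩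
    have hs := h.mult_mul_sum hab g (n ^ k * M)
    rw [← mul_assoc, ← pow_succ', hf] at hs
    have h1 := hC M
    have h2 : |c (g * a ^ (n ^ (k + 1) * M)) - c g| ≤ 2 * (3 * n + 6) := by
      have := abs_sub (c (g * a ^ (n ^ (k + 1) * M))) (c g)
      linarith [h.carry (g * a ^ (n ^ (k + 1) * M)), h.carry g]
    have key : (2 : ℤ) ^ (k + 1) * 3 ^ (e + f) *
          ∑ i ∈ Finset.range (n ^ (k + 1) * M), d (g * a ^ i) -
        (3 * n) ^ (k + 1) * ∑ i ∈ Finset.range M, d (g * b ^ (k + 1) * a ^ i) =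
        3 * n * (2 ^ k * 3 ^ e * ∑ i ∈ Finset.range (n ^ k * M), d (g * b * a ^ i) -
          (3 * n) ^ k * ∑ i ∈ Finset.range M, d (g * b * b ^ k * a ^ i)) +
        2 ^ k * 3 ^ e * (c (g * a ^ (n ^ (k + 1) * M)) - c g) := by
      rw [mul_assoc g b (b ^ k), ← pow_succ']
      linear_combination (2 : ℤ) ^ k * 3 ^ e * hs
    rw [key]
    refine (abs_add_le _ _).trans (add_le_add ?_ ?_)
    · rw [abs_mul, abs_of_nonneg (by positivity : (0 : ℤ) ≤ 3 * n)]
      gcongr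
    · rw [abs_mul, abs_of_nonneg (by positivity : (0 : ℤ) ≤ 2 ^ k * 3 ^ e)]
      gcongr

end MultiplierRule

end Relation

/-- Shifting the window of a bounded sequence changes its partial sums by a bounded amount. -/
theorem exists_abs_sum_shift_sub_le (u : ℤ → ℤ) (B : ℤ) (hu : ∀ i, |u i| ≤ B) (j : ℤ) :
    ∃ C : ℤ, ∀ N : ℕ,
      |∑ i ∈ Finset.range N, u (j + i) - ∑ i ∈ Finset.range N, u i| ≤ C := by
  have hstep : ∀ (j : ℤ) (N : ℕ),
      |∑ i ∈ Finset.range N, u (j + 1 + i) - ∑ i ∈ Finset.range N, u (j + i)| ≤ 2 * B := by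
    intro j N
    rw [← Finset.sum_sub_distrib]
    have := Finset.sum_range_sub (fun i : ℕ => u (j + i)) N
    have h2 : ∑ i ∈ Finset.range N, (u (j + 1 + i) - u (j + i)) = u (j + N) - u j := by
      rw [← Finset.sum_congr rfl fun i _ => ?_, this]
      · simp
      · push_cast
        ring_nf
    rw [h2]
    have := abs_sub (u (j + N)) (u j)
    linarith [hu (j + N), hu j]
  induction j using Int.induction_on with
  | zero => exact ⟨0, by simp⟩
  | succ j ih =>
    obtain ⟨C, hC⟩ := ih
    exact ⟨2 * B + C, fun N => (abs_sub_le _ _ _).trans (add_le_add (hstep j N) (hC N))⟩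
  | pred j ih =>
    obtain ⟨C, hC⟩ := ih
    refine ⟨2 * B + C, fun N => (abs_sub_le _ _ _).trans (add_le_add ?_ (hC N))⟩
    have := hstep (-j - 1) N
    rw [sub_add_cancel, abs_sub_comm] at this
    exact this

/-- A function squeezed between two positive linear functions cannot be asymptotically
self-similar with a ratio different from the scaling factor. -/
theorem eq_of_abs_mul_sub_mul_le {S : ℕ → ℤ} {N : ℕ} {P Q : ℕ} {C : ℤ} (hN : 0 < N)
    (hS : ∀ M : ℕ, 2 * M ≤ S M ∧ S M ≤ 6 * M)
    (hC : ∀ M : ℕ, |P * S (N * M) - Q * N * S M| ≤ C) : P = Q := by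
  set D : ℕ := C.toNat + 1 with hD
  have hCD : (C : ℝ) ≤ D := by
    have : C ≤ (D : ℤ) := by omega
    exact_mod_cast this
  have hpos : ∀ j : ℕ, (1 : ℝ) ≤ N ^ j := fun j => one_le_pow₀ (by exact_mod_cast hN)
  have hDpos : (0 : ℝ) < D := by positivity
  set s : ℕ → ℝ := fun j => S (N ^ j * D) / (N ^ j * D) with hs
  have hmul : ∀ j, s j * (N ^ j * D) = S (N ^ j * D) := fun j =>
    div_mul_cancel₀ _ (by have := hpos j; positivity)
  have hs2 : ∀ j, 2 ≤ s j := fun j => by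
    rw [hs, le_div_iff₀ (by have := hpos j; positivity)]
    exact_mod_cast (hS (N ^ j * D)).1
  have hs6 : ∀ j, s j ≤ 6 := fun j => by
    rw [hs, div_le_iff₀ (by have := hpos j; positivity)]
    exact_mod_cast (hS (N ^ j * D)).2
  have hstep : ∀ j, |P * s (j + 1) - Q * s j| ≤ 1 := fun j => by
    have h1 : |(P : ℝ) * S (N * (N ^ j * D)) - Q * N * S (N ^ j * D)| ≤ C := by
      exact_mod_cast hC (N ^ j * D)
    have h0 := hpos (j + 1)
    rw [← mul_assoc, ← pow_succ', ← hmul, ← hmul] at h1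
    have h2 : (P : ℝ) * (s (j + 1) * (N ^ (j + 1) * D)) - Q * N * (s j * (N ^ j * D)) =
        (P * s (j + 1) - Q * s j) * (N ^ (j + 1) * D) := by ring
    have h3 : (0 : ℝ) < N ^ (j + 1) * D := by positivity
    rw [h2, abs_mul, abs_of_pos h3] at h1
    by_contra! h4
    nlinarith
  rcases lt_trichotomy P Q with h | h | h
  · have hPQ : (P : ℝ) + 1 ≤ Q := by exact_mod_cast h
    have hgrow : ∀ j : ℕ, (j : ℝ) ≤ P * s j := fun j => by
      induction j with
      | zero => have := hs2 0; push_cast; positivity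
      | succ j ih =>
        have := (abs_le.1 (hstep j)).1
        have := hs2 j
        push_cast
        nlinarith
    have h1 := hgrow (6 * P + 1)
    push_cast at h1
    nlinarith [hs6 (6 * P + 1), (Nat.cast_nonneg P : (0 : ℝ) ≤ P)]
  · exact h
  · have hPQ : (Q : ℝ) + 1 ≤ P := by exact_mod_cast h
    have hdecay : ∀ j : ℕ, Q * s j + j ≤ 6 * Q := fun j => by
      induction j with
      | zero =>
        have := mul_le_mul_of_nonneg_left (hs6 0) (Nat.cast_nonneg Q)
        push_cast
        linarith
      | succ j ih =>
        have := (abs_le.1 (hstep j)).2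
        have := hs2 (j + 1)
        push_cast
        nlinarith
    have h1 := hdecay (6 * Q + 1)
    push_cast at h1
    nlinarith [hs2 (6 * Q + 1), (Nat.cast_nonneg Q : (0 : ℝ) ≤ Q)]

namespace MultiplierRule

variable {G : Type} [Group G] {n : ℕ} {a b : G} {t p d c : G → ℤ}

theorem level_eq_zero_of_invariant (h : MultiplierRule n a b t p d c)
    (hab : b * a = a ^ n * b) (hn : 0 < n) {i k : ℕ} {j : ℤ}
    (hd : ∀ g, d ((b ^ i)⁻¹ * a ^ j * b ^ (i + k) * g) = d g) : k = 0 := by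
  obtain ⟨e, C, hC⟩ := h.exists_sum_bound hab k ((b ^ i)⁻¹ * a ^ j)
  set u : ℤ → ℤ := fun m => d ((b ^ i)⁻¹ * a ^ m) with hu
  obtain ⟨C', hC'⟩ := exists_abs_sum_shift_sub_le u 6
    (fun m => abs_le.2 ⟨by linarith [h.two_le ((b ^ i)⁻¹ * a ^ m)], h.le_six _⟩) j
  have h1 : ∀ m : ℕ, d ((b ^ i)⁻¹ * a ^ j * a ^ m) = u (j + m) := fun m => by
    rw [hu, mul_assoc, ← zpow_natCast a m, ← zpow_add]
  have h2 : ∀ m : ℕ, d ((b ^ i)⁻¹ * a ^ j * b ^ k * a ^ m) = u m := fun m => by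
    refine (congrArg d ?_).trans (hd ((b ^ i)⁻¹ * a ^ (m : ℤ)))
    rw [zpow_natCast, add_comm, pow_add]
    group
  simp only [h1, h2] at hC
  have hPQ : 2 ^ k * 3 ^ e = 3 ^ k := by
    refine eq_of_abs_mul_sub_mul_le (S := fun M => ∑ m ∈ Finset.range M, u m) (N := n ^ k)
      (C := C + 2 ^ k * 3 ^ e * C') (by positivity) (fun M => ⟨?_, ?_⟩) fun M => ?_
    · have := Finset.card_nsmul_le_sum (Finset.range M) (fun m : ℕ => u m) 2
        fun m _ => h.two_le _
      simpa [mul_comm] using this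
    · have := Finset.sum_le_card_nsmul (Finset.range M) (fun m : ℕ => u m) 6
        fun m _ => h.le_six _
      simpa [mul_comm] using this
    · have h3 := abs_le.1 (hC M)
      have h4 := abs_le.1 (hC' (n ^ k * M))
      have hpos : (0 : ℤ) ≤ 2 ^ k * 3 ^ e := by positivity
      have h5 := mul_le_mul_of_nonneg_left h4.1 hpos
      have h6 := mul_le_mul_of_nonneg_left h4.2 hpos
      rw [mul_pow] at h3
      push_cast
      rw [abs_le]
      constructor <;> linarith [h3.1, h3.2]
  by_contra hk
  have h3 : 2 ∣ 3 ^ k := hPQ ▸ Dvd.dvd.mul_right (dvd_pow_self 2 hk) _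
  exact absurd (Nat.prime_two.dvd_of_dvd_pow h3) (by norm_num)

theorem eq_one_of_invariant_of_le (h : MultiplierRule n a b t p d c) (hab : b * a = a ^ n * b)
    (hn : 2 ≤ n) {i m : ℕ} {j : ℤ} (him : i ≤ m)
    (ht : ∀ x, t ((b ^ i)⁻¹ * a ^ j * b ^ m * x) = t x)
    (hd : ∀ x, d ((b ^ i)⁻¹ * a ^ j * b ^ m * x) = d x) : (b ^ i)⁻¹ * a ^ j * b ^ m = 1 := by
  obtain ⟨k, rfl⟩ := Nat.exists_eq_add_of_le him
  obtain rfl := h.level_eq_zero_of_invariant hab (by omega) hd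
  by_cases hj : j = 0
  · simp [hj]
  exfalso
  have hfin : FiniteMultiplicity (n : ℤ) j := Int.finiteMultiplicity_iff.2 ⟨by simp; omega, hj⟩
  obtain ⟨r, hr, hnr⟩ := hfin.exists_eq_pow_mul_and_not_dvd
  have h1 := h.colour_mul_zpow ((b ^ i)⁻¹ * b ^ multiplicity (n : ℤ) j) r
  rw [mul_assoc _ _ (a ^ r), mul_zpow_of_rel hab, ← hr,
    ← ht ((b ^ i)⁻¹ * b ^ multiplicity (n : ℤ) j)] at h1
  have h2 : (b ^ i)⁻¹ * a ^ j * b ^ (i + 0) * ((b ^ i)⁻¹ * b ^ multiplicity (n : ℤ) j) =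
      (b ^ i)⁻¹ * (a ^ j * b ^ multiplicity (n : ℤ) j) := by
    rw [add_zero]
    group
  rw [h2, sub_self, zero_sub, dvd_neg] at h1
  exact hnr h1

theorem eq_one_of_invariant (h : MultiplierRule n a b t p d c) (hab : b * a = a ^ n * b)
    (htop : Subgroup.closure {a, b} = ⊤) (hn : 2 ≤ n) {g : G} (ht : ∀ x, t (g * x) = t x)
    (hd : ∀ x, d (g * x) = d x) : g = 1 := by
  obtain ⟨i, j, m, rfl⟩ := exists_eq_inv_pow_mul_zpow_mul_pow hab htop g
  rcases le_total i m with him | him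
  · exact h.eq_one_of_invariant_of_le hab hn him ht hd
  · have hinv : ((b ^ i)⁻¹ * a ^ j * b ^ m)⁻¹ = (b ^ m)⁻¹ * a ^ (-j) * b ^ i := by group
    rw [← inv_eq_one, hinv]
    refine h.eq_one_of_invariant_of_le hab hn him (fun x => ?_) fun x => ?_
    · rw [← hinv, ← ht, mul_inv_cancel_left]
    · rw [← hinv, ← hd, mul_inv_cancel_left]

end MultiplierRule

/-- A bi-infinite orbit in `[2, 6]` of multiplications by `2` and `2 / 3`. -/
theorem exists_multiplier_orbit :
    ∃ (α : ℤ → ℝ) (q : ℤ → ℤ), (∀ l, 2 ≤ α l ∧ α l ≤ 6) ∧ (∀ l, q l = 2 ∨ q l = 6) ∧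
      ∀ l, α (l + 1) = q l / 3 * α l := by
  set θ : ℝ := Real.logb 3 2 with hθ
  have h3θ : (3 : ℝ) ^ θ = 2 := Real.rpow_logb (by norm_num) (by norm_num) (by norm_num)
  have hθ0 : 0 < θ := Real.logb_pos (by norm_num) (by norm_num)
  have hθ1 : θ < 1 := by
    rw [hθ, Real.logb_lt_iff_lt_rpow (by norm_num) (by norm_num)]
    norm_num
  set α : ℤ → ℝ := fun l => 2 * 3 ^ Int.fract (l * θ) with hα
  have hstep : ∀ l : ℤ, α (l + 1) = 2 * α l ∨ α (l + 1) = 2 / 3 * α l := fun l => by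
    have hf0 := Int.fract_nonneg ((l : ℝ) * θ)
    have hf1 := Int.fract_lt_one ((l : ℝ) * θ)
    have hl := Int.floor_add_fract ((l : ℝ) * θ)
    simp only [hα]
    by_cases hc : Int.fract (l * θ) + θ < 1
    · left
      have : Int.fract (((l + 1 : ℤ) : ℝ) * θ) = Int.fract (l * θ) + θ :=
        Int.fract_eq_iff.2 ⟨by linarith, hc, ⌊(l : ℝ) * θ⌋, by push_cast; linarith⟩
      rw [this, Real.rpow_add (by norm_num), h3θ]
      ring
    · right
      have : Int.fract (((l + 1 : ℤ) : ℝ) * θ) = Int.fract (l * θ) + θ - 1 :=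
        Int.fract_eq_iff.2 ⟨by linarith, by linarith, ⌊(l : ℝ) * θ⌋ + 1, by push_cast; linarith⟩
      rw [this, Real.rpow_sub (by norm_num), Real.rpow_add (by norm_num), h3θ, Real.rpow_one]
      ring
  have hq : ∀ l, ∃ q : ℤ, (q = 2 ∨ q = 6) ∧ α (l + 1) = q / 3 * α l := fun l =>
    (hstep l).elim (fun h => ⟨6, by simp, by rw [h]; norm_num⟩) fun h =>
      ⟨2, by simp, by simpa using h⟩
  choose q hq1 hq2 using hq
  refine ⟨α, q, fun l => ⟨?_, ?_⟩, hq1, hq2⟩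
  · have : (1 : ℝ) ≤ 3 ^ Int.fract ((l : ℝ) * θ) :=
      Real.one_le_rpow (by norm_num) (Int.fract_nonneg _)
    simp only [hα]
    linarith
  · have : (3 : ℝ) ^ Int.fract ((l : ℝ) * θ) ≤ 3 ^ (1 : ℝ) :=
      Real.rpow_le_rpow_of_exponent_le (by norm_num) (Int.fract_lt_one _).le
    rw [Real.rpow_one] at this
    simp only [hα]
    linarith

theorem exists_multiplierRule_of_coordinates {G : Type} [Group G] {n : ℕ} {a b : G} (hn : 0 < n)
    (s : G → ℝ) (l : G → ℤ) (hsa : ∀ g, s (g * a) = s g + 1) (hla : ∀ g, l (g * a) = l g)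
    (hsb : ∀ g, s (g * b) = s g / n) (hlb : ∀ g, l (g * b) = l g + 1) :
    ∃ t p d c : G → ℤ, MultiplierRule n a b t p d c ∧ ∀ g, 0 ≤ t g ∧ t g < n := by
  obtain ⟨α, q, hα, hq, hαq⟩ := exists_multiplier_orbit
  have hn' : (0 : ℝ) < n := by exact_mod_cast hn
  have hsp : ∀ g (i : ℕ), s (g * a ^ i) = s g + i := fun g i => by
    induction i with
    | zero => simp
    | succ i ih => rw [pow_succ, ← mul_assoc, hsa, ih]; push_cast; ring
  have hlp : ∀ g (i : ℕ), l (g * a ^ i) = l g := fun g i => by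
    induction i with
    | zero => simp
    | succ i ih => rw [pow_succ, ← mul_assoc, hla, ih]
  refine ⟨fun g => ⌊s g⌋ % n, fun g => q (l g),
    fun g => ⌊(s g + 1) * α (l g)⌋ - ⌊s g * α (l g)⌋,
    fun g => q (l g) * ⌊s g * α (l g)⌋ - 3 * n * ⌊s g / n * (q (l g) / 3 * α (l g))⌋,
    ⟨fun g => ?_, fun g => by rw [hla], fun g => hq _, fun g => ?_, fun g => ?_, fun g => ?_,
      fun g => ?_⟩, fun g => ⟨Int.emod_nonneg _ (by omega), Int.emod_lt_of_pos _ (by omega)⟩⟩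
  · simp only [hsa, Int.floor_add_one]
    have h1 := Int.emod_add_mul_ediv (⌊s g⌋ + 1) n
    have h2 := Int.emod_add_mul_ediv ⌊s g⌋ n
    exact ⟨⌊s g⌋ / n - (⌊s g⌋ + 1) / n, by linarith⟩
  · have h : ⌊s g * α (l g)⌋ + 2 ≤ ⌊(s g + 1) * α (l g)⌋ := by
      rw [Int.le_floor]
      push_cast
      linarith [Int.floor_le (s g * α (l g)), (hα (l g)).1]
    linarith
  · have h : ⌊(s g + 1) * α (l g)⌋ < ⌊s g * α (l g)⌋ + 7 := by
      rw [Int.floor_lt]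
      push_cast
      linarith [Int.lt_floor_add_one (s g * α (l g)), (hα (l g)).2]
    linarith
  · set z := s g * α (l g)
    have hz : s g / n * (q (l g) / 3 * α (l g)) * (3 * n) = q (l g) * z := by
      field_simp
      ring
    set w := s g / n * (q (l g) / 3 * α (l g))
    have h1 := Int.floor_le z
    have h2 := Int.lt_floor_add_one z
    have h3 := mul_le_mul_of_nonneg_right (Int.floor_le w) (by positivity : (0 : ℝ) ≤ 3 * n)
    have h4 := mul_le_mul_of_nonneg_right (Int.lt_floor_add_one w).le
      (by positivity : (0 : ℝ) ≤ 3 * n)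
    have h5 : |(q (l g) * ⌊z⌋ - 3 * n * ⌊w⌋ : ℝ)| ≤ 3 * n + 6 := by
      rw [abs_le]
      rcases hq (l g) with h | h <;> rw [h] at hz ⊢ <;> push_cast at hz ⊢ <;>
        constructor <;> linarith
    exact_mod_cast h5
  · have hsum : ∑ i ∈ Finset.range n, (⌊(s (g * a ^ i) + 1) * α (l (g * a ^ i))⌋ -
        ⌊s (g * a ^ i) * α (l (g * a ^ i))⌋) = ⌊(s g + n) * α (l g)⌋ - ⌊s g * α (l g)⌋ := by
      have := Finset.sum_range_sub (fun i : ℕ => ⌊(s g + i) * α (l g)⌋) n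
      simp only [hsp, hlp]
      simpa [add_assoc] using this
    have hdiv : (s g + n) / n = s g / n + 1 := by field_simp
    rw [hsum]
    simp only [hsp, hlp, hsb, hlb, hαq, hdiv]
    ring

/-- The affine representation `a ↦ (y ↦ y + 1)`, `b ↦ (y ↦ n y)` gives coordinates on
`BS(1,n)`. -/
theorem exists_BS_coordinates {n : ℕ} (hn : 0 < n) :
    ∃ (s : BS 1 n → ℝ) (l : BS 1 n → ℤ),
      (∀ g, s (g * PresentedGroup.of 0) = s g + 1) ∧ (∀ g, l (g * PresentedGroup.of 0) = l g) ∧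
      (∀ g, s (g * PresentedGroup.of 1) = s g / n) ∧
      (∀ g, l (g * PresentedGroup.of 1) = l g + 1) := by
  have hn' : (n : ℝ) ≠ 0 := by positivity
  set f : Fin 2 → Equiv.Perm ℝ := ![Equiv.addRight 1, Equiv.mulRight₀ (n : ℝ) hn'] with hf
  set e : Fin 2 → Multiplicative ℤ := ![1, Multiplicative.ofAdd 1] with he
  have hfr : ∀ r ∈ BSrel 1 n, FreeGroup.lift f r = 1 := by
    rintro _ rfl
    simp only [map_mul, map_inv, FreeGroup.lift_apply_of, zpow_one, zpow_natCast]
    rw [mul_inv_eq_one, mul_inv_eq_iff_eq_mul]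
    ext y
    simp [hf, Equiv.Perm.mul_apply]
    ring
  have her : ∀ r ∈ BSrel 1 n, FreeGroup.lift e r = 1 := by
    rintro _ rfl
    simp [he]
  refine ⟨fun g => -((PresentedGroup.toGroup hfr g)⁻¹ 0),
    fun g => Multiplicative.toAdd (PresentedGroup.toGroup her g), fun g => ?_, fun g => ?_,
    fun g => ?_, fun g => ?_⟩
  · simp [hf]
    ring
  · simp [he]
  · simp [hf]
    ring
  · simp [he]

theorem BS_rel (n : ℕ) : (PresentedGroup.of 1 * PresentedGroup.of 0 : BS 1 n) =
    PresentedGroup.of 0 ^ n * PresentedGroup.of 1 := by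
  have h : PresentedGroup.mk (BSrel 1 n) _ = 1 := PresentedGroup.one_of_mem rfl
  simp only [map_mul, map_inv, zpow_one, zpow_natCast] at h
  rw [mul_inv_eq_one, mul_inv_eq_iff_eq_mul] at h
  exact h

theorem BS_closure (n : ℕ) : Subgroup.closure {(PresentedGroup.of 0 : BS 1 n),
    PresentedGroup.of 1} = ⊤ := by
  rw [← PresentedGroup.closure_range_of (BSrel 1 n)]
  congr 1
  ext g
  simp [eq_comm]

theorem multiplierRule_is_SFT {G A : Type} [Group G] [Finite A] (n : ℕ) (a b : G)
    (τ π δ κ : A → ℤ) :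
    ∃ F : Set (Pattern G A), F.Finite ∧ ∀ x : G → A,
      x ∈ SFT F ↔ MultiplierRule n a b (τ ∘ x) (π ∘ x) (δ ∘ x) (κ ∘ x) := by
  classical
  obtain ⟨F, hF, h⟩ := exists_finite_forall_mem_SFT_iff (A := A)
    ({1, a, b, a ^ n} ∪ (Finset.range n).image (a ^ ·))
    (fun y => (n : ℤ) ∣ τ (y a) - τ (y 1) - 1 ∧ π (y a) = π (y 1) ∧ (π (y 1) = 2 ∨ π (y 1) = 6) ∧
      2 ≤ δ (y 1) ∧ δ (y 1) ≤ 6 ∧ |κ (y 1)| ≤ 3 * n + 6 ∧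
      π (y 1) * ∑ i ∈ Finset.range n, δ (y (a ^ i)) =
        3 * n * δ (y b) + κ (y (a ^ n)) - κ (y 1)) (fun x y hxy => by
      have hsum : ∑ i ∈ Finset.range n, δ (x (a ^ i)) = ∑ i ∈ Finset.range n, δ (y (a ^ i)) :=
        Finset.sum_congr rfl fun i hi => by
          rw [hxy _ (Finset.mem_union_right _ (Finset.mem_image_of_mem _ hi))]
      rw [hsum, hxy 1 (by simp), hxy a (by simp), hxy b (by simp), hxy (a ^ n) (by simp)])
  refine ⟨F, hF, fun x => (h x).trans ⟨fun hx => ?_, fun hx g => ?_⟩⟩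
  · simp only [mul_one] at hx
    exact ⟨fun g => (hx g).1, fun g => (hx g).2.1, fun g => (hx g).2.2.1,
      fun g => (hx g).2.2.2.1, fun g => (hx g).2.2.2.2.1, fun g => (hx g).2.2.2.2.2.1,
      fun g => (hx g).2.2.2.2.2.2⟩
  · simp only [mul_one]
    exact ⟨hx.colour g, hx.const g, hx.mult g, hx.two_le g, hx.le_six g, hx.carry g, hx.step g⟩

/-- The integers of absolute value at most `K`. -/
abbrev CenteredInterval (K : ℤ) : Type :=
  Finset.Icc (-K) K

/-- For every `n ≥ 2`, the group `BS(1,n)` admits a strongly aperiodic SFT. -/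
theorem BS1n_admits_strongly_aperiodic_SFT (n : ℤ) (hn : 2 ≤ n) :
    ∃ (A : Type) (_ : Fintype A) (F : Set (Pattern (BS 1 n) A)),
      F.Finite ∧ (SFT F).Nonempty ∧
      ∀ x ∈ SFT F, ∀ g : BS 1 n, (fun h => x (g⁻¹ * h)) = x → g = 1 := by
  lift n to ℕ using by omega
  have hn2 : 2 ≤ n := by exact_mod_cast hn
  obtain ⟨F, hF, h⟩ := multiplierRule_is_SFT 
    (A := CenteredInterval (3 * n + 6) × CenteredInterval (3 * n + 6) ×
      CenteredInterval (3 * n + 6) × CenteredInterval (3 * n + 6)) n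
    (PresentedGroup.of 0 : BS 1 n) (PresentedGroup.of 1)
    (fun v => v.1) (fun v => v.2.1) (fun v => v.2.2.1) (fun v => v.2.2.2)
  refine ⟨_, inferInstance, F, hF, ?_, fun x hx g hg => ?_⟩
  · obtain ⟨s, l, hsa, hla, hsb, hlb⟩ := exists_BS_coordinates (n := n) (by omega)
    obtain ⟨t, p, d, c, hr, ht⟩ :=
      exists_multiplierRule_of_coordinates (by omega) s l hsa hla hsb hlb
    refine ⟨fun g => ⟨⟨t g, ?_⟩, ⟨p g, ?_⟩, ⟨d g, ?_⟩, ⟨c g, ?_⟩⟩, (h _).2 hr⟩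
    · have := ht g
      rw [Finset.mem_Icc]
      omega
    · have := hr.mult g
      rw [Finset.mem_Icc]
      omega
    · have := hr.two_le g
      have := hr.le_six g
      rw [Finset.mem_Icc]
      omega
    · exact Finset.mem_Icc.2 (abs_le.1 (hr.carry g))
  · have hx' : ∀ y, x (g⁻¹ * y) = x y := congrFun hg
    rw [← inv_eq_one]
    exact ((h x).1 hx).eq_one_of_invariant (BS_rel n) (BS_closure n) hn2
      (fun y => by simp only [Function.comp_apply, hx']) fun y => by
        simp only [Function.comp_apply, hx']
end

section
/- For every integer n ≥ 2, the Baumslag–Solitar group BS(n,n) admits a strongly aperiodic subshift of finite type: there exist a finite alphabet A and a finite set F of forbidden patterns over BS(n,n) such that the SFT X_F is nonempty and every configuration in X_F has trivial stabilizer. -/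
/-! ### Subshifts of finite type from local rules -/

/-- A rule that only reads the cells of a finite window, over a finite alphabet, defines an SFT. -/
theorem exists_finite_SFT_of_local_rule {G A : Type} [Group G] [Finite A] (S : Finset G)
    (P : (G → A) → Prop) (hP : ∀ y y' : G → A, (∀ h ∈ S, y h = y' h) → P y → P y') :
    ∃ F : Set (Pattern G A), F.Finite ∧ ∀ x, x ∈ SFT F ↔ ∀ u, P fun h => x (u * h) := by
  refine ⟨Set.range fun q : {q : S → A // ∀ y : G → A, (∀ h : S, y h = q h) → ¬ P y} =>
    (⟨S, q.1⟩ : Pattern G A), Set.finite_range _, fun x => ⟨fun hx u => ?_, ?_⟩⟩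
  · by_contra hu
    refine hx ⟨S, fun h => x (u * h)⟩ ⟨⟨fun h => x (u * h), fun y hy hPy => hu ?_⟩, rfl⟩ ⟨u⁻¹, ?_⟩
    · exact hP _ _ (fun h hh => hy ⟨h, hh⟩) hPy
    · intro h
      simp
  · rintro hx _ ⟨⟨q, hq⟩, rfl⟩ ⟨g, hg⟩
    exact hq (fun h => x (g⁻¹ * h)) hg (hx g⁻¹)

/-! ### The tiles and their local rule -/

/-- A tile: `index` and `up` say that the outgoing edge of the current coset of `⟨a⟩` is reached
after `a ^ index`, and is followed along `b` or `b⁻¹`; `double` tells whether the number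
written on the row is multiplied by `2` or divided by `3` along that edge. -/
@[ext]
structure Tile (N : ℕ) where
  index : ZMod N
  up : Bool
  double : Bool
  digit : Finset.Icc (1 : ℤ) 6
  carry : Finset.Icc (-20 : ℤ) 20

instance (N : ℕ) [NeZero N] : Finite (Tile N) :=
  Finite.of_injective (fun t : Tile N => (t.index, t.up, t.double, t.digit, t.carry)) (by
    intro s t h
    simp only [Prod.mk.injEq] at h
    exact Tile.ext h.1 h.2.1 h.2.2.1 h.2.2.2.1 h.2.2.2.2)

section Flow

variable {G : Type} [Group G] {N : ℕ}

/-- The displacement along the outgoing edge described by a tile. -/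
def Tile.step (a b : G) (t : Tile N) : G :=
  a ^ t.index.val * if t.up then b else b⁻¹

/-- The element reached from `u` along the outgoing edge of its coset. -/
def flow (a b : G) (x : G → Tile N) (u : G) : G :=
  u * (x u).step a b

/-- The local rule: the outgoing edge depends only on the coset of `⟨a⟩`, every `b`-edge is the
outgoing edge of one of its endpoints, and rows are multiplied by `2` or `1 / 3` along the flow. -/
structure LocalRule (a b : G) (x : G → Tile N) (u : G) : Prop where
  index_mul : (x (u * a)).index = (x u).index - 1
  up_mul : (x (u * a)).up = (x u).up
  edge : ((x u).index = 0 ∧ (x u).up = true) ∨ ((x (u * b)).index = 0 ∧ (x (u * b)).up = false)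
  double_mul : (x (u * a ^ N)).double = (x u).double
  digit_flow : (if (x u).double then 1 else 3) * ((x (flow a b x u)).digit : ℤ) =
    (if (x u).double then 2 else 1) * ((x u).digit : ℤ) +
      ((x (u * a ^ N)).carry : ℤ) - ((x u).carry : ℤ)

theorem localRule_translate (a b : G) (x : G → Tile N) (u : G) :
    LocalRule a b (fun h => x (u * h)) 1 ↔ LocalRule a b x u := by
  constructor
  · rintro ⟨h1, h2, h3, h4, h5⟩
    simp only [flow, one_mul, mul_one] at h1 h2 h3 h4 h5
    exact ⟨h1, h2, h3, h4, h5⟩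
  · rintro ⟨h1, h2, h3, h4, h5⟩
    constructor <;> simp only [flow, one_mul, mul_one] <;> assumption

theorem LocalRule.congr [NeZero N] {a b : G} {x y : G → Tile N} (h₁ : x 1 = y 1) (ha : x a = y a)
    (hb : x b = y b) (hN : x (a ^ N) = y (a ^ N))
    (hs : ∀ t : Tile N, x (t.step a b) = y (t.step a b)) (h : LocalRule a b x 1) :
    LocalRule a b y 1 := by
  obtain ⟨h1, h2, h3, h4, h5⟩ := h
  simp only [flow, one_mul, h₁, ha, hb, hN, hs] at h1 h2 h3 h4 h5
  constructor <;> simp only [flow, one_mul] <;> assumption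

theorem exists_finite_SFT_localRule [NeZero N] (a b : G) :
    ∃ F : Set (Pattern G (Tile N)), F.Finite ∧ ∀ x, x ∈ SFT F ↔ ∀ u, LocalRule a b x u := by
  classical
  have := Fintype.ofFinite (Tile N)
  obtain ⟨F, hF, h⟩ := exists_finite_SFT_of_local_rule
    ({1, a, b, a ^ N} ∪ Finset.univ.image (fun t : Tile N => t.step a b))
    (fun y : G → Tile N => LocalRule a b y 1) (fun y y' hy => LocalRule.congr (N := N) (hy _ (by simp))
      (hy _ (by simp)) (hy _ (by simp)) (hy _ (by simp)) (fun t => hy _ (by simp)))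
  exact ⟨F, hF, fun x => by simp only [h, localRule_translate]⟩

/-! ### Rows of a tiling -/

theorem apply_mul_zpow_of_forall {β : Type*} {f : G → β} {z : G} (hf : ∀ u, f (u * z) = f u)
    (u : G) (j : ℤ) : f (u * z ^ j) = f u := by
  induction j with
  | zero => simp
  | succ k ih => rw [zpow_add_one, ← mul_assoc, hf, ih]
  | pred k ih => rw [← ih, ← hf (u * z ^ (-(k : ℤ) - 1)), mul_assoc, ← zpow_add_one]; simp

theorem exists_abs_sum_shift_sub_sum_le {s : ℤ → ℤ} {K : ℤ} (hs : ∀ t, |s t| ≤ K) (j : ℤ) :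
    ∃ B : ℤ, ∀ T : ℕ, |∑ t ∈ Finset.range T, s (t + j) - ∑ t ∈ Finset.range T, s t| ≤ B := by
  have key : ∀ (j : ℤ) (T : ℕ), ∑ t ∈ Finset.range T, s (t + (j + 1)) -
      ∑ t ∈ Finset.range T, s (t + j) = s (T + j) - s j := by
    intro j T
    induction T with
    | zero => simp
    | succ T ih =>
      rw [Finset.sum_range_succ, Finset.sum_range_succ]
      have : (T : ℤ) + (j + 1) = ((T + 1 : ℕ) : ℤ) + j := by push_cast; ring
      rw [this]
      linarith
  have key' : ∀ (j : ℤ) (T : ℕ), |∑ t ∈ Finset.range T, s (t + (j + 1)) -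
      ∑ t ∈ Finset.range T, s (t + j)| ≤ 2 * K := by
    intro j T
    rw [key]
    linarith [abs_sub (s (T + j)) (s j), hs (T + j), hs j]
  induction j with
  | zero => exact ⟨0, by simp⟩
  | succ k ih =>
    obtain ⟨B, hB⟩ := ih
    refine ⟨2 * K + B, fun T => ?_⟩
    have := abs_sub_le (∑ t ∈ Finset.range T, s (t + ((k : ℤ) + 1)))
      (∑ t ∈ Finset.range T, s (t + (k : ℤ))) (∑ t ∈ Finset.range T, s t)
    linarith [hB T, key' k T]
  | pred k ih =>
    obtain ⟨B, hB⟩ := ih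
    refine ⟨2 * K + B, fun T => ?_⟩
    have := abs_sub_le (∑ t ∈ Finset.range T, s (t + (-(k : ℤ) - 1)))
      (∑ t ∈ Finset.range T, s (t + -(k : ℤ))) (∑ t ∈ Finset.range T, s t)
    have h2 := key' (-(k : ℤ) - 1) T
    rw [sub_add_cancel, abs_sub_comm] at h2
    linarith [hB T]

theorem three_pow_ne_two_pow {i j : ℕ} (h : 0 < i + j) : (3 : ℤ) ^ j ≠ 2 ^ i := by
  intro h'
  have hodd : Odd ((3 : ℤ) ^ j) := Odd.pow (by decide)
  rcases Nat.eq_zero_or_pos i with rfl | hi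
  · rw [pow_zero] at h'
    have := one_lt_pow₀ (by norm_num : (1 : ℤ) < 3) (by omega : j ≠ 0)
    omega
  · rw [h'] at hodd
    exact (Int.not_even_iff_odd.2 hodd) ((by decide : Even (2 : ℤ)).pow_of_ne_zero hi.ne')

variable {a b : G} {x : G → Tile N}

theorem index_mul_pow (hx : ∀ u, LocalRule a b x u) (u : G) (k : ℕ) :
    (x (u * a ^ k)).index = (x u).index - k := by
  induction k with
  | zero => simp
  | succ k ih =>
    rw [pow_succ, ← mul_assoc, (hx _).index_mul, ih]
    push_cast
    ring

theorem up_mul_pow (hx : ∀ u, LocalRule a b x u) (u : G) (k : ℕ) :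
    (x (u * a ^ k)).up = (x u).up := by
  induction k with
  | zero => simp
  | succ k ih => rw [pow_succ, ← mul_assoc, (hx _).up_mul, ih]

theorem flow_mul_pow_zpow (hx : ∀ u, LocalRule a b x u) (hz : ∀ g, Commute (a ^ N) g) (u : G)
    (j : ℤ) : flow a b x (u * (a ^ N) ^ j) = flow a b x u * (a ^ N) ^ j := by
  have hi := apply_mul_zpow_of_forall (f := fun u => (x u).index) (z := a ^ N)
    (fun u => by simp [index_mul_pow hx]) u j
  have hu := apply_mul_zpow_of_forall (f := fun u => (x u).up) (z := a ^ N)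
    (fun u => up_mul_pow hx u N) u j
  simp only [flow, Tile.step] at hi hu ⊢
  rw [hi, hu, mul_assoc, mul_assoc, ((hz _).zpow_left j).eq]

theorem flow_iterate_mul_pow_zpow (hx : ∀ u, LocalRule a b x u) (hz : ∀ g, Commute (a ^ N) g)
    (m : ℕ) (u : G) (j : ℤ) :
    (flow a b x)^[m] (u * (a ^ N) ^ j) = (flow a b x)^[m] u * (a ^ N) ^ j := by
  induction m generalizing u with
  | zero => rfl
  | succ m ih => rw [Function.iterate_succ_apply, Function.iterate_succ_apply,
      flow_mul_pow_zpow hx hz, ih]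

theorem sum_digit_flow (hx : ∀ u, LocalRule a b x u) (hz : ∀ g, Commute (a ^ N) g) (u : G)
    (T : ℕ) :
    (if (x u).double then 1 else 3) *
        ∑ t ∈ Finset.range T, ((x (flow a b x u * (a ^ N) ^ (t : ℤ))).digit : ℤ) =
      (if (x u).double then 2 else 1) *
        ∑ t ∈ Finset.range T, ((x (u * (a ^ N) ^ (t : ℤ))).digit : ℤ) +
        ((x (u * (a ^ N) ^ (T : ℤ))).carry : ℤ) - ((x u).carry : ℤ) := by
  induction T with
  | zero => simp
  | succ T ih =>
    rw [Finset.sum_range_succ, Finset.sum_range_succ, mul_add, ih, ← flow_mul_pow_zpow hx hz]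
    have hd := apply_mul_zpow_of_forall (f := fun u => (x u).double) (z := a ^ N)
      (fun u => (hx u).double_mul) u T
    have h := (hx (u * (a ^ N) ^ (T : ℤ))).digit_flow
    rw [hd] at h
    rw [h]
    push_cast
    rw [mul_assoc u, ← zpow_add_one]
    ring

theorem exists_sum_digit_flow_iterate (hx : ∀ u, LocalRule a b x u)
    (hz : ∀ g, Commute (a ^ N) g) (u : G) (m : ℕ) :
    ∃ (i j : ℕ) (B : ℤ), i + j = m ∧ ∀ T : ℕ,
      |3 ^ j * ∑ t ∈ Finset.range T, ((x ((flow a b x)^[m] u * (a ^ N) ^ (t : ℤ))).digit : ℤ) -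
        2 ^ i * ∑ t ∈ Finset.range T, ((x (u * (a ^ N) ^ (t : ℤ))).digit : ℤ)| ≤ B := by
  induction m with
  | zero => exact ⟨0, 0, 0, rfl, by simp⟩
  | succ m ih =>
    obtain ⟨i, j, B, hij, hB⟩ := ih
    set v := (flow a b x)^[m] u with hv
    have hc : ∀ g, -20 ≤ ((x g).carry : ℤ) ∧ ((x g).carry : ℤ) ≤ 20 :=
      fun g => Finset.mem_Icc.1 (x g).carry.2
    simp only [Function.iterate_succ_apply', ← hv]
    have hs := sum_digit_flow hx hz v
    have h3 : (0 : ℤ) < 3 ^ j := by positivity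
    rcases hd : (x v).double with _ | _
    · refine ⟨i, j + 1, B + 3 ^ j * 40, by omega, fun T => ?_⟩
      have hs := hs T
      simp only [hd, Bool.false_eq_true, if_false, one_mul] at hs
      rw [pow_succ, mul_assoc, hs]
      have h1 := abs_le.1 (hB T)
      have h2 := hc v
      have h4 := hc (v * (a ^ N) ^ (T : ℤ))
      rw [abs_le]
      constructor <;> nlinarith
    · refine ⟨i + 1, j, 2 * B + 3 ^ j * 40, by omega, fun T => ?_⟩
      have hs := hs T
      simp only [hd, if_true, one_mul] at hs
      rw [hs, pow_succ]
      have h1 := abs_le.1 (hB T)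
      have h2 := hc v
      have h4 := hc (v * (a ^ N) ^ (T : ℤ))
      rw [abs_le]
      constructor <;> nlinarith

/-- Following the flow never leads back to a translate of the initial row. -/
theorem not_forall_digit_flow_iterate_eq (hx : ∀ u, LocalRule a b x u)
    (hz : ∀ g, Commute (a ^ N) g) (u : G) {m : ℕ} (hm : 0 < m) (k : ℤ) :
    ¬ ∀ t : ℤ, (x ((flow a b x)^[m] u * (a ^ N) ^ t)).digit = (x (u * (a ^ N) ^ (t + k))).digit := by
  intro h
  obtain ⟨i, j, B, hij, hB⟩ := exists_sum_digit_flow_iterate hx hz u m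
  have hd : ∀ g, 1 ≤ ((x g).digit : ℤ) ∧ ((x g).digit : ℤ) ≤ 6 :=
    fun g => Finset.mem_Icc.1 (x g).digit.2
  obtain ⟨B', hB'⟩ := exists_abs_sum_shift_sub_sum_le
    (s := fun t : ℤ => ((x (u * (a ^ N) ^ t)).digit : ℤ)) (K := 6)
    (fun t => abs_le.2 ⟨by linarith [(hd (u * (a ^ N) ^ t)).1], (hd _).2⟩) k
  simp only [h] at hB
  have hne := three_pow_ne_two_pow (i := i) (j := j) (by omega)
  set T : ℕ := (B + 3 ^ j * B' + 1).toNat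
  have hT : B + 3 ^ j * B' + 1 ≤ (T : ℤ) := Int.self_le_toNat _
  have h1 := abs_le.1 (hB T)
  have h2 := abs_le.1 (hB' T)
  set S := ∑ t ∈ Finset.range T, ((x (u * (a ^ N) ^ (t : ℤ))).digit : ℤ)
  set S' := ∑ t ∈ Finset.range T, ((x (u * (a ^ N) ^ ((t : ℤ) + k))).digit : ℤ)
  have hS : (T : ℤ) ≤ S := by
    have := Finset.card_nsmul_le_sum (Finset.range T)
      (fun t : ℕ => ((x (u * (a ^ N) ^ (t : ℤ))).digit : ℤ)) 1 (fun t _ => (hd _).1)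
    simpa only [Finset.card_range, nsmul_eq_mul, mul_one] using this
  have h3 : (0 : ℤ) < 3 ^ j := by positivity
  have hT0 : (0 : ℤ) ≤ T := by positivity
  have h4 : 3 ^ j * (S' - S) ≤ 3 ^ j * B' := by gcongr; exact h2.2
  have h5 : 3 ^ j * (-B') ≤ 3 ^ j * (S' - S) := by gcongr; exact h2.1
  rcases lt_or_gt_of_ne hne with hlt | hlt
  · have : 1 * S ≤ (2 ^ i - 3 ^ j) * S := mul_le_mul_of_nonneg_right (by omega) (by omega)
    linarith
  · have : 1 * S ≤ (3 ^ j - 2 ^ i) * S := mul_le_mul_of_nonneg_right (by omega) (by omega)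
    linarith

/-! ### Coalescence of the flow and aperiodicity -/

/-- The flow lines of `u` and `v` eventually pass through the same coset of `⟨a ^ N⟩`. -/
def Coalesce (a b : G) (x : G → Tile N) (u v : G) : Prop :=
  ∃ (k l : ℕ) (j : ℤ), (flow a b x)^[k] u * (a ^ N) ^ j = (flow a b x)^[l] v

theorem Coalesce.symm {u v : G} : Coalesce a b x u v → Coalesce a b x v u := by
  rintro ⟨k, l, j, h⟩
  exact ⟨l, k, -j, by rw [← h, mul_assoc, ← zpow_add]; simp⟩

theorem Coalesce.trans (hx : ∀ u, LocalRule a b x u) (hz : ∀ g, Commute (a ^ N) g) {u v w : G} :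
    Coalesce a b x u v → Coalesce a b x v w → Coalesce a b x u w := by
  rintro ⟨k, l, j, h⟩ ⟨k', l', j', h'⟩
  refine ⟨k' + k, l + l', j + j', ?_⟩
  rw [Function.iterate_add_apply, Function.iterate_add_apply, ← h',
    flow_iterate_mul_pow_zpow hx hz, zpow_add, ← mul_assoc, ← flow_iterate_mul_pow_zpow hx hz, h,
    ← Function.iterate_add_apply, ← Function.iterate_add_apply, add_comm]

theorem coalesce_mul_a [NeZero N] (hx : ∀ u, LocalRule a b x u) (hz : ∀ g, Commute (a ^ N) g)
    (u : G) : Coalesce a b x u (u * a) := by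
  have hdvd : (N : ℤ) ∣ (((x u).index - 1).val + 1 : ℤ) - ((x u).index.val : ℤ) := by
    rw [← ZMod.intCast_eq_intCast_iff_dvd_sub]
    push_cast
    simp
  obtain ⟨j, hj⟩ := hdvd
  refine ⟨1, 1, j, ?_⟩
  simp only [Function.iterate_one, flow, Tile.step, (hx u).index_mul, (hx u).up_mul]
  have : a * a ^ ((x u).index - 1).val = a ^ (x u).index.val * (a ^ N) ^ j := by
    rw [← pow_succ', ← zpow_natCast, ← zpow_natCast a (ZMod.val _), ← zpow_natCast a N,
      ← zpow_mul, ← hj, ← zpow_add]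
    push_cast
    congr 1
    ring
  rw [mul_assoc, mul_assoc, mul_assoc, ← mul_assoc a, this, mul_assoc, ((hz _).zpow_left j).eq]

theorem coalesce_mul_b (hx : ∀ u, LocalRule a b x u) (u : G) : Coalesce a b x u (u * b) := by
  rcases (hx u).edge with ⟨h, h'⟩ | ⟨h, h'⟩
  · exact ⟨1, 0, 0, by simp [flow, Tile.step, h, h']⟩
  · exact ⟨0, 1, 0, by simp [flow, Tile.step, h, h']⟩

theorem coalesce_one [NeZero N] (hx : ∀ u, LocalRule a b x u) (hz : ∀ g, Commute (a ^ N) g)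
    (hab : Subgroup.closure {a, b} = ⊤) (g : G) : Coalesce a b x 1 g := by
  have hs : ∀ s ∈ ({a, b} : Set G), ∀ u, Coalesce a b x u (u * s) := by
    rintro s (rfl | rfl) u
    · exact coalesce_mul_a hx hz u
    · exact coalesce_mul_b hx u
  have hg : g ∈ Subgroup.closure {a, b} := hab ▸ Subgroup.mem_top g
  induction hg using Subgroup.closure_induction_right with
  | one => exact ⟨0, 0, 0, by simp⟩
  | mul_right u _ s h ih => exact ih.trans hx hz (hs s h u)
  | mul_inv_cancel u _ s h ih => exact ih.trans hx hz (by simpa using (hs s h (u * s⁻¹)).symm)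

theorem flow_iterate_mul_left {g : G} (hg : ∀ h, x (g * h) = x h) (m : ℕ) (u : G) :
    (flow a b x)^[m] (g * u) = g * (flow a b x)^[m] u := by
  induction m generalizing u with
  | zero => rfl
  | succ m ih =>
    rw [Function.iterate_succ_apply, Function.iterate_succ_apply, ← ih, flow, flow, hg, mul_assoc]

theorem zpow_eq_zero_of_period (hx : ∀ u, LocalRule a b x u) (hz : ∀ g, Commute (a ^ N) g)
    {j : ℤ} (hj : ∀ h, x ((a ^ N) ^ j * h) = x h) : j = 0 := by
  by_contra hj0
  have hper : ∀ u : G, ∀ t : ℤ, x (u * (a ^ N) ^ t) = x (u * (a ^ N) ^ (t % j)) := by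
    intro u t
    have := apply_mul_zpow_of_forall (f := x) (z := (a ^ N) ^ j)
      (fun u => by rw [← ((hz u).zpow_left j).eq, hj]) (u * (a ^ N) ^ (t % j)) (t / j)
    rw [← this, mul_assoc, ← zpow_mul, ← zpow_add, Int.emod_add_mul_ediv]
  obtain ⟨i, i', hne, heq⟩ := Finite.exists_ne_map_eq_of_infinite
    (fun (i : ℕ) (t : Fin j.natAbs) => (x ((flow a b x)^[i] 1 * (a ^ N) ^ (t : ℤ))).digit)
  wlog hlt : i < i' generalizing i i'
  · exact this i' i hne.symm heq.symm (by omega)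
  refine not_forall_digit_flow_iterate_eq hx hz ((flow a b x)^[i] 1) (m := i' - i) (by omega) 0
    fun t => ?_
  rw [← Function.iterate_add_apply, Nat.sub_add_cancel hlt.le, add_zero, hper, hper _ t]
  have h0 := Int.emod_nonneg t hj0
  have h1 := Int.emod_lt_abs t hj0
  have := congrFun heq ⟨(t % j).toNat, by rw [Int.abs_eq_natAbs] at h1; omega⟩
  simp only [Int.toNat_of_nonneg h0] at this
  exact this.symm

theorem eq_one_of_period [NeZero N] (hx : ∀ u, LocalRule a b x u) (hz : ∀ g, Commute (a ^ N) g)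
    (hab : Subgroup.closure {a, b} = ⊤) {g : G} (hg : ∀ h, x (g * h) = x h) : g = 1 := by
  obtain ⟨k, l, j, h⟩ := coalesce_one hx hz hab g
  have hgl := flow_iterate_mul_left (a := a) (b := b) hg l 1
  rw [mul_one] at hgl
  rw [hgl] at h
  rcases lt_trichotomy k l with hkl | rfl | hkl
  · obtain ⟨m, rfl⟩ := Nat.exists_eq_add_of_lt hkl
    refine absurd (fun t => ?_) (not_forall_digit_flow_iterate_eq hx hz ((flow a b x)^[k] 1)
      (m := m + 1) (by omega) j)
    rw [← Function.iterate_add_apply, show m + 1 + k = k + m + 1 by omega, ← hg, ← mul_assoc, ← h,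
      mul_assoc, ← zpow_add, add_comm j]
  · have : g = (a ^ N) ^ j := by
      rw [← ((hz _).zpow_left j).eq] at h
      exact (mul_right_cancel h).symm
    subst this
    rw [zpow_eq_zero_of_period hx hz hg, zpow_zero]
  · obtain ⟨m, rfl⟩ := Nat.exists_eq_add_of_lt hkl
    refine absurd (fun t => ?_) (not_forall_digit_flow_iterate_eq hx hz ((flow a b x)^[l] 1)
      (m := m + 1) (by omega) (-j))
    rw [← Function.iterate_add_apply, show m + 1 + l = l + m + 1 by omega,
      ← hg (_ * (a ^ N) ^ (t + -j)), ← mul_assoc, ← h, mul_assoc _ ((a ^ N) ^ j), ← zpow_add]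
    congr 4
    ring

end Flow

/-! ### A valid tiling -/

/-- Multiplication by `2` or `1 / 3` as a permutation of `[1, 6)`. -/
def scale : Equiv.Perm (Set.Ico (1 : ℚ) 6) where
  toFun r := if h : (r : ℚ) < 3 then
      ⟨2 * r, by obtain ⟨r, h1, h2⟩ := r; constructor <;> simp only at * <;> linarith⟩
    else ⟨r / 3, by obtain ⟨r, h1, h2⟩ := r; constructor <;> simp only at * <;> linarith⟩
  invFun r := if h : (r : ℚ) < 2 then
      ⟨3 * r, by obtain ⟨r, h1, h2⟩ := r; constructor <;> simp only at * <;> linarith⟩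
    else ⟨r / 2, by obtain ⟨r, h1, h2⟩ := r; constructor <;> simp only at * <;> linarith⟩
  left_inv := by
    rintro ⟨r, h1, h2⟩
    by_cases h : r < 3
    · have : ¬ 2 * r < 2 := by linarith
      simp [h, this]
    · have : r / 3 < 2 := by linarith
      simp only [h, this, dite_true, dite_false]
      exact Subtype.ext (by ring)
  right_inv := by
    rintro ⟨r, h1, h2⟩
    by_cases h : r < 2
    · have : ¬ 3 * r < 3 := by linarith
      simp [h, this]
    · have : r / 2 < 3 := by linarith
      simp only [h, this, dite_true, dite_false]
      exact Subtype.ext (by ring)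

theorem scale_mul (r : Set.Ico (1 : ℚ) 6) :
    (if (r : ℚ) < 3 then 1 else 3) * (scale r : ℚ) = (if (r : ℚ) < 3 then 2 else 1) * (r : ℚ) := by
  by_cases h : (r : ℚ) < 3
  · simp [scale, h]
  · simp only [scale, Equiv.coe_fn_mk, h, dite_false, if_false]
    ring

/-- Infinite reduced words: the ends of the Bass–Serre tree of `BS(N, N)`. -/
def EndWord (N : ℕ) : Type :=
  {w : ℕ → ZMod N × Bool // ∀ k, (w k).1 = 0 → (w k).2 = (w (k + 1)).2}

namespace EndWord

variable {N : ℕ}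

/-- Remove the first letter. -/
def tail (w : EndWord N) : EndWord N :=
  ⟨fun k => w.1 (k + 1), fun k => w.2 (k + 1)⟩

/-- Add a first letter. -/
def cons (c : ZMod N × Bool) (w : EndWord N) (h : c.1 = 0 → c.2 = (w.1 0).2) : EndWord N :=
  ⟨fun k => Nat.casesOn k c w.1, fun k => by cases k with
    | zero => exact h
    | succ k => exact w.2 k⟩

theorem cons_tail (w : EndWord N) (c : ZMod N × Bool) (hc : c = w.1 0)
    (h : c.1 = 0 → c.2 = (w.tail.1 0).2) :
    cons c w.tail h = w := by
  subst hc
  apply Subtype.ext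
  funext k
  cases k <;> rfl

end EndWord

/-- A vertex of the tree seen from an end, together with a slot and a position on its row. -/
@[ext]
structure TreeState (N : ℕ) where
  value : Set.Ico (1 : ℚ) 6
  word : EndWord N
  slot : ZMod N
  pos : ℤ

namespace TreeState

variable {N : ℕ}

/-- Right multiplication by `a`. -/
def rotate : Equiv.Perm (TreeState N) where
  toFun s := ⟨s.value, s.word, s.slot + 1, s.pos + 1⟩
  invFun s := ⟨s.value, s.word, s.slot - 1, s.pos - 1⟩
  left_inv s := by simp
  right_inv s := by simp

theorem rotate_pow (k : ℕ) (s : TreeState N) :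
    (rotate ^ k) s = ⟨s.value, s.word, s.slot + k, s.pos + k⟩ := by
  induction k with
  | zero => simp
  | succ k ih =>
    rw [pow_succ', Equiv.Perm.mul_apply, ih]
    simp [rotate, add_assoc]

/-- Cross the edge at the current slot, along `b` if `e` holds and along `b⁻¹` otherwise. -/
def cross (e : Bool) (s : TreeState N) : TreeState N :=
  if h : s.slot = 0 ∧ (s.word.1 0).2 = e then
    ⟨scale s.value, s.word.tail, (s.word.1 0).1, s.pos⟩
  else
    ⟨scale.symm s.value, s.word.cons (s.slot, !e) (fun h0 => by
      rcases e <;> simp_all), 0, s.pos⟩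

theorem cross_not_cross (e : Bool) (s : TreeState N) : cross (!e) (cross e s) = s := by
  by_cases h : s.slot = 0 ∧ (s.word.1 0).2 = e
  · have h' : ¬ ((s.word.1 0).1 = 0 ∧ (s.word.tail.1 0).2 = !e) := by
      rintro ⟨h1, h2⟩
      have := s.word.2 0 h1
      rw [h.2] at this
      change (s.word.1 1).2 = !e at h2
      rw [zero_add, h2] at this
      simp at this
    rw [cross, cross]
    simp only [h, and_self, dite_true]
    rw [dif_neg h']
    ext1
    · simp
    · exact EndWord.cons_tail s.word ((s.word.1 0).1, !!e) (by simp [← h.2]) (fun h0 => by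
        rw [Bool.not_not]
        exact h.2.symm.trans (s.word.2 0 h0))
    · exact h.1.symm
    · rfl
  · rw [cross, cross, dif_neg h]
    rw [dif_pos ⟨rfl, rfl⟩]
    ext1
    · simp
    · rfl
    · rfl
    · rfl

/-- Right multiplication by `b`. -/
def crossPerm : Equiv.Perm (TreeState N) where
  toFun := cross true
  invFun := cross false
  left_inv := cross_not_cross true
  right_inv := cross_not_cross false

theorem cross_rotate_pow_card (e : Bool) (s : TreeState N) :
    cross e ((rotate ^ N) s) = (rotate ^ N) (cross e s) := by
  simp only [rotate_pow, CharP.cast_eq_zero, add_zero]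
  by_cases h : s.slot = 0 ∧ (s.word.1 0).2 = e
  · simp [cross, h]
  · simp [cross, h]

/-- The phase of the digit sequence of the row. -/
def phase (s : TreeState N) : ℚ := s.pos * s.value / N

/-- The phase after moving along the outgoing edge. -/
def nextPhase (s : TreeState N) : ℚ := (s.pos + (-s.slot).val : ℤ) * scale s.value / N

theorem carry_mem [NeZero N] (s : TreeState N) :
    (if (s.value : ℚ) < 3 then 1 else 3) * ⌊s.nextPhase⌋ -
      (if (s.value : ℚ) < 3 then 2 else 1) * ⌊s.phase⌋ ∈ Finset.Icc (-20 : ℤ) 20 := by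
  have hN : (0 : ℚ) < N := by exact_mod_cast Nat.pos_of_ne_zero (NeZero.ne N)
  have hi : ((-s.slot).val : ℚ) / N ≤ 1 := by
    rw [div_le_one hN]
    exact_mod_cast (ZMod.val_lt _).le
  have hi0 : 0 ≤ ((-s.slot).val : ℚ) / N := by positivity
  set i : ℚ := ((-s.slot).val : ℚ) / N with hidef
  obtain ⟨hv1, hv2⟩ := s.value.2
  have hiv : i * s.value ≤ 6 := by nlinarith
  have hiv0 : 0 ≤ i * s.value := by nlinarith
  have hp : (if (s.value : ℚ) < 3 then 1 else 3) * s.nextPhase =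
      (if (s.value : ℚ) < 3 then 2 else 1) * (s.phase + i * s.value) := by
    have := scale_mul s.value
    have e1 : (if (s.value : ℚ) < 3 then 1 else 3) * s.nextPhase =
      (s.pos + (-s.slot).val : ℤ) / N *
        ((if (s.value : ℚ) < 3 then 1 else 3) * (scale s.value : ℚ)) := by
      rw [nextPhase]; ring
    rw [e1, this, phase, hidef]
    push_cast
    ring
  have f1 := Int.floor_le s.nextPhase
  have f2 := Int.lt_floor_add_one s.nextPhase
  have f3 := Int.floor_le s.phase
  have f4 := Int.lt_floor_add_one s.phase
  rw [Finset.mem_Icc]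
  split_ifs at hp ⊢
  · constructor
    · have : (-20 : ℚ) ≤ ((1 * ⌊s.nextPhase⌋ - 2 * ⌊s.phase⌋ : ℤ) : ℚ) := by
        push_cast; linarith
      exact_mod_cast this
    · have : ((1 * ⌊s.nextPhase⌋ - 2 * ⌊s.phase⌋ : ℤ) : ℚ) ≤ 20 := by
        push_cast; linarith
      exact_mod_cast this
  · constructor
    · have : (-20 : ℚ) ≤ ((3 * ⌊s.nextPhase⌋ - 1 * ⌊s.phase⌋ : ℤ) : ℚ) := by
        push_cast; linarith
      exact_mod_cast this
    · have : ((3 * ⌊s.nextPhase⌋ - 1 * ⌊s.phase⌋ : ℤ) : ℚ) ≤ 20 := by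
        push_cast; linarith
      exact_mod_cast this

theorem digit_mem (s : TreeState N) :
    ⌊s.phase + s.value⌋ - ⌊s.phase⌋ ∈ Finset.Icc (1 : ℤ) 6 := by
  obtain ⟨hv1, hv2⟩ := s.value.2
  have f3 := Int.floor_le s.phase
  have f4 := Int.lt_floor_add_one s.phase
  have h1 : ⌊s.phase⌋ + 1 ≤ ⌊s.phase + s.value⌋ := by
    rw [Int.le_floor]; push_cast; linarith
  have h2 : ⌊s.phase + s.value⌋ < ⌊s.phase⌋ + 7 := by
    rw [Int.floor_lt]; push_cast; linarith
  rw [Finset.mem_Icc]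
  omega

/-- The tile displayed at a state. -/
def tile [NeZero N] (s : TreeState N) : Tile N where
  index := -s.slot
  up := (s.word.1 0).2
  double := decide ((s.value : ℚ) < 3)
  digit := ⟨_, s.digit_mem⟩
  carry := ⟨_, s.carry_mem⟩

theorem phase_rotate_pow_card [NeZero N] (s : TreeState N) :
    ((rotate ^ N) s).phase = s.phase + s.value := by
  have hN : (N : ℚ) ≠ 0 := by exact_mod_cast NeZero.ne N
  rw [rotate_pow, phase, phase]
  push_cast
  field_simp

theorem nextPhase_rotate_pow_card [NeZero N] (s : TreeState N) :
    ((rotate ^ N) s).nextPhase = s.nextPhase + scale s.value := by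
  have hN : (N : ℚ) ≠ 0 := by exact_mod_cast NeZero.ne N
  rw [rotate_pow, nextPhase, nextPhase]
  simp only [CharP.cast_eq_zero, add_zero]
  push_cast
  field_simp
  ring

theorem cross_rotate_pow_index [NeZero N] (s : TreeState N) :
    cross s.tile.up ((rotate ^ s.tile.index.val) s) =
      ⟨scale s.value, s.word.tail, (s.word.1 0).1, s.pos + (-s.slot).val⟩ := by
  simp [rotate_pow, tile, cross]

/-- A function into states that follows right multiplication yields a valid tiling. -/
theorem localRule_tile [NeZero N] {G : Type} [Group G] {a b : G} {σ : G → TreeState N}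
    (ha : ∀ u, σ (u * a) = rotate (σ u)) (hb : ∀ u, σ (u * b) = cross true (σ u)) (u : G) :
    LocalRule a b (fun g => (σ g).tile) u := by
  have hpow : ∀ (k : ℕ) (u : G), σ (u * a ^ k) = (rotate ^ k) (σ u) := by
    intro k u
    induction k with
    | zero => simp
    | succ k ih => rw [pow_succ, ← mul_assoc, ha, ih, pow_succ', Equiv.Perm.mul_apply]
  have hb' : ∀ u, σ (u * b⁻¹) = cross false (σ u) := by
    intro u
    have := cross_not_cross true (σ (u * b⁻¹))
    rw [← hb, inv_mul_cancel_right] at this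
    exact this.symm
  have hflow : σ (flow a b (fun g => (σ g).tile) u) =
      ⟨scale (σ u).value, (σ u).word.tail, ((σ u).word.1 0).1,
        (σ u).pos + (-(σ u).slot).val⟩ := by
    rw [← cross_rotate_pow_index, ← hpow, flow, Tile.step, ← mul_assoc]
    rcases (σ u).tile.up
    · simp [hb']
    · simp [hb]
  constructor
  · simp only [ha, tile, rotate, Equiv.coe_fn_mk]
    ring
  · simp only [ha, tile, rotate, Equiv.coe_fn_mk]
  · simp only [hb]
    by_cases h : (σ u).slot = 0 ∧ ((σ u).word.1 0).2 = true
    · exact Or.inl ⟨by simp [tile, h], h.2⟩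
    · refine Or.inr ?_
      rw [cross, dif_neg h]
      exact ⟨neg_zero, rfl⟩
  · simp only [hpow, tile, rotate_pow]
  · simp only [hflow, hpow]
    simp only [tile, phase_rotate_pow_card, nextPhase_rotate_pow_card]
    simp only [rotate_pow, decide_eq_true_eq]
    have : (⟨scale (σ u).value, (σ u).word.tail, ((σ u).word.1 0).1,
        (σ u).pos + (-(σ u).slot).val⟩ : TreeState N).phase = (σ u).nextPhase := rfl
    rw [this]
    ring

end TreeState

theorem exists_localRule_of_BS (N : ℕ) [NeZero N] :
    ∃ x : BS N N → Tile N, ∀ u,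
      LocalRule (PresentedGroup.of 0 : BS N N) (PresentedGroup.of 1) x u := by
  let ρ : Fin 2 → Equiv.Perm (TreeState N) :=
    ![TreeState.rotate⁻¹, TreeState.crossPerm⁻¹]
  have hcomm : Commute (TreeState.crossPerm (N := N)) (TreeState.rotate ^ N) :=
    Equiv.ext (TreeState.cross_rotate_pow_card true)
  have hρ : ∀ r ∈ BSrel N N, FreeGroup.lift ρ r = 1 := by
    rintro r rfl
    simp only [map_mul, map_inv, zpow_natCast, map_pow, FreeGroup.lift_apply_of]
    have h : Commute (ρ 1) (ρ 0 ^ N) := by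
      simp only [ρ, Matrix.cons_val_zero, Matrix.cons_val_one, inv_pow]
      exact hcomm.inv_inv
    rw [h.eq]
    group
  let ψ : BS N N →* Equiv.Perm (TreeState N) := PresentedGroup.toGroup hρ
  let s₀ : TreeState N :=
    ⟨⟨1, by norm_num⟩, ⟨fun _ => (0, true), fun _ _ => rfl⟩, 0, 0⟩
  refine ⟨_, TreeState.localRule_tile (σ := fun g => (ψ g)⁻¹ s₀) (fun u => ?_) (fun u => ?_)⟩
  · have : ψ (PresentedGroup.of 0) = TreeState.rotate⁻¹ := PresentedGroup.toGroup.of hρ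
    rw [map_mul, mul_inv_rev, this, inv_inv, Equiv.Perm.mul_apply]
  · have : ψ (PresentedGroup.of 1) = TreeState.crossPerm⁻¹ := PresentedGroup.toGroup.of hρ
    rw [map_mul, mul_inv_rev, this, inv_inv, Equiv.Perm.mul_apply]
    rfl

theorem BS_closure_eq_top (m n : ℤ) :
    Subgroup.closure {(PresentedGroup.of 0 : BS m n), PresentedGroup.of 1} = ⊤ := by
  rw [← PresentedGroup.closure_range_of (BSrel m n)]
  congr 1
  ext g
  simp [Fin.exists_fin_two, eq_comm]

theorem BS_commute_pow (N : ℕ) (g : BS N N) :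
    Commute ((PresentedGroup.of 0 : BS N N) ^ N) g := by
  have hrel : (PresentedGroup.of 1 : BS N N) * PresentedGroup.of 0 ^ N * (PresentedGroup.of 1)⁻¹ *
      (PresentedGroup.of 0 ^ N)⁻¹ = 1 := by
    have := PresentedGroup.one_of_mem (rels := BSrel N N) rfl
    simp only [map_mul, map_inv, zpow_natCast, map_pow] at this
    exact this
  have hb : Commute ((PresentedGroup.of 0 : BS N N) ^ N) (PresentedGroup.of 1) :=
    (mul_inv_eq_iff_eq_mul.1 (mul_inv_eq_one.1 hrel)).symm
  have hg : g ∈ Subgroup.closure {(PresentedGroup.of 0 : BS N N), PresentedGroup.of 1} :=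
    BS_closure_eq_top N N ▸ Subgroup.mem_top g
  induction hg using Subgroup.closure_induction with
  | mem s hs =>
    rcases hs with rfl | rfl
    · exact (Commute.refl _).pow_left N
    · exact hb
  | one => exact Commute.one_right _
  | mul _ _ _ _ h h' => exact h.mul_right h'
  | inv _ _ h => exact h.inv_right

/-- For every `n ≥ 2`, the group `BS(n,n)` admits a strongly aperiodic SFT. -/
theorem BSnn_admits_strongly_aperiodic_SFT (n : ℤ) (hn : 2 ≤ n) :
    ∃ (A : Type) (_ : Fintype A) (F : Set (Pattern (BS n n) A)),
      F.Finite ∧ (SFT F).Nonempty ∧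
      ∀ x ∈ SFT F, ∀ g : BS n n, (fun h => x (g⁻¹ * h)) = x → g = 1 := by
  obtain ⟨N, rfl⟩ := Int.eq_ofNat_of_zero_le (by omega : 0 ≤ n)
  have : NeZero N := ⟨by omega⟩
  obtain ⟨F, hF, hmem⟩ := exists_finite_SFT_localRule (N := N)
    (PresentedGroup.of 0 : BS N N) (PresentedGroup.of 1)
  obtain ⟨x, hx⟩ := exists_localRule_of_BS N
  refine ⟨Tile N, Fintype.ofFinite _, F, hF, ⟨x, (hmem x).2 hx⟩, fun y hy g hg => ?_⟩
  exact inv_eq_one.1 (eq_one_of_period ((hmem y).1 hy) (BS_commute_pow N) (BS_closure_eq_top N N)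
    (congrFun hg))
end

section
/- Let m,n be nonzero integers with |m| ≥ 2 or |n| ≥ 2, and suppose |m| = 1 or |n| = 1 or |m| = |n| (i.e. BS(m,n) is residually finite). Then BS(m,n) admits a strongly aperiodic SFT, and BS(m,n) also admits an SFT that is weakly aperiodic but not strongly aperiodic (nonempty, every configuration has infinite orbit, and some configuration has a nontrivial stabilizer). -/
/-! ### Local rules define subshifts of finite type -/

/-- A function of a configuration that only depends on finitely many cells. -/
def IsLocal {G A β : Type} (f : (G → A) → β) : Prop :=
  ∃ W : Finset G, ∀ z z' : G → A, (∀ w ∈ W, z w = z' w) → f z = f z'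

namespace IsLocal

variable {G A β γ δ : Type}

lemma eval (w : G) : IsLocal (fun z : G → A => z w) :=
  ⟨{w}, fun _ _ h => h w (by simp)⟩

lemma comp {f : (G → A) → β} (φ : β → γ) (hf : IsLocal f) : IsLocal (fun z => φ (f z)) := by
  obtain ⟨W, hW⟩ := hf
  exact ⟨W, fun z z' h => congrArg φ (hW z z' h)⟩

lemma comp₂ {f : (G → A) → β} {g : (G → A) → γ} (φ : β → γ → δ) (hf : IsLocal f)
    (hg : IsLocal g) : IsLocal (fun z => φ (f z) (g z)) := by
  classical
  obtain ⟨W, hW⟩ := hf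
  obtain ⟨W', hW'⟩ := hg
  refine ⟨W ∪ W', fun z z' h => ?_⟩
  dsimp only
  rw [hW z z' fun w hw => h w (by simp [hw]), hW' z z' fun w hw => h w (by simp [hw])]

lemma and {P Q : (G → A) → Prop} (hP : IsLocal P) (hQ : IsLocal Q) :
    IsLocal (fun z => P z ∧ Q z) := comp₂ And hP hQ

lemma sum {ι : Type} (s : Finset ι) {f : ι → (G → A) → ℤ} (hf : ∀ i, IsLocal (f i)) :
    IsLocal (fun z => ∑ i ∈ s, f i z) := by
  classical
  choose W hW using hf
  refine ⟨s.biUnion W, fun z z' h => Finset.sum_congr rfl fun i hi => hW i z z' fun w hw => ?_⟩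
  exact h w (Finset.mem_biUnion.2 ⟨i, hi, hw⟩)

end IsLocal

lemma exists_SFT_eq_of_isLocal {G A : Type} [Group G] [Finite A] {P : (G → A) → Prop}
    (hP : IsLocal P) :
    ∃ F : Set (Pattern G A), F.Finite ∧ SFT F = {x | ∀ g, P (fun h => x (g * h))} := by
  obtain ⟨W, hW⟩ := hP
  refine ⟨(fun d : W → A => (⟨W, d⟩ : Pattern G A)) ''
    {d | ∃ z : G → A, (∀ w : W, z w = d w) ∧ ¬ P z}, (Set.toFinite _).image _, ?_⟩
  ext x
  constructor
  · intro hx g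
    by_contra hg
    refine hx _ ⟨fun w => x (g * w), ⟨fun h => x (g * h), fun _ => rfl, hg⟩, rfl⟩ ⟨g⁻¹, ?_⟩
    intro h
    simp
  · rintro hx p ⟨d, ⟨z, hz, hPz⟩, rfl⟩ ⟨g, hg⟩
    refine hPz ?_
    rw [hW z (fun h => x (g⁻¹ * h))]
    · exact hx g⁻¹
    · intro w hw
      rw [hz ⟨w, hw⟩]
      exact (hg ⟨w, hw⟩).symm

/-! ### Baumslag–Solitar pairs -/

/-- The elements `a` and `b` exhibit `G` as the Baumslag–Solitar group `BS(m,n)`. -/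
structure IsBS {G : Type} [Group G] (m n : ℤ) (a b : G) : Prop where
  rel : b * a ^ m * b⁻¹ = a ^ n
  gen : Subgroup.closure {a, b} = ⊤
  lift : ∀ (H : Type) [Group H] (α β : H), β * α ^ m * β⁻¹ = α ^ n →
    ∃ φ : G →* H, φ a = α ∧ φ b = β

lemma isBS_presentedGroup (m n : ℤ) :
    IsBS m n (PresentedGroup.of 0 : BS m n) (PresentedGroup.of 1) where
  rel := by
    have h : PresentedGroup.mk (BSrel m n)
        (FreeGroup.of 1 * FreeGroup.of 0 ^ m * (FreeGroup.of 1)⁻¹ * (FreeGroup.of 0 ^ n)⁻¹) = 1 :=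
      PresentedGroup.one_of_mem rfl
    simp only [map_mul, map_inv, map_zpow] at h
    exact mul_inv_eq_one.1 h
  gen := by
    rw [← PresentedGroup.closure_range_of (BSrel m n)]
    congr 1
    ext x
    simp [eq_comm]
  lift H _ α β h := by
    have hr : ∀ r ∈ BSrel m n, FreeGroup.lift ![α, β] r = 1 := by
      rintro r rfl
      simpa using mul_inv_eq_one.2 h
    exact ⟨PresentedGroup.toGroup hr, by simp, by simp⟩

namespace IsBS

variable {G : Type} [Group G] {m n : ℤ} {a b : G}

lemma swap (h : IsBS m n a b) : IsBS n m a b⁻¹ where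
  rel := by rw [← h.rel]; group
  gen := by
    rw [← top_le_iff, ← h.gen, Subgroup.closure_le]
    rintro x (rfl | rfl)
    · exact Subgroup.subset_closure (by simp)
    · exact inv_inv x ▸ inv_mem (Subgroup.subset_closure (by simp))
  lift H _ α β hr := by
    obtain ⟨φ, ha, hb⟩ := h.lift H α β⁻¹ (by rw [← hr]; group)
    exact ⟨φ, ha, by simp [hb]⟩

lemma zpow_mul_comm (h : IsBS m n a b) (t : ℤ) : a ^ (n * t) * b = b * a ^ (m * t) := by
  rw [zpow_mul, ← h.rel, conj_zpow, zpow_mul]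
  group

lemma zpow_mul_inv_comm (h : IsBS m n a b) (t : ℤ) :
    a ^ (m * t) * b⁻¹ = b⁻¹ * a ^ (n * t) := by
  rw [mul_inv_eq_iff_eq_mul, mul_assoc, h.zpow_mul_comm, inv_mul_cancel_left]

/-- Two permutations satisfying the defining relation yield a right action of `G`; this is the
orbit map of a point. -/
lemma exists_orbitMap (h : IsBS m n a b) {X : Type} (α β : Equiv.Perm X)
    (hr : α ^ m * β = β * α ^ n) (x₀ : X) :
    ∃ π : G → X, π 1 = x₀ ∧ (∀ g, π (g * a) = α (π g)) ∧ (∀ g, π (g * b) = β (π g)) ∧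
      ∀ g, π g = x₀ → ∀ k, π (g * k) = π k := by
  have hr' : β⁻¹ * α ^ m * β = α ^ n := by rw [mul_assoc, hr, inv_mul_cancel_left]
  obtain ⟨φ, ha, hb⟩ := h.lift (Equiv.Perm X) α⁻¹ β⁻¹ (by
    rw [inv_zpow, inv_zpow, inv_inv, ← hr']; group)
  refine ⟨fun g => φ g⁻¹ x₀, by simp, fun g => ?_, fun g => ?_, fun g hg k => ?_⟩
  · simp [ha]
  · simp [hb]
  · have : φ g⁻¹ x₀ = x₀ := hg
    simp only [mul_inv_rev, map_mul, Equiv.Perm.mul_apply, this]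

end IsBS

/-! ### Weakly but not strongly aperiodic subshifts -/

/-- `G` admits a weakly but not strongly aperiodic SFT. -/
def HasWeakNotStrongSFT (G : Type) [Group G] : Prop :=
  ∃ (A : Type) (_ : Fintype A) (F : Set (Pattern G A)),
    F.Finite ∧ (SFT F).Nonempty ∧
    (∀ x ∈ SFT F, {y : G → A | ∃ g : G, y = fun h => x (g⁻¹ * h)}.Infinite) ∧
    (∃ x ∈ SFT F, ∃ g : G, g ≠ 1 ∧ (fun h => x (g⁻¹ * h)) = x)

/-- `G` admits a strongly aperiodic SFT. -/
def HasStrongSFT (G : Type) [Group G] : Prop :=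
  ∃ (A : Type) (_ : Fintype A) (F : Set (Pattern G A)),
    F.Finite ∧ (SFT F).Nonempty ∧ ∀ x ∈ SFT F, ∀ g : G, (fun h => x (g⁻¹ * h)) = x → g = 1

lemma exists_pow_period_of_finite_orbit {G A : Type} [Group G] {x : G → A}
    (hx : {y : G → A | ∃ g : G, y = fun h => x (g⁻¹ * h)}.Finite) (r : G) :
    ∃ k : ℕ, 0 < k ∧ ∀ h, x (r ^ k * h) = x h := by
  have := hx.to_subtype
  obtain ⟨i, j, hij, h⟩ := Finite.exists_ne_map_eq_of_infinite
    (fun i : ℕ => (⟨fun h => x (r ^ i * h), (r ^ i)⁻¹, by simp⟩ :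
      {y : G → A | ∃ g : G, y = fun h => x (g⁻¹ * h)}))
  have key : ∀ i j : ℕ, i < j → (∀ h, x (r ^ i * h) = x (r ^ j * h)) →
      ∃ k : ℕ, 0 < k ∧ ∀ h, x (r ^ k * h) = x h := by
    intro i j hlt h
    refine ⟨j - i, by omega, fun k => ?_⟩
    have := h ((r ^ i)⁻¹ * k)
    rw [mul_inv_cancel_left, ← mul_assoc, ← pow_sub r hlt.le] at this
    exact this.symm
  have h' : ∀ k, x (r ^ i * k) = x (r ^ j * k) := fun k => congrFun (Subtype.ext_iff.1 h) k
  rcases lt_or_gt_of_ne hij with hlt | hlt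
  · exact key i j hlt h'
  · exact key j i hlt fun k => (h' k).symm

lemma hasWeakNotStrongSFT_of_isLocal {G A : Type} [Group G] [Finite A] {P : (G → A) → Prop}
    (hP : IsLocal P)
    (hinf : ∀ x : G → A, (∀ g, P (fun h => x (g * h))) →
      (∀ r : G, ∃ k : ℕ, 0 < k ∧ ∀ h, x (r ^ k * h) = x h) → False)
    (hex : ∃ x : G → A, (∀ g, P (fun h => x (g * h))) ∧ ∃ g : G, g ≠ 1 ∧ ∀ h, x (g * h) = x h) :
    HasWeakNotStrongSFT G := by
  obtain ⟨F, hF, hFP⟩ := exists_SFT_eq_of_isLocal hP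
  obtain ⟨x, hx, g, hg, hgx⟩ := hex
  refine ⟨A, Fintype.ofFinite A, F, hF, ⟨x, hFP ▸ hx⟩, fun y hy hfin => ?_,
    x, hFP ▸ hx, g⁻¹, inv_ne_one.2 hg, ?_⟩
  · rw [hFP] at hy
    exact hinf y hy (exists_pow_period_of_finite_orbit hfin)
  · funext h
    simpa using hgx h

lemma hasStrongSFT_of_isLocal {G A : Type} [Group G] [Finite A] {P : (G → A) → Prop}
    (hP : IsLocal P) (hex : ∃ x : G → A, ∀ g, P (fun h => x (g * h)))
    (hap : ∀ x : G → A, (∀ g, P (fun h => x (g * h))) →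
      ∀ g, (∀ h, x (g * h) = x h) → g = 1) :
    HasStrongSFT G := by
  obtain ⟨F, hF, hFP⟩ := exists_SFT_eq_of_isLocal hP
  obtain ⟨x, hx⟩ := hex
  refine ⟨A, Fintype.ofFinite A, F, hF, ⟨x, hFP ▸ hx⟩, fun y hy g hg => ?_⟩
  rw [hFP] at hy
  exact inv_eq_one.1 (hap y hy g⁻¹ fun h => congrFun hg h)

lemma map_mul_zpow_of_map_mul {G : Type} [Group G] {a : G} {N : ℕ} {c : G → ZMod N}
    (hc : ∀ g, c (g * a) = c g + 1) (g : G) (i : ℤ) : c (g * a ^ i) = c g + i := by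
  induction i with
  | zero => simp
  | succ i ih => rw [zpow_add_one, ← mul_assoc, hc, ih]; push_cast; ring
  | pred i ih =>
    have := hc (g * a ^ (-(i : ℤ) - 1))
    rw [mul_assoc, ← zpow_add_one, sub_add_cancel, ih] at this
    rw [← sub_eq_iff_eq_add.2 this]; push_cast; ring

lemma exists_map_mul_zpow_eq_zero {G : Type} [Group G] {a : G} {N : ℕ} {c : G → ZMod N}
    (hc : ∀ g, c (g * a) = c g + 1) (g : G) : ∃ i : ℤ, c (g * a ^ i) = 0 := by
  obtain ⟨i, hi⟩ := ZMod.intCast_surjective (-c g)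
  exact ⟨i, by rw [map_mul_zpow_of_map_mul hc, hi, add_neg_cancel]⟩

lemma map_mul_zpow_of_invariant {G β : Type} [Group G] {a : G} {f : G → β}
    (hf : ∀ g, f (g * a) = f g) (g : G) (i : ℤ) : f (g * a ^ i) = f g := by
  induction i with
  | zero => simp
  | succ i ih => rw [zpow_add_one, ← mul_assoc, hf, ih]
  | pred i ih =>
    rw [← hf, mul_assoc, ← zpow_add_one, sub_add_cancel, ih]

/-! #### The case `BS(±1,n)`: a hierarchical marking of the `a`-rows -/

lemma round_div_intCast {N : ℤ} (hN : 2 ≤ |N|) {s : ℚ} {q : ℤ} (h : round s = N * q) :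
    round (s / N) = q := by
  have hN' : (2 : ℚ) ≤ |(N : ℚ)| := by exact_mod_cast hN
  have hN0 : (N : ℚ) ≠ 0 := by
    rintro h0
    rw [h0] at hN'
    norm_num at hN'
  have h1 := abs_sub_round s
  rw [h] at h1
  push_cast at h1
  have h2 : |s / N - q| ≤ 1 / 4 := by
    have : s / N - q = (s - N * q) / N := by field_simp
    rw [this, abs_div, div_le_iff₀ (by linarith)]
    linarith
  rw [round_eq, Int.floor_eq_iff]
  rw [abs_le] at h2
  constructor <;> linarith [h2.1, h2.2]

/-- No row of the hierarchical marking is periodic. -/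
lemma not_periodic_of_hierarchy {G : Type} [Group G] {a b : G} {N : ℤ} (hN : 2 ≤ |N|)
    (hrel : ∀ t : ℤ, a ^ (N * t) * b = b * a ^ t)
    {c : G → ZMod N.natAbs} {y : G → Bool} (hc : ∀ g, c (g * a) = c g + 1)
    (h0 : ∀ g, c g ≠ 0 → y g = false) (h1 : ∀ g, c g = 0 → y g = !y (g * b))
    (k : ℤ) (hk : k ≠ 0) (g : G) (hper : ∀ i : ℤ, y (g * a ^ (i + k)) = y (g * a ^ i)) :
    False := by
  have hdvd : ∀ j : ℤ, (j : ZMod N.natAbs) = 0 ↔ N ∣ j := fun j => by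
    rw [ZMod.intCast_zmod_eq_zero_iff_dvd, Int.natAbs_dvd]
  induction hd : k.natAbs using Nat.strong_induction_on generalizing k g with
  | _ d ih =>
  subst hd
  obtain ⟨i, hi⟩ := exists_map_mul_zpow_eq_zero hc g
  have hci : ∀ j : ℤ, c (g * a ^ i * a ^ (N * j)) = 0 := fun j => by
    rw [map_mul_zpow_of_map_mul hc, hi, zero_add, hdvd]
    exact dvd_mul_right _ _
  have hyb : ∀ j : ℤ, y (g * a ^ i * b * a ^ j) = !y (g * a ^ (i + N * j)) := fun j => by
    rw [zpow_add, ← mul_assoc, h1 _ (hci j), Bool.not_not, mul_assoc (g * a ^ i) _ b, hrel,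
      ← mul_assoc]
  by_cases hNk : N ∣ k
  · obtain ⟨k', rfl⟩ := hNk
    have hk' : k' ≠ 0 := right_ne_zero_of_mul hk
    refine ih k'.natAbs ?_ k' hk' (g * a ^ i * b) (fun j => ?_) rfl
    · rw [Int.natAbs_mul]
      have : 2 ≤ N.natAbs := by rw [Int.abs_eq_natAbs] at hN; omega
      have : 0 < k'.natAbs := by omega
      nlinarith
    · rw [hyb, hyb, mul_add, ← add_assoc, hper]
  · have hz : ∀ j : ℤ, y (g * a ^ i * b * a ^ j) = true := fun j => by
      rw [hyb, ← hper, h0, Bool.not_false]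
      rw [zpow_add, ← mul_assoc, zpow_add, ← mul_assoc, map_mul_zpow_of_map_mul hc, hci, zero_add,
        Ne, hdvd]
      exact hNk
    obtain ⟨j, hj⟩ := exists_map_mul_zpow_eq_zero hc (g * a ^ i * b)
    have := hz (j + 1)
    rw [h0] at this
    · exact Bool.false_ne_true this
    · rw [zpow_add_one, ← mul_assoc, hc, hj, zero_add]
      have h := hdvd 1
      rw [Int.cast_one] at h
      rw [Ne, h]
      intro h2
      have := Int.le_of_dvd one_pos ((abs_dvd _ _).2 h2)
      omega

lemma exists_parity (N : ℤ) (hN : 2 ≤ |N|) :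
    ∃ v : ℤ → Bool, (∀ r, ¬ N ∣ r → v r = false) ∧ ∀ r, r ≠ 0 → v (N * r) = !v r := by
  refine ⟨fun r => decide (Odd (multiplicity N r)), fun r hr => ?_, fun r hr => ?_⟩
  · simp [multiplicity_eq_zero.2 hr]
  · have hfin : FiniteMultiplicity N r := by
      rw [Int.finiteMultiplicity_iff]
      exact ⟨by rw [Int.abs_eq_natAbs] at hN; omega, hr⟩
    have : multiplicity N (N * r) = multiplicity N r + 1 := by
      refine multiplicity_eq_of_dvd_of_not_dvd ?_ ?_
      · rw [pow_succ']
        exact mul_dvd_mul_left _ (pow_multiplicity_dvd _ _)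
      · rw [pow_succ', mul_dvd_mul_iff_left (by rintro rfl; simp at hN)]
        exact hfin.not_pow_dvd_of_multiplicity_lt (Nat.lt_succ_self _)
    by_cases ho : Odd (multiplicity N r) <;> simp [this, Nat.odd_add_one, ho]

lemma IsBS.hasWeakNotStrongSFT_of_abs_eq_one {G : Type} [Group G] {m n : ℤ} {a b : G}
    (h : IsBS m n a b) (hm : |m| = 1) (hn : 2 ≤ |n|) : HasWeakNotStrongSFT G := by
  have hmm : m * m = 1 := by
    rw [← abs_mul_abs_self, hm, one_mul]
  obtain ⟨N, hNdef⟩ : ∃ N, N = n * m := ⟨_, rfl⟩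
  have hN : 2 ≤ |N| := by rw [hNdef, abs_mul, hm, mul_one]; exact hn
  have hN0 : N ≠ 0 := by rintro rfl; simp at hN
  have : NeZero N.natAbs := ⟨Int.natAbs_ne_zero.2 hN0⟩
  have hrel : ∀ t : ℤ, a ^ (N * t) * b = b * a ^ t := fun t => by
    rw [hNdef, mul_assoc, h.zpow_mul_comm, ← mul_assoc m, hmm, one_mul]
  refine hasWeakNotStrongSFT_of_isLocal (A := ZMod N.natAbs × Bool)
    (P := fun z => (z a).1 = (z 1).1 + 1 ∧ ((z 1).1 ≠ 0 → (z 1).2 = false) ∧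
      ((z 1).1 = 0 → (z 1).2 = !(z b).2)) ?_ ?_ ?_
  · exact .and (.comp₂ (fun u v : ZMod N.natAbs × Bool => u.1 = v.1 + 1) (.eval a) (.eval 1))
      (.and (.comp (fun u : ZMod N.natAbs × Bool => u.1 ≠ 0 → u.2 = false) (.eval 1))
        (.comp₂ (fun u v : ZMod N.natAbs × Bool => u.1 = 0 → u.2 = !v.2) (.eval 1) (.eval b)))
  · intro x hx hper
    simp only [mul_one] at hx
    obtain ⟨k, hk, hxk⟩ := hper a
    refine not_periodic_of_hierarchy hN hrel (c := fun g => (x g).1) (y := fun g => (x g).2)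
      (fun g => (hx g).1) (fun g => (hx g).2.1) (fun g => (hx g).2.2) k (by exact_mod_cast hk.ne')
      1 fun i => ?_
    rw [one_mul, one_mul, add_comm, zpow_add, zpow_natCast, hxk]
  · obtain ⟨v, hv0, hv1⟩ := exists_parity N hN
    have hNQ : ((N : ℚ))⁻¹ ≠ 0 := inv_ne_zero (by exact_mod_cast hN0)
    let α : Equiv.Perm (ℚ × ZMod 2) := (Equiv.addRight (1 : ℚ)).prodCongr (Equiv.refl _)
    let β : Equiv.Perm (ℚ × ZMod 2) :=
      (Equiv.mulRight₀ (N : ℚ)⁻¹ hNQ).prodCongr (Equiv.addRight 1)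
    have hα : ∀ (k : ℤ) (s : ℚ × ZMod 2), (α ^ k) s = (s.1 + k, s.2) := fun k => by
      induction k with
      | zero => simp
      | succ k ih =>
        intro s
        rw [zpow_add_one, Equiv.Perm.mul_apply, ih]
        simp [α]; ring
      | pred k ih =>
        intro s
        rw [zpow_sub_one, Equiv.Perm.mul_apply, ih]
        simp [α, Equiv.Perm.inv_def]; ring
    have hr : α ^ m * β = β * α ^ n := by
      ext1 s
      rw [Equiv.Perm.mul_apply, Equiv.Perm.mul_apply, hα, hα]
      have hnN : (n : ℚ) = N * m := by
        rw [hNdef]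
        exact_mod_cast (by rw [mul_assoc, hmm, mul_one] : n = n * m * m)
      have : (N : ℚ) ≠ 0 := by exact_mod_cast hN0
      simp only [β, Equiv.prodCongr_apply, Prod.map, Equiv.coe_addRight, Equiv.mulRight₀_apply,
        Prod.mk.injEq, and_true, hnN]
      field_simp
    obtain ⟨π, hπ1, hπa, hπb, hπs⟩ := h.exists_orbitMap α β hr (0, 0)
    have hbool : ∀ l : ZMod 2, decide (l = 0) = !decide (l + 1 = 0) := by decide
    refine ⟨fun g => ((round (π g).1 : ZMod N.natAbs),
      if round (π g).1 = 0 then decide ((π g).2 = 0) else v (round (π g).1)), ?_, ?_⟩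
    · intro g
      simp only [mul_one, hπa, hπb]
      have hdvd : ((round (π g).1 : ℤ) : ZMod N.natAbs) = 0 ↔ N ∣ round (π g).1 := by
        rw [ZMod.intCast_zmod_eq_zero_iff_dvd, Int.natAbs_dvd]
      refine ⟨?_, fun h0 => ?_, fun h0 => ?_⟩
      · simp [α]
      · rw [Ne, hdvd] at h0
        rw [if_neg (by rintro h; exact h0 (h ▸ dvd_zero _)), hv0 _ h0]
      · rw [hdvd] at h0
        obtain ⟨q, hq⟩ := h0
        have hq' : round ((π g).1 * (N : ℚ)⁻¹) = q := round_div_intCast hN hq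
        simp only [β, Equiv.prodCongr_apply, Prod.map, Equiv.coe_addRight, Equiv.mulRight₀_apply,
          hq', hq]
        by_cases hq0 : q = 0
        · simp only [hq0, mul_zero, if_true]
          exact hbool _
        · rw [if_neg (mul_ne_zero hN0 hq0), if_neg hq0, hv1 q hq0]
    · have hb2 : π (b * b) = (0, 0) := by
        have h1 := hπb 1
        rw [one_mul, hπ1] at h1
        rw [hπb, h1]
        simp only [β, Equiv.prodCongr_apply, Prod.map, Equiv.coe_addRight, Equiv.mulRight₀_apply,
          zero_mul]
        rfl
      refine ⟨b * b, fun hb => ?_, fun k => ?_⟩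
      · obtain ⟨φ, -, hφ⟩ := h.lift (Multiplicative ℤ) 1 (Multiplicative.ofAdd 1) (by simp)
        have h1 : φ (b * b) = 1 := by rw [hb, map_one]
        rw [map_mul, hφ, ← ofAdd_add, ofAdd_eq_one] at h1
        norm_num at h1
      · simp only [hπs _ hb2]

/-! #### The case `BS(n,±n)`: orienting the Bass–Serre tree towards an end -/

/-- The edge between the rows of `g` and `g * b` leaves a row with marking `(c, dir)` upwards. -/
def IsUp {p : ℕ} (s : ZMod p × Bool) : Prop := s.2 = true ∧ s.1 = 0

/-- The edge between the rows of `g * b⁻¹` and `g` leaves a row with marking `(c, dir)`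
downwards. -/
def IsDown {p : ℕ} (s : ZMod p × Bool) : Prop := s.2 = false ∧ s.1 = 0

lemma exists_orientation (p : ℕ) (hp : 2 ≤ p) :
    ∃ α β : Equiv.Perm ((ℕ × Bool) × ZMod p), α ^ p = 1 ∧ (∀ x, α x = (x.1, x.2 + 1)) ∧
      ∀ x, IsUp (x.2, x.1.2) ↔ ¬ IsDown ((β x).2, (β x).1.2) := by
  classical
  have : NeZero p := ⟨by omega⟩
  have : Fact (1 < p) := ⟨by omega⟩
  let X := (ℕ × Bool) × ZMod p
  let T : X → Prop := fun x => IsUp (x.2, x.1.2)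
  let T' : X → Prop := fun x => ¬ IsDown (x.2, x.1.2)
  have inf : ∀ (q : X → Prop) (e : Bool) (i : ZMod p), (∀ k : ℕ, q ((k, e), i)) →
      Infinite {x // q x} := fun q e i hq =>
    Infinite.of_injective (fun k : ℕ => (⟨((k, e), i), hq k⟩ : {x // q x}))
      fun k l hkl => congrArg (fun x => x.1.1.1) hkl
  have : Infinite {x // T x} := inf _ true 0 fun k => ⟨rfl, rfl⟩
  have : Infinite {x // ¬ T x} := inf _ false 0 fun k h => by simpa using h.1
  have : Infinite {x // T' x} := inf _ true 0 fun k h => by simpa using h.1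
  have : Infinite {x // ¬ T' x} := inf _ false 0 fun k h => h ⟨rfl, rfl⟩
  obtain ⟨e₁⟩ : Nonempty ({x // T x} ≃ {x // T' x}) := nonempty_equiv_of_countable
  obtain ⟨e₂⟩ : Nonempty ({x // ¬ T x} ≃ {x // ¬ T' x}) := nonempty_equiv_of_countable
  let α : Equiv.Perm X := (Equiv.refl _).prodCongr (Equiv.addRight (1 : ZMod p))
  have hα : ∀ (k : ℕ) (x : X), (α ^ k) x = (x.1, x.2 + k) := fun k => by
    induction k with
    | zero => simp
    | succ k ih =>
      intro x
      rw [pow_succ, Equiv.Perm.mul_apply, ih]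
      change (x.1, x.2 + 1 + (k : ZMod p)) = _
      push_cast
      rw [add_assoc, add_comm 1]
  refine ⟨α, Equiv.subtypeCongr e₁ e₂, ?_, fun x => rfl, fun x => ?_⟩
  · ext1 x
    rw [hα]
    simp
  · change T x ↔ T' _
    by_cases hx : T x
    · simp only [hx, true_iff]
      rw [Equiv.subtypeCongr, Equiv.trans_apply, Equiv.trans_apply]
      rw [Equiv.sumCompl_symm_apply_of_pos hx]
      exact (e₁ ⟨x, hx⟩).2
    · simp only [hx, false_iff]
      rw [Equiv.subtypeCongr, Equiv.trans_apply, Equiv.trans_apply]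
      rw [Equiv.sumCompl_symm_apply_of_neg hx]
      exact (e₂ ⟨x, hx⟩).2

lemma addRight_one_zpow_apply (k : ℤ) (x : ℝ) : (Equiv.addRight (1 : ℝ) ^ k) x = x + k := by
  induction k generalizing x with
  | zero => simp
  | succ k ih =>
    rw [zpow_add_one, Equiv.Perm.mul_apply, ih, Equiv.coe_addRight]
    push_cast
    ring
  | pred k ih =>
    rw [zpow_sub_one, Equiv.Perm.mul_apply, ih]
    change x + -1 + _ = _
    push_cast
    ring

/-- The affine coordinate on the rows: `a` acts as `s ↦ s + 1` and `b` as `s ↦ (m / n) s`. -/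
lemma IsBS.exists_affine {G : Type} [Group G] {m n : ℤ} {a b : G} (h : IsBS m n a b)
    (hm : m ≠ 0) (hn : n ≠ 0) :
    ∃ s : G → ℝ, s 1 = 0 ∧ (∀ g, s (g * a) = s g + 1) ∧ ∀ g, s (g * b) = s g * (m / n) := by
  have hm' : (m : ℝ) ≠ 0 := by exact_mod_cast hm
  have hn' : (n : ℝ) ≠ 0 := by exact_mod_cast hn
  obtain ⟨π, h1, h2, h3, -⟩ := h.exists_orbitMap (Equiv.addRight (1 : ℝ))
    (Equiv.mulRight₀ ((m : ℝ) / n) (div_ne_zero hm' hn')) (by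
      ext x
      simp only [Equiv.Perm.mul_apply, addRight_one_zpow_apply, Equiv.mulRight₀_apply]
      field_simp) 0
  exact ⟨π, h1, h2, h3⟩

lemma map_mul_zpow_of_map_mul_add_one {G : Type} [Group G] {a : G} {s : G → ℝ}
    (hs : ∀ g, s (g * a) = s g + 1) (g : G) (i : ℤ) : s (g * a ^ i) = s g + i := by
  induction i with
  | zero => simp
  | succ i ih => rw [zpow_add_one, ← mul_assoc, hs, ih]; push_cast; ring
  | pred i ih =>
    have := hs (g * a ^ (-(i : ℤ) - 1))
    rw [mul_assoc, ← zpow_add_one, sub_add_cancel, ih] at this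
    push_cast at this ⊢
    linarith

/-- If a power of `b` preserves the orientation along an axis, then that axis meets the row of
`g` in the marked position. -/
lemma marked_of_axis_periodic {G : Type} [Group G] {b : G} {p : ℕ} {x : G → ZMod p × Bool}
    (hedge : ∀ g, IsUp (x g) ∨ IsDown (x (g * b))) (g : G) (k : ℕ) (hk : 0 < k)
    (hper : x (g * b ^ k) = x g) : (x g).1 = 0 := by
  by_cases hup : IsUp (x g)
  · exact hup.2
  · have : ∀ j : ℕ, IsDown (x (g * b ^ (j + 1))) := fun j => by
      induction j with
      | zero => simpa using (hedge g).resolve_left hup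
      | succ j ih =>
        rw [pow_succ, ← mul_assoc]
        refine (hedge _).resolve_left fun h' => ?_
        exact Bool.false_ne_true (ih.1.symm.trans h'.1)
    have h := this (k - 1)
    rw [Nat.sub_add_cancel hk, hper] at h
    exact h.2

lemma IsBS.hasWeakNotStrongSFT_of_abs_eq {G : Type} [Group G] {m n : ℤ} {a b : G}
    (h : IsBS m n a b) (hmn : |m| = |n|) (hm : 2 ≤ |m|) : HasWeakNotStrongSFT G := by
  have hm0 : m ≠ 0 := by rintro rfl; simp at hm
  have hn0 : n ≠ 0 := by rintro rfl; simp at hmn; exact hm0 hmn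
  obtain ⟨p, hp⟩ : ∃ p, p = m.natAbs := ⟨_, rfl⟩
  have hp2 : 2 ≤ p := by rw [Int.abs_eq_natAbs] at hm; omega
  have : NeZero p := ⟨by omega⟩
  have : Fact (1 < p) := ⟨by omega⟩
  have hpm : (p : ℤ) ∣ m := by rw [hp]; exact Int.natAbs_dvd.2 dvd_rfl
  have hpn : (p : ℤ) ∣ n := by rw [hp, Int.natAbs_dvd, ← dvd_abs, ← hmn, dvd_abs]
  refine hasWeakNotStrongSFT_of_isLocal (A := ZMod p × Bool)
    (P := fun z => (z a).1 = (z 1).1 + 1 ∧ (IsUp (z 1) ∨ IsDown (z b))) ?_ ?_ ?_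
  · exact .and (.comp₂ (fun u v : ZMod p × Bool => u.1 = v.1 + 1) (.eval a) (.eval 1))
      (.comp₂ (fun u v : ZMod p × Bool => IsUp u ∨ IsDown v) (.eval 1) (.eval b))
  · intro x hx hper
    simp only [mul_one] at hx
    obtain ⟨k, hk, hxk⟩ := hper b
    obtain ⟨l, hl, hxl⟩ := hper (a * b * a⁻¹)
    have h1 := marked_of_axis_periodic (fun g => (hx g).2) 1 k hk (by
      rw [one_mul, ← hxk 1, mul_one])
    have h2 := marked_of_axis_periodic (fun g => (hx g).2) a l hl (by
      rw [← hxl a, conj_pow, inv_mul_cancel_right])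
    have h3 := (hx 1).1
    rw [one_mul, h1, h2, zero_add] at h3
    exact zero_ne_one h3
  · obtain ⟨α, β, hα, hαx, hβ⟩ := exists_orientation p hp2
    have hα' : ∀ k : ℤ, (p : ℤ) ∣ k → α ^ k = 1 := by
      rintro _ ⟨k, rfl⟩
      rw [zpow_mul, zpow_natCast, hα, one_zpow]
    obtain ⟨π, hπ1, hπa, hπb, hπs⟩ := h.exists_orbitMap α β
      (by rw [hα' m hpm, hα' n hpn, one_mul, mul_one]) ((0, true), 0)
    refine ⟨fun g => ((π g).2, (π g).1.2), fun g => ?_, a ^ p, ?_, ?_⟩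
    · simp only [mul_one, hπa, hπb, hαx, true_and, hβ (π g)]
      exact (em _).symm
    · intro hap
      obtain ⟨s, hs1, hsa, -⟩ := h.exists_affine hm0 hn0
      have := map_mul_zpow_of_map_mul_add_one hsa 1 p
      rw [zpow_natCast, hap, one_mul, hs1, zero_add] at this
      have : (p : ℝ) = 0 := by exact_mod_cast this.symm
      norm_cast at this
      omega
    · have : ∀ k : ℕ, π (a ^ k) = (α ^ k) ((0, true), 0) := fun k => by
        induction k with
        | zero => simpa using hπ1
        | succ k ih => rw [pow_succ, hπa, ih, pow_succ', Equiv.Perm.mul_apply]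
      have := hπs (a ^ p) (by rw [this, hα]; rfl)
      intro k
      simp only [this]

/-! ### Growth rates of slowly increasing functions -/

/-- The function on `ℤ` vanishing at `0` with increments `z`. -/
def signedSum (z : ℤ → ℤ) (k : ℤ) : ℤ :=
  ∑ i ∈ Finset.range k.toNat, z i - ∑ i ∈ Finset.range (-k).toNat, z (-1 - i)

lemma signedSum_zero (z : ℤ → ℤ) : signedSum z 0 = 0 := by simp [signedSum]

lemma signedSum_add_one (z : ℤ → ℤ) (k : ℤ) : signedSum z (k + 1) = signedSum z k + z k := by
  rcases le_or_gt 0 k with hk | hk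
  · lift k to ℕ using hk
    have h1 : ((k : ℤ) + 1).toNat = k + 1 := by omega
    have h2 : (-(k : ℤ)).toNat = 0 := by omega
    have h3 : (-((k : ℤ) + 1)).toNat = 0 := by omega
    simp only [signedSum, h1, h2, h3, Int.toNat_natCast, Finset.sum_range_succ,
      Finset.sum_range_zero]
    ring
  · obtain ⟨j, rfl⟩ : ∃ j : ℕ, k = -1 - j := ⟨(-1 - k).toNat, by omega⟩
    have h1 : (-1 - (j : ℤ)).toNat = 0 := by omega
    have h2 : (-1 - (j : ℤ) + 1).toNat = 0 := by omega
    have h3 : (-(-1 - (j : ℤ))).toNat = j + 1 := by omega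
    have h4 : (-(-1 - (j : ℤ) + 1)).toNat = j := by omega
    simp only [signedSum, h1, h2, h3, h4, Finset.sum_range_succ, Finset.sum_range_zero]
    ring

lemma eq_signedSum {z f : ℤ → ℤ} (h0 : f 0 = 0) (h : ∀ k, f (k + 1) = f k + z k) (k : ℤ) :
    f k = signedSum z k := by
  induction k with
  | zero => rw [h0, signedSum_zero]
  | succ k ih => rw [h, ih, signedSum_add_one]
  | pred k ih =>
    have h1 := h (-k - 1)
    have h2 := signedSum_add_one z (-k - 1)
    rw [sub_add_cancel] at h1 h2
    linarith

lemma signedSum_shift (z : ℤ → ℤ) (j k : ℤ) :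
    signedSum (fun i => z (j + i)) k = signedSum z (j + k) - signedSum z j :=
  (eq_signedSum (f := fun k => signedSum z (j + k) - signedSum z j) (by simp) (fun k => by
    rw [← add_assoc, signedSum_add_one]; ring) k).symm

/-- An integer function vanishing at `0` with all increments between `1` and `6`. -/
def IsClimbing (f : ℤ → ℤ) : Prop :=
  f 0 = 0 ∧ ∀ k l, k ≤ l → l - k ≤ f l - f k ∧ f l - f k ≤ 6 * (l - k)

lemma isClimbing_signedSum {z : ℤ → ℤ} (hz : ∀ i, 1 ≤ z i ∧ z i ≤ 6) :
    IsClimbing (signedSum z) := by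
  refine ⟨signedSum_zero z, fun k l hkl => ?_⟩
  obtain ⟨d, rfl⟩ := Int.le.dest hkl
  clear hkl
  induction d with
  | zero => simp
  | succ d ih =>
    have h1 := signedSum_add_one z (k + d)
    have h2 := hz (k + d)
    push_cast
    rw [← add_assoc, h1]
    constructor <;> linarith [ih.1, ih.2]

/-- The linear lower growth rates of `|f|`, up to an additive constant. -/
def growthRates (f : ℤ → ℤ) : Set ℝ :=
  {r | ∃ C : ℝ, ∀ k : ℤ, r * |(k : ℝ)| ≤ |(f k : ℝ)| + C}

lemma growthRates_subset_of_close {f f' : ℤ → ℤ} {C : ℤ} (h : ∀ k, |f k - f' k| ≤ C) :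
    growthRates f ⊆ growthRates f' := by
  rintro r ⟨D, hD⟩
  refine ⟨D + C, fun k => (hD k).trans ?_⟩
  have h1 : |(f k : ℝ) - f' k| ≤ C := by exact_mod_cast h k
  linarith [abs_sub_abs_le_abs_sub (f k : ℝ) (f' k)]

namespace IsClimbing

variable {f f' : ℤ → ℤ}

lemma abs_le_abs (hf : IsClimbing f) (k : ℤ) : |k| ≤ |f k| := by
  have h0 := hf.1
  rcases le_total 0 k with hk | hk
  · have := (hf.2 0 k hk).1
    rw [abs_of_nonneg hk]
    exact le_trans (by linarith) (le_abs_self _)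
  · have := (hf.2 k 0 hk).1
    rw [abs_of_nonpos hk]
    exact le_trans (by linarith) (neg_le_abs _)

lemma abs_sub_le (hf : IsClimbing f) (k l : ℤ) : |f k - f l| ≤ 6 * |k - l| := by
  wlog hkl : k ≤ l generalizing k l
  · rw [abs_sub_comm, abs_sub_comm k]
    exact this l k (le_of_not_ge hkl)
  · have := hf.2 k l hkl
    rw [abs_sub_comm, abs_sub_comm k, abs_of_nonneg (by linarith), abs_of_nonneg (by linarith)]
    exact this.2

lemma one_mem (hf : IsClimbing f) : (1 : ℝ) ∈ growthRates f :=
  ⟨0, fun k => by rw [one_mul, add_zero]; exact_mod_cast hf.abs_le_abs k⟩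

lemma le_six (hf : IsClimbing f) {r : ℝ} (hr : r ∈ growthRates f) : r ≤ 6 := by
  obtain ⟨C, hC⟩ := hr
  by_contra! hr
  obtain ⟨k, hk⟩ := exists_nat_gt (C / (r - 6))
  rw [div_lt_iff₀ (by linarith)] at hk
  have h1 := hC k
  have h2 := hf.abs_sub_le k 0
  rw [hf.1, sub_zero, sub_zero] at h2
  have h3 : |(f k : ℝ)| ≤ 6 * |((k : ℤ) : ℝ)| := by exact_mod_cast h2
  rw [Int.cast_natCast, Nat.abs_cast] at h1 h3
  nlinarith

/-- It suffices to test growth rates on multiples of a fixed nonzero integer. -/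
lemma mem_of_multiples (hf : IsClimbing f) {N : ℤ} (hN : N ≠ 0) {r C : ℝ}
    (h : ∀ t : ℤ, r * |((N * t : ℤ) : ℝ)| ≤ |(f (N * t) : ℝ)| + C) : r ∈ growthRates f := by
  rcases le_or_gt r 0 with hr | hr
  · exact ⟨0, fun k => by
      have := mul_nonpos_of_nonpos_of_nonneg hr (abs_nonneg (k : ℝ))
      have := abs_nonneg (f k : ℝ)
      linarith⟩
  · refine ⟨C + r * |(N : ℝ)| + 6 * |(N : ℝ)|, fun k => ?_⟩
    have h1 := h (k / N)
    have h2 : |k - N * (k / N)| ≤ |N| := by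
      rw [← Int.emod_def, abs_of_nonneg (Int.emod_nonneg _ hN)]
      exact (Int.emod_lt_abs _ hN).le
    have h3 := (hf.abs_sub_le (N * (k / N)) k)
    rw [abs_sub_comm (N * (k / N))] at h3
    have h4 : |((N * (k / N) : ℤ) : ℝ) - k| ≤ |(N : ℝ)| := by
      rw [abs_sub_comm]; exact_mod_cast h2
    have h5 : |(f (N * (k / N)) : ℝ) - f k| ≤ 6 * |(N : ℝ)| := by
      exact_mod_cast h3.trans (by linarith)
    have h6 := abs_sub_abs_le_abs_sub (f (N * (k / N)) : ℝ) (f k)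
    have h7 := abs_sub_abs_le_abs_sub (k : ℝ) ((N * (k / N) : ℤ) : ℝ)
    rw [abs_sub_comm] at h7
    have h8 : r * |(k : ℝ)| ≤ r * (|((N * (k / N) : ℤ) : ℝ)| + |(N : ℝ)|) :=
      mul_le_mul_of_nonneg_left (by linarith) hr.le
    linarith

lemma scale_mem (hf' : IsClimbing f') {m n : ℤ} (hm : m ≠ 0) (hn : n ≠ 0)
    {u v K : ℝ} (hu : 0 < u) (hv : 0 < v)
    (h : ∀ t : ℤ, |u * m * f (n * t) - v * n * f' (m * t)| ≤ K) {r : ℝ}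
    (hr : r ∈ growthRates f) : u / v * r ∈ growthRates f' := by
  obtain ⟨C, hC⟩ := hr
  have hm' : 0 < |(m : ℝ)| := abs_pos.2 (by exact_mod_cast hm)
  have hn' : 0 < |(n : ℝ)| := abs_pos.2 (by exact_mod_cast hn)
  refine hf'.mem_of_multiples hm (C := (u * |(m : ℝ)| * C + K) / (v * |(n : ℝ)|)) fun t => ?_
  have h1 := hC (n * t)
  have h2 := (abs_sub_abs_le_abs_sub _ _).trans (h t)
  rw [abs_mul, abs_mul, abs_mul, abs_mul, abs_of_pos hu, abs_of_pos hv] at h2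
  have h3 := mul_le_mul_of_nonneg_left h1 (mul_pos hu hm').le
  rw [← sub_le_iff_le_add', le_div_iff₀ (mul_pos hv hn')]
  have h4 : u / v * r * |((m * t : ℤ) : ℝ)| * (v * |(n : ℝ)|) =
      u * |(m : ℝ)| * (r * |((n * t : ℤ) : ℝ)|) := by
    push_cast
    rw [abs_mul, abs_mul]
    field_simp
  linarith

lemma scale_mem_iff (hf : IsClimbing f) (hf' : IsClimbing f') {m n : ℤ} (hm : m ≠ 0)
    (hn : n ≠ 0) {u v K : ℝ} (hu : 0 < u) (hv : 0 < v)
    (h : ∀ t : ℤ, |u * m * f (n * t) - v * n * f' (m * t)| ≤ K) (r : ℝ) :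
    r ∈ growthRates f ↔ u / v * r ∈ growthRates f' := by
  refine ⟨hf'.scale_mem hm hn hu hv h, fun hr => ?_⟩
  have := hf.scale_mem hn hm hv hu (fun t => by rw [abs_sub_comm]; exact h t) hr
  rwa [← mul_assoc, div_mul_div_comm, mul_comm v u, div_self (by positivity), one_mul] at this

lemma growthRates_eq_of_multiples (hf : IsClimbing f) (hf' : IsClimbing f') {N : ℤ} (hN : N ≠ 0)
    (h : ∀ t : ℤ, f (N * t) = f' (N * t)) : growthRates f = growthRates f' := by
  ext r
  constructor
  · rintro ⟨C, hC⟩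
    exact hf'.mem_of_multiples hN fun t => h t ▸ hC (N * t)
  · rintro ⟨C, hC⟩
    exact hf.mem_of_multiples hN fun t => h t ▸ hC (N * t)

end IsClimbing

lemma signedSum_mul_of_periodic {z : ℤ → ℤ} {N : ℤ} (hz : ∀ i, z (N + i) = z i) (t : ℤ) :
    signedSum z (N * t) = t * signedSum z N := by
  have hs : ∀ k, signedSum z (N + k) = signedSum z N + signedSum z k := fun k => by
    have := signedSum_shift z N k
    simp only [hz] at this
    linarith
  induction t with
  | zero => simp [signedSum_zero]
  | succ t ih => rw [mul_add, mul_one, add_comm, hs, ih]; ring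
  | pred t ih =>
    have h1 := hs (N * (-t - 1))
    rw [mul_sub, mul_one, add_sub_cancel, ih] at h1
    rw [mul_sub, mul_one]
    linarith

lemma eq_one_of_mul_mem_iff {S : Set ℝ} (h1 : 1 ∈ S) (h6 : ∀ r ∈ S, r ≤ 6) {Q : ℝ} (hQ : 0 < Q)
    (h : ∀ r, r ∈ S ↔ Q * r ∈ S) : Q = 1 := by
  have hp : ∀ k : ℕ, Q ^ k ∈ S := fun k => by
    induction k with
    | zero => simpa using h1
    | succ k ih => rw [pow_succ']; exact (h _).1 ih
  have hi : ∀ k : ℕ, Q⁻¹ ^ k ∈ S := fun k => by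
    induction k with
    | zero => simpa using h1
    | succ k ih =>
      rw [h, pow_succ', ← mul_assoc, mul_inv_cancel₀ hQ.ne', one_mul]
      exact ih
  rcases lt_trichotomy Q 1 with hlt | heq | hgt
  · obtain ⟨k, hk⟩ := pow_unbounded_of_one_lt 6 ((one_lt_inv₀ hQ).2 hlt)
    exact absurd (h6 _ (hi k)) (not_le.2 hk)
  · exact heq
  · obtain ⟨k, hk⟩ := pow_unbounded_of_one_lt 6 hgt
    exact absurd (h6 _ (hp k)) (not_le.2 hk)

lemma add_eq_zero_of_two_pow_div_three_pow_eq_one {i j : ℕ} (h : (2 : ℝ) ^ i / 3 ^ j = 1) :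
    i + j = 0 := by
  rw [div_eq_one_iff_eq (by positivity)] at h
  have h' : 2 ^ i = 3 ^ j := by exact_mod_cast h
  rcases i with _ | i
  · rcases j with _ | j
    · rfl
    · have : 1 < 3 ^ (j + 1) := Nat.one_lt_pow (by omega) (by norm_num)
      omega
  · have h2 : Odd (3 ^ j) := Odd.pow (by decide)
    rw [← h', pow_succ] at h2
    exact absurd h2 (by simp)

/-! ### Strongly aperiodic subshifts -/

lemma row_mul_zpow {G : Type} [Group G] (a x : G) (i : ℤ) :
    (QuotientGroup.mk (x * a ^ i) : G ⧸ Subgroup.zpowers a) = QuotientGroup.mk x :=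
  QuotientGroup.mk_mul_of_mem x (Subgroup.zpow_mem_zpowers a i)

lemma exists_eq_mul_zpow_of_row_eq {G : Type} [Group G] {a g g' : G}
    (h : (QuotientGroup.mk g : G ⧸ Subgroup.zpowers a) = QuotientGroup.mk g') :
    ∃ t : ℤ, g' = g * a ^ t := by
  obtain ⟨t, ht⟩ := QuotientGroup.eq.1 h
  exact ⟨t, (mul_inv_cancel_left g g' ▸ congrArg (g * ·) ht).symm⟩

/-- Numerator of the factor by which the density changes from a row to its parent. -/
def ratioNum (e : Bool) : ℤ := if e then 2 else 1

/-- Denominator of the factor by which the density changes from a row to its parent. -/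
def ratioDen (e : Bool) : ℤ := if e then 1 else 3

lemma ratioNum_pos (e : Bool) : 0 < ratioNum e := by cases e <;> decide

lemma ratioDen_pos (e : Bool) : 0 < ratioDen e := by cases e <;> decide

/-- Tilings of `BS(m,n)`. The marking `s` orients the Bass–Serre tree so that every row has exactly
one parent, the row sequences `y` have a density, and the density of the parent of a row is
`ratioNum / ratioDen` times that of the row, as certified locally by the bounded carries `κ`. -/
structure IsTiling {G : Type} [Group G] (m n : ℤ) (a b : G) (K : ℤ)
    (s : G → ZMod m.natAbs × Bool) (e : G → Bool) (y κ : G → ℤ) : Prop where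
  fst_mul : ∀ g, (s (g * a)).1 = (s g).1 + 1
  snd_mul : ∀ g, (s (g * a)).2 = (s g).2
  ratio_mul : ∀ g, e (g * a) = e g
  dvd : ∀ g, (s g).2 = true → n ∣ m
  edge : ∀ g, IsUp (s g) ∨ IsDown (s (g * b))
  y_mem : ∀ g, 1 ≤ y g ∧ y g ≤ 6
  carry_le : ∀ g, |κ g| ≤ K
  up : ∀ g, IsUp (s g) → κ (g * a ^ n) - κ g =
    ratioNum (e g) * m * signedSum (fun i => y (g * a ^ i)) n -
      ratioDen (e g) * n * signedSum (fun i => y (g * b * a ^ i)) m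
  down : ∀ g, IsDown (s (g * b)) → κ (g * a ^ n) - κ g =
    ratioDen (e (g * b)) * m * signedSum (fun i => y (g * a ^ i)) n -
      ratioNum (e (g * b)) * n * signedSum (fun i => y (g * b * a ^ i)) m

namespace IsTiling

variable {G : Type} [Group G] {m n : ℤ} {a b : G} {K : ℤ} {s : G → ZMod m.natAbs × Bool}
  {e : G → Bool} {y κ : G → ℤ}

lemma isClimbing (T : IsTiling m n a b K s e y κ) (g : G) :
    IsClimbing (signedSum fun i => y (g * a ^ i)) :=
  isClimbing_signedSum fun _ => T.y_mem _

lemma growthRates_mul (T : IsTiling m n a b K s e y κ) (g : G) :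
    growthRates (signedSum fun i => y (g * a * a ^ i)) =
      growthRates (signedSum fun i => y (g * a ^ i)) := by
  have key : ∀ k, |signedSum (fun i => y (g * a * a ^ i)) k -
      signedSum (fun i => y (g * a ^ i)) k| ≤ 12 := fun k => by
    have h1 := signedSum_shift (fun i => y (g * a ^ i)) 1 k
    simp only [zpow_add, zpow_one, ← mul_assoc] at h1
    have h2 := (T.isClimbing g).abs_sub_le (1 + k) k
    have h3 := (T.isClimbing g).abs_sub_le 1 0
    rw [(T.isClimbing g).1, sub_zero, sub_zero, abs_one] at h3
    rw [add_sub_cancel_right, abs_one] at h2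
    rw [h1]
    rw [abs_le] at *
    constructor <;> linarith [h2.1, h2.2, h3.1, h3.2]
  refine (growthRates_subset_of_close key).antisymm
    (growthRates_subset_of_close (C := 12) fun k => ?_)
  rw [abs_sub_comm]
  exact key k

lemma fst_mul_zpow (T : IsTiling m n a b K s e y κ) (g : G) (t : ℤ) :
    (s (g * a ^ t)).1 = (s g).1 + t :=
  map_mul_zpow_of_map_mul (c := fun g => (s g).1) T.fst_mul g t

lemma snd_mul_zpow (T : IsTiling m n a b K s e y κ) (g : G) (t : ℤ) :
    (s (g * a ^ t)).2 = (s g).2 :=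
  map_mul_zpow_of_invariant (f := fun g => (s g).2) T.snd_mul g t

lemma marking_mul_zpow (T : IsTiling m n a b K s e y κ) (g : G) {t : ℤ} (ht : m ∣ t) :
    s (g * a ^ t) = s g := by
  refine Prod.ext ?_ (T.snd_mul_zpow g t)
  rw [T.fst_mul_zpow, (ZMod.intCast_zmod_eq_zero_iff_dvd _ _).2 (Int.natAbs_dvd.2 ht), add_zero]

/-- Telescoping the carry equation along an edge of the Bass–Serre tree. -/
lemma growthRates_edge (T : IsTiling m n a b K s e y κ) (hBS : IsBS m n a b) (hm : m ≠ 0)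
    (hn : n ≠ 0) (g : G) {u v : ℤ} (hu : 0 < u) (hv : 0 < v)
    (h : ∀ t : ℤ, κ (g * a ^ (n * t) * a ^ n) - κ (g * a ^ (n * t)) =
      u * m * signedSum (fun i => y (g * a ^ (n * t) * a ^ i)) n -
        v * n * signedSum (fun i => y (g * a ^ (n * t) * b * a ^ i)) m) (r : ℝ) :
    r ∈ growthRates (signedSum fun i => y (g * a ^ i)) ↔
      (u / v : ℝ) * r ∈ growthRates (signedSum fun i => y (g * b * a ^ i)) := by
  have hstep : ∀ t : ℤ, κ (g * a ^ (n * (t + 1))) - κ (g * a ^ (n * t)) =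
      u * m * (signedSum (fun i => y (g * a ^ i)) (n * (t + 1)) -
        signedSum (fun i => y (g * a ^ i)) (n * t)) -
      v * n * (signedSum (fun i => y (g * b * a ^ i)) (m * (t + 1)) -
        signedSum (fun i => y (g * b * a ^ i)) (m * t)) := fun t => by
    have h1 := h t
    have h2 := signedSum_shift (fun i => y (g * a ^ i)) (n * t) n
    have h3 := signedSum_shift (fun i => y (g * b * a ^ i)) (m * t) m
    have h4 : ∀ i, g * a ^ (n * t) * b * a ^ i = g * b * a ^ (m * t + i) := fun i => by
      rw [mul_assoc g, hBS.zpow_mul_comm, zpow_add]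
      simp only [mul_assoc]
    simp only [h4] at h1
    simp only [mul_assoc, ← zpow_add] at h1 h2 h3 ⊢
    rw [h2, h3] at h1
    simp only [mul_add, mul_one] at h1 ⊢
    linarith
  have htel : ∀ t : ℤ, κ (g * a ^ (n * t)) - κ g =
      u * m * signedSum (fun i => y (g * a ^ i)) (n * t) -
      v * n * signedSum (fun i => y (g * b * a ^ i)) (m * t) := fun t => by
    induction t with
    | zero => simp [signedSum_zero]
    | succ t ih => linarith [hstep t]
    | pred t ih =>
      have := hstep (-t - 1)
      rw [sub_add_cancel] at this
      linarith
  refine (T.isClimbing g).scale_mem_iff (T.isClimbing (g * b)) hm hn (K := 2 * K)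
    (by exact_mod_cast hu) (by exact_mod_cast hv) (fun t => ?_) r
  have h1 := T.carry_le (g * a ^ (n * t))
  have h2 := T.carry_le g
  have h3 : |κ (g * a ^ (n * t)) - κ g| ≤ 2 * K := by
    rw [abs_le] at *
    constructor <;> linarith [h1.1, h1.2, h2.1, h2.2]
  rw [htel] at h3
  exact_mod_cast h3

/-- The element of the parent row reached from a marked element. -/
def parentStep (s : G → ZMod m.natAbs × Bool) (b g : G) : G :=
  if (s g).2 = true then g * b else g * b⁻¹

lemma growthRates_parentStep (T : IsTiling m n a b K s e y κ) (hBS : IsBS m n a b) (hm : m ≠ 0)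
    (hn : n ≠ 0) (hmn : m ∣ n) {g : G} (hg : (s g).1 = 0) (r : ℝ) :
    r ∈ growthRates (signedSum fun i => y (g * a ^ i)) ↔
      (ratioNum (e g) / ratioDen (e g) : ℝ) * r ∈
        growthRates (signedSum fun i => y (parentStep s b g * a ^ i)) := by
  have he : ∀ (g : G) (t : ℤ), e (g * a ^ t) = e g :=
    fun g t => map_mul_zpow_of_invariant T.ratio_mul g t
  unfold parentStep
  split_ifs with hup
  · refine T.growthRates_edge hBS hm hn g (ratioNum_pos _) (ratioDen_pos _) (fun t => ?_) r
    have := T.up (g * a ^ (n * t))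
      (by rw [T.marking_mul_zpow g (hmn.mul_right t)]; exact ⟨hup, hg⟩)
    rwa [he] at this
  · have hdown : IsDown (s g) := ⟨by simpa using hup, hg⟩
    have h1 := T.growthRates_edge hBS hm hn (g * b⁻¹) (ratioDen_pos (e g)) (ratioNum_pos (e g))
      (fun t => by
        have h2 : g * b⁻¹ * a ^ (n * t) * b = g * a ^ (m * t) := by
          rw [mul_assoc, hBS.zpow_mul_comm, mul_assoc, inv_mul_cancel_left]
        have h3 := T.down (g * b⁻¹ * a ^ (n * t))
          (by rw [h2, T.marking_mul_zpow g (dvd_mul_right _ _)]; exact hdown)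
        rw [h2] at h3 ⊢
        rwa [he] at h3)
      ((ratioNum (e g) / ratioDen (e g) : ℝ) * r)
    have h4 : (0 : ℝ) < ratioNum (e g) := by exact_mod_cast ratioNum_pos _
    have h5 : (0 : ℝ) < ratioDen (e g) := by exact_mod_cast ratioDen_pos _
    rw [inv_mul_cancel_right, ← mul_assoc, div_mul_div_comm,
      mul_comm (ratioDen (e g) : ℝ), div_self (by positivity), one_mul] at h1
    exact h1.symm

/-- The parent of a row is well defined. -/
lemma parentStep_row_eq (T : IsTiling m n a b K s e y κ) (hBS : IsBS m n a b) {g g' : G}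
    (hg : (s g).1 = 0) (hg' : (s g').1 = 0)
    (h : (g : G ⧸ Subgroup.zpowers a) = g') :
    QuotientGroup.mk (s := Subgroup.zpowers a) (parentStep s b g) =
      QuotientGroup.mk (s := Subgroup.zpowers a) (parentStep s b g') := by
  obtain ⟨t, rfl⟩ := exists_eq_mul_zpow_of_row_eq h
  rw [T.fst_mul_zpow, hg, zero_add, ZMod.intCast_zmod_eq_zero_iff_dvd, Int.natAbs_dvd] at hg'
  unfold parentStep
  rw [T.snd_mul_zpow]
  split_ifs with hup
  · obtain ⟨i, rfl⟩ := (T.dvd g hup).trans hg'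
    rw [mul_assoc, hBS.zpow_mul_comm, ← mul_assoc]
    exact (row_mul_zpow _ _ _).symm
  · obtain ⟨i, rfl⟩ := hg'
    rw [mul_assoc, hBS.zpow_mul_inv_comm, ← mul_assoc]
    exact (row_mul_zpow _ _ _).symm

end IsTiling

/-- Iterates of a self-map from any two points eventually meet, provided they do so for generators
of the group relating the points. -/
lemma exists_iterate_eq {G V : Type} [Group G] {a b : G} (hgen : Subgroup.closure {a, b} = ⊤)
    (ρ : G → V) (P : V → V) (ha : ∀ g, ρ (g * a) = ρ g)
    (hb : ∀ g, P (ρ g) = ρ (g * b) ∨ P (ρ (g * b)) = ρ g) (g h : G) :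
    ∃ i j : ℕ, P^[i] (ρ g) = P^[j] (ρ h) := by
  suffices ∀ k : G, ∀ g, ∃ i j : ℕ, P^[i] (ρ g) = P^[j] (ρ (g * k)) by
    simpa using this (g⁻¹ * h) g
  intro k
  have hk : k ∈ Subgroup.closure {a, b} := hgen ▸ Subgroup.mem_top k
  induction hk using Subgroup.closure_induction with
  | mem x hx =>
    rcases hx with rfl | rfl
    · exact fun g => ⟨0, 0, by rw [ha]⟩
    · intro g
      rcases hb g with h | h
      · exact ⟨1, 0, h⟩
      · exact ⟨0, 1, h.symm⟩
  | one => exact fun g => ⟨0, 0, by rw [mul_one]⟩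
  | mul x y _ _ hx hy =>
    intro g
    obtain ⟨i, j, h⟩ := hx g
    obtain ⟨i', j', h'⟩ := hy (g * x)
    refine ⟨i' + i, j + j', ?_⟩
    rw [Function.iterate_add_apply, h, Function.iterate_add_apply, ← mul_assoc, ← h',
      ← Function.iterate_add_apply, ← Function.iterate_add_apply, add_comm]
  | inv x _ hx =>
    intro g
    obtain ⟨i, j, h⟩ := hx (g * x⁻¹)
    rw [inv_mul_cancel_right] at h
    exact ⟨j, i, h.symm⟩

namespace IsTiling

variable {G : Type} [Group G] {m n : ℤ} {a b : G} {K : ℤ} {s : G → ZMod m.natAbs × Bool}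
  {e : G → Bool} {y κ : G → ℤ}

lemma exists_marked (T : IsTiling m n a b K s e y κ) (v : G ⧸ Subgroup.zpowers a) :
    ∃ g : G, QuotientGroup.mk g = v ∧ (s g).1 = 0 := by
  obtain ⟨g, rfl⟩ := QuotientGroup.mk_surjective v
  obtain ⟨i, hi⟩ := exists_map_mul_zpow_eq_zero (c := fun g => (s g).1) T.fst_mul g
  exact ⟨g * a ^ i, row_mul_zpow _ _ _, hi⟩

lemma exists_parent (T : IsTiling m n a b K s e y κ) (hBS : IsBS m n a b) :
    ∃ P : G ⧸ Subgroup.zpowers a → G ⧸ Subgroup.zpowers a, ∀ g : G, (s g).1 = 0 →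
      P (QuotientGroup.mk g) = QuotientGroup.mk (parentStep s b g) := by
  choose r hr h0 using T.exists_marked
  exact ⟨fun v => QuotientGroup.mk (parentStep s b (r v)), fun g hg =>
    T.parentStep_row_eq hBS (h0 _) hg (hr _)⟩

lemma exists_rates (T : IsTiling m n a b K s e y κ) :
    ∃ L : G ⧸ Subgroup.zpowers a → Set ℝ, ∀ g : G,
      L (QuotientGroup.mk g) = growthRates (signedSum fun i => y (g * a ^ i)) := by
  refine ⟨Quotient.lift (fun g => growthRates (signedSum fun i => y (g * a ^ i))) ?_, fun g => rfl⟩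
  intro g g' h
  obtain ⟨t, rfl⟩ := exists_eq_mul_zpow_of_row_eq (Quotient.sound h)
  exact (map_mul_zpow_of_invariant
    (f := fun g => growthRates (signedSum fun i => y (g * a ^ i))) T.growthRates_mul g t).symm

section Rows

variable {P : G ⧸ Subgroup.zpowers a → G ⧸ Subgroup.zpowers a}
  {L : G ⧸ Subgroup.zpowers a → Set ℝ}

lemma rates_iterate (T : IsTiling m n a b K s e y κ) (hBS : IsBS m n a b) (hm : m ≠ 0)
    (hn : n ≠ 0) (hmn : m ∣ n)
    (hP : ∀ g : G, (s g).1 = 0 → P (QuotientGroup.mk g) = QuotientGroup.mk (parentStep s b g))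
    (hL : ∀ g : G, L (QuotientGroup.mk g) = growthRates (signedSum fun i => y (g * a ^ i)))
    (v : G ⧸ Subgroup.zpowers a) (l : ℕ) :
    ∃ i j : ℕ, i + j = l ∧ ∀ r, r ∈ L v ↔ (2 : ℝ) ^ i / 3 ^ j * r ∈ L (P^[l] v) := by
  induction l with
  | zero => exact ⟨0, 0, rfl, fun r => by simp⟩
  | succ l ih =>
    obtain ⟨i, j, hij, h⟩ := ih
    obtain ⟨g, hg, hg0⟩ := T.exists_marked (P^[l] v)
    have key := T.growthRates_parentStep hBS hm hn hmn hg0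
    rw [← hL, ← hL, ← hP g hg0, hg] at key
    rw [Function.iterate_succ_apply']
    rcases he : e g with _ | _
    · refine ⟨i, j + 1, by omega, fun r => ?_⟩
      rw [h, key, he, ← mul_assoc]
      have : (ratioNum false / ratioDen false : ℝ) * (2 ^ i / 3 ^ j) = 2 ^ i / 3 ^ (j + 1) := by
        simp only [ratioNum, ratioDen]
        push_cast
        norm_num
        field_simp
        exact pow_succ' 3 j
      rw [this]
    · refine ⟨i + 1, j, by omega, fun r => ?_⟩
      rw [h, key, he, ← mul_assoc]
      have : (ratioNum true / ratioDen true : ℝ) * (2 ^ i / 3 ^ j) = 2 ^ (i + 1) / 3 ^ j := by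
        simp only [ratioNum, ratioDen]
        push_cast
        simp
        ring
      rw [this]

lemma eq_zero_of_rates_iterate_eq (T : IsTiling m n a b K s e y κ) (hBS : IsBS m n a b)
    (hm : m ≠ 0) (hn : n ≠ 0) (hmn : m ∣ n)
    (hP : ∀ g : G, (s g).1 = 0 → P (QuotientGroup.mk g) = QuotientGroup.mk (parentStep s b g))
    (hL : ∀ g : G, L (QuotientGroup.mk g) = growthRates (signedSum fun i => y (g * a ^ i)))
    {v : G ⧸ Subgroup.zpowers a} {l : ℕ} (h : L (P^[l] v) = L v) : l = 0 := by
  obtain ⟨i, j, rfl, hr⟩ := T.rates_iterate hBS hm hn hmn hP hL v l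
  rw [h] at hr
  obtain ⟨g, rfl⟩ := QuotientGroup.mk_surjective v
  rw [hL] at hr
  exact add_eq_zero_of_two_pow_div_three_pow_eq_one
    (eq_one_of_mul_mem_iff (T.isClimbing g).one_mem (fun r => (T.isClimbing g).le_six)
      (by positivity) hr)

lemma iterate_injective (T : IsTiling m n a b K s e y κ) (hBS : IsBS m n a b)
    (hm : m ≠ 0) (hn : n ≠ 0) (hmn : m ∣ n)
    (hP : ∀ g : G, (s g).1 = 0 → P (QuotientGroup.mk g) = QuotientGroup.mk (parentStep s b g))
    (hL : ∀ g : G, L (QuotientGroup.mk g) = growthRates (signedSum fun i => y (g * a ^ i)))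
    {v : G ⧸ Subgroup.zpowers a} {i j : ℕ} (h : L (P^[i] v) = L (P^[j] v)) : i = j := by
  wlog hij : i ≤ j generalizing i j
  · exact (this h.symm (le_of_not_ge hij)).symm
  obtain ⟨d, rfl⟩ := Nat.exists_eq_add_of_le' hij
  rw [Function.iterate_add_apply] at h
  rw [T.eq_zero_of_rates_iterate_eq hBS hm hn hmn hP hL h.symm, zero_add]

/-- A symmetry of a tiling fixes a row. -/
lemma exists_fixed_row (T : IsTiling m n a b K s e y κ) (hBS : IsBS m n a b)
    (hm : m ≠ 0) (hn : n ≠ 0) (hmn : m ∣ n)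
    (hP : ∀ g : G, (s g).1 = 0 → P (QuotientGroup.mk g) = QuotientGroup.mk (parentStep s b g))
    (hL : ∀ g : G, L (QuotientGroup.mk g) = growthRates (signedSum fun i => y (g * a ^ i)))
    {h : G} (hs : ∀ g, s (h * g) = s g) (hy : ∀ g, y (h * g) = y g) :
    ∃ (w : G) (k : ℤ), h * w = w * a ^ k := by
  have hPh : ∀ v, P (h • v) = h • P v := fun v => by
    obtain ⟨g, rfl, hg⟩ := T.exists_marked v
    have hhg : (s (h * g)).1 = 0 := by rw [hs, hg]
    rw [hP g hg, MulAction.Quotient.smul_mk, MulAction.Quotient.smul_mk, smul_eq_mul, hP _ hhg]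
    simp only [parentStep, hs, smul_eq_mul]
    split_ifs <;> rw [mul_assoc]
  have hLh : ∀ v, L (h • v) = L v := fun v => by
    obtain ⟨g, rfl⟩ := QuotientGroup.mk_surjective v
    rw [MulAction.Quotient.smul_mk, hL, hL]
    simp only [smul_eq_mul, mul_assoc, hy]
  have hit : ∀ (i : ℕ) v, P^[i] (h • v) = h • P^[i] v := fun i v =>
    ((show Function.Semiconj (fun v => h • v) P P from fun v => (hPh v).symm).iterate_right i
      |>.eq v).symm
  obtain ⟨i, j, hij⟩ := exists_iterate_eq hBS.gen
    (QuotientGroup.mk : G → G ⧸ Subgroup.zpowers a) P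
    (fun g => by simp) (fun g => by
      rcases T.edge g with hg | hg
      · left
        rw [hP g hg.2, parentStep, if_pos hg.1]
      · right
        rw [hP _ hg.2, parentStep, if_neg (by simp [hg.1]), mul_inv_cancel_right]) 1 h
  have h1 : (QuotientGroup.mk h : G ⧸ Subgroup.zpowers a) = h • QuotientGroup.mk 1 := by
    rw [MulAction.Quotient.smul_mk, smul_eq_mul, mul_one]
  rw [h1, hit] at hij
  obtain rfl := T.iterate_injective hBS hm hn hmn hP hL ((congrArg L hij).trans (hLh _))
  obtain ⟨w, hw⟩ := QuotientGroup.mk_surjective (P^[i] (QuotientGroup.mk 1))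
  rw [← hw, MulAction.Quotient.smul_mk] at hij
  obtain ⟨k, hk⟩ := exists_eq_mul_zpow_of_row_eq hij
  exact ⟨w, k, hk⟩

end Rows

/-- Among infinitely many rows with a common period, two have the same growth rates. -/
lemma exists_rates_eq_of_periodic (T : IsTiling m n a b K s e y κ) {N : ℤ} (hN : N ≠ 0)
    (g : ℕ → G) (hg : ∀ j i, y (g j * a ^ (N + i)) = y (g j * a ^ i)) :
    ∃ i j, i ≠ j ∧ growthRates (signedSum fun k => y (g i * a ^ k)) =
      growthRates (signedSum fun k => y (g j * a ^ k)) := by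
  have hb : ∀ j, signedSum (fun k => y (g j * a ^ k)) N ∈ Set.Icc (-(6 * |N|)) (6 * |N|) :=
    fun j => by
      have := (T.isClimbing (g j)).abs_sub_le N 0
      rwa [(T.isClimbing (g j)).1, sub_zero, sub_zero, abs_le] at this
  obtain ⟨i, j, hij, h⟩ := Finite.exists_ne_map_eq_of_infinite
    (fun j => (⟨_, hb j⟩ : Set.Icc (-(6 * |N|)) (6 * |N|)))
  refine ⟨i, j, hij, (T.isClimbing _).growthRates_eq_of_multiples (T.isClimbing _) hN fun t => ?_⟩
  rw [signedSum_mul_of_periodic (hg i), signedSum_mul_of_periodic (hg j)]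
  exact congrArg (t * ·) (Subtype.ext_iff.1 h)

end IsTiling

lemma periodic_of_mul_eq_mul_zpow {G β : Type} [Group G] {a h : G} {y : G → β}
    (hy : ∀ g, y (h * g) = y g) {g : G} {q t N : ℤ} (hg : h ^ q * g = g * a ^ t)
    (ht : t = N ∨ t = -N) (i : ℤ) : y (g * a ^ (N + i)) = y (g * a ^ i) := by
  have hq : ∀ x, y (h ^ q * x) = y x := fun x => by
    clear hg
    induction q generalizing x with
    | zero => simp
    | succ q ih => rw [zpow_add_one, mul_assoc, ih, hy]
    | pred q ih => rw [zpow_sub_one, mul_assoc, ih, ← hy, mul_inv_cancel_left]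
  have key : ∀ i, y (g * a ^ (t + i)) = y (g * a ^ i) := fun i => by
    rw [zpow_add, ← mul_assoc, ← hg, mul_assoc, hq]
  rcases ht with rfl | rfl
  · exact key i
  · have := key (N + i)
    rw [neg_add_cancel_left] at this
    exact this.symm

lemma zpow_mul_eq_mul_zpow {G : Type} [Group G] {a h g : G} {t : ℤ} (hg : h * g = g * a ^ t)
    (q : ℤ) : h ^ q * g = g * a ^ (t * q) := by
  rw [eq_mul_inv_of_mul_eq hg, conj_zpow, zpow_mul, inv_mul_cancel_right]

lemma IsBS.zpow_mul_of_abs_eq {G : Type} [Group G] {m n : ℤ} {a b : G} (hBS : IsBS m n a b)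
    (hmn : |m| = |n|) (g : G) (t : ℤ) :
    ∃ t', (t' = t ∨ t' = -t) ∧ a ^ (m * t) * g = g * a ^ (m * t') := by
  have hg : g ∈ Subgroup.closure {a, b} := hBS.gen ▸ Subgroup.mem_top g
  induction hg using Subgroup.closure_induction_right generalizing t with
  | one => exact ⟨t, Or.inl rfl, by simp⟩
  | mul_right x hx z hz ih =>
    obtain ⟨t', h1, h2⟩ := ih t
    rcases hz with rfl | rfl
    · refine ⟨t', h1, ?_⟩
      rw [← mul_assoc, h2, mul_assoc, mul_assoc, ← zpow_add_one, ← zpow_one_add, add_comm]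
    · rcases abs_eq_abs.1 hmn with rfl | rfl
      · refine ⟨t', h1, ?_⟩
        rw [← mul_assoc, h2, mul_assoc, mul_assoc, hBS.zpow_mul_comm]
      · refine ⟨-t', by omega, ?_⟩
        rw [← mul_assoc, h2, mul_assoc, mul_assoc, neg_mul_comm, hBS.zpow_mul_comm]
  | mul_inv_cancel x hx z hz ih =>
    obtain ⟨t', h1, h2⟩ := ih t
    rcases hz with rfl | rfl
    · refine ⟨t', h1, ?_⟩
      rw [← mul_assoc, h2, mul_assoc, mul_assoc, ← zpow_sub_one, ← zpow_neg_one, ← zpow_add,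
        add_comm, sub_eq_add_neg]
    · rcases abs_eq_abs.1 hmn with rfl | rfl
      · refine ⟨t', h1, ?_⟩
        rw [← mul_assoc, h2, mul_assoc, mul_assoc, hBS.zpow_mul_inv_comm]
      · refine ⟨-t', by omega, ?_⟩
        rw [← mul_assoc, h2, mul_assoc, mul_assoc, hBS.zpow_mul_inv_comm]
        congr 3
        ring

lemma dvd_of_abs_eq {m n : ℤ} (h : |m| = 1 ∨ |m| = |n|) : m ∣ n := by
  rcases h with h | h
  · exact (Int.isUnit_iff_abs_eq.2 h).dvd
  · exact (abs_dvd_abs m n).1 (dvd_of_eq h)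

lemma subsingleton_zmod_natAbs {m : ℤ} (h : |m| = 1) : Subsingleton (ZMod m.natAbs) := by
  have : m.natAbs = 1 := by rw [Int.abs_eq_natAbs] at h; omega
  rw [this]
  infer_instance

/-- Tilings have no nontrivial symmetries. -/
lemma IsTiling.eq_one_of_symm {G : Type} [Group G] {m n : ℤ} {a b : G} {K : ℤ}
    {s : G → ZMod m.natAbs × Bool} {e : G → Bool} {y κ : G → ℤ}
    (T : IsTiling m n a b K s e y κ) (hBS : IsBS m n a b) (hm : m ≠ 0) (hn : n ≠ 0)
    (hmn : |m| = 1 ∧ 2 ≤ |n| ∨ |m| = |n|) {h : G} (hs : ∀ g, s (h * g) = s g)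
    (hy : ∀ g, y (h * g) = y g) : h = 1 := by
  have hdvd : m ∣ n := dvd_of_abs_eq (hmn.imp_left And.left)
  obtain ⟨P, hP⟩ := T.exists_parent hBS
  obtain ⟨L, hL⟩ := T.exists_rates
  obtain ⟨w, k, hw⟩ := T.exists_fixed_row hBS hm hn hdvd hP hL hs hy
  rcases eq_or_ne k 0 with rfl | hk
  · simpa using hw
  exfalso
  rcases hmn with ⟨h1, h2⟩ | h1
  · have hdir : ∀ g, (s g).2 ≠ true := fun g hg => by
      have h3 := abs_dvd_abs n m |>.2 (T.dvd g hg)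
      rw [h1] at h3
      have := Int.le_of_dvd one_pos h3
      omega
    have hs0 : ∀ g, (s g).1 = 0 := fun g => by
      have := subsingleton_zmod_natAbs h1
      exact Subsingleton.elim _ _
    have hper : ∀ j : ℕ, ∃ q t : ℤ, (t = k ∨ t = -k) ∧ h ^ q * (w * b ^ j) = w * b ^ j * a ^ t := by
      intro j
      induction j with
      | zero => exact ⟨1, k, Or.inl rfl, by simpa using hw⟩
      | succ j ih =>
        obtain ⟨q, t, ht, hq⟩ := ih
        refine ⟨q * n, m * t, ?_, ?_⟩
        · rcases (abs_eq zero_le_one).1 h1 with rfl | rfl <;> omega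
        · rw [pow_succ, ← mul_assoc, ← mul_assoc, mul_assoc (h ^ (q * n)), zpow_mul,
            zpow_mul_eq_mul_zpow hq, mul_comm t n, mul_assoc, hBS.zpow_mul_comm]
          simp only [mul_assoc]
    obtain ⟨i, j, hij, hrate⟩ := T.exists_rates_eq_of_periodic hk (fun j => w * b ^ j) fun j i => by
      obtain ⟨q, t, ht, hq⟩ := hper j
      exact periodic_of_mul_eq_mul_zpow hy hq ht i
    have hback : ∀ i d : ℕ, P^[d] (QuotientGroup.mk (w * b ^ (i + d))) =
        QuotientGroup.mk (w * b ^ i) := fun i d => by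
      induction d with
      | zero => rfl
      | succ d ih =>
        rw [Function.iterate_succ_apply, hP _ (hs0 _), parentStep, if_neg (hdir _), ← ih,
          ← add_assoc, pow_succ, ← mul_assoc, mul_inv_cancel_right]
    wlog hlt : i < j generalizing i j
    · exact this j i hij.symm hrate.symm (lt_of_le_of_ne (not_lt.1 hlt) hij.symm)
    obtain ⟨d, rfl⟩ := Nat.exists_eq_add_of_lt hlt
    have := T.eq_zero_of_rates_iterate_eq hBS hm hn hdvd hP hL
      (v := QuotientGroup.mk (w * b ^ (i + d + 1))) (l := d + 1) (by
        rw [add_assoc, hback, ← add_assoc, hL, hL]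
        exact hrate)
    omega
  · choose g hg using fun j : ℕ => QuotientGroup.mk_surjective (P^[j] (QuotientGroup.mk w))
    obtain ⟨i, j, hij, hrate⟩ := T.exists_rates_eq_of_periodic (mul_ne_zero hm hk) g fun j i => by
      obtain ⟨t, ht, h3⟩ := hBS.zpow_mul_of_abs_eq h1 (w⁻¹ * g j) k
      refine periodic_of_mul_eq_mul_zpow hy (q := m) (t := m * t) ?_ ?_ i
      · have h4 := zpow_mul_eq_mul_zpow hw m
        rw [eq_mul_inv_of_mul_eq h4, mul_assoc, mul_assoc, mul_comm k, h3]
        group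
      · rcases ht with rfl | rfl
        · exact Or.inl rfl
        · exact Or.inr (by ring)
    rw [← hL, ← hL, hg, hg] at hrate
    exact hij (T.iterate_injective hBS hm hn hdvd hP hL hrate)

/-! ### Existence of tilings -/

/-- The bijection of `[1,6)` that doubles small numbers and divides large ones by three. -/
noncomputable def densityShift : Equiv.Perm {x : ℝ // 1 ≤ x ∧ x < 6} where
  toFun x := if h : (x : ℝ) < 3 then ⟨2 * x, by have := x.2.1; constructor <;> linarith⟩
    else ⟨x / 3, by have := x.2.2; constructor <;> linarith⟩
  invFun x := if h : (x : ℝ) < 2 then ⟨3 * x, by have := x.2.1; constructor <;> linarith⟩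
    else ⟨x / 2, by have := x.2.2; constructor <;> linarith⟩
  left_inv x := by
    have := x.2
    by_cases h : (x : ℝ) < 3
    · have h2 : ¬ 2 * (x : ℝ) < 2 := by linarith
      simp [h, h2]
    · have h2 : (x : ℝ) / 3 < 2 := by linarith
      ext
      simp only [h, h2, dif_pos, dif_neg, not_false_eq_true]
      ring
  right_inv x := by
    have := x.2
    by_cases h : (x : ℝ) < 2
    · have h2 : ¬ 3 * (x : ℝ) < 3 := by linarith
      simp [h, h2]
    · have h2 : (x : ℝ) / 2 < 3 := by linarith
      ext
      simp only [h, h2, dif_pos, dif_neg, not_false_eq_true]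
      ring

lemma exists_density : ∃ (δ : ℤ → ℝ) (q : ℤ → Bool), (∀ h, 1 ≤ δ h ∧ δ h ≤ 6) ∧
    ∀ h, ratioNum (q h) * δ h = ratioDen (q h) * δ (h + 1) := by
  classical
  refine ⟨fun h => ((densityShift ^ h) ⟨1, by norm_num⟩ : {x : ℝ // 1 ≤ x ∧ x < 6}),
    fun h => decide ((((densityShift ^ h) ⟨1, by norm_num⟩ : {x : ℝ // 1 ≤ x ∧ x < 6}) : ℝ) < 3),
    fun h => ?_, fun h => ?_⟩
  · have := ((densityShift ^ h) ⟨1, by norm_num⟩).2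
    exact ⟨this.1, this.2.le⟩
  dsimp only
  rw [add_comm h, zpow_one_add, Equiv.Perm.mul_apply]
  generalize (densityShift ^ h) ⟨1, by norm_num⟩ = x
  by_cases hx : (x : ℝ) < 3
  · simp [densityShift, hx, ratioNum, ratioDen]
  · simp [densityShift, hx, ratioNum, ratioDen]
    ring

lemma exists_marking_action {m n : ℤ} (h : |m| = 1 ∧ 2 ≤ |n| ∨ |m| = |n| ∧ 2 ≤ |m|) :
    ∃ (X : Type) (α β : Equiv.Perm X) (μ : X → ZMod m.natAbs × Bool), Nonempty X ∧
      α ^ m.natAbs = 1 ∧ (∀ x, (μ (α x)).1 = (μ x).1 + 1) ∧ (∀ x, (μ (α x)).2 = (μ x).2) ∧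
      (∀ x, (μ x).2 = true → n ∣ m) ∧ ∀ x, IsUp (μ x) ↔ ¬ IsDown (μ (β x)) := by
  rcases h with ⟨h1, -⟩ | ⟨h1, h2⟩
  · have := subsingleton_zmod_natAbs h1
    exact ⟨Unit, 1, 1, fun _ => (0, false), ⟨()⟩, one_pow _, fun _ => Subsingleton.elim _ _,
      fun _ => rfl, by simp, by simp [IsUp, IsDown]⟩
  · obtain ⟨α, β, hα, hα', h⟩ := exists_orientation m.natAbs
      (by rw [Int.abs_eq_natAbs] at h2; omega)
    exact ⟨_, α, β, fun x => (x.2, x.1.2), ⟨((0, false), 0)⟩, hα, fun x => by rw [hα'],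
      fun x => by rw [hα'], fun _ _ => (abs_dvd_abs n m).1 (dvd_of_eq h1.symm), h⟩

lemma IsBS.exists_marking {G : Type} [Group G] {m n : ℤ} {a b : G} (hBS : IsBS m n a b)
    (h : |m| = 1 ∧ 2 ≤ |n| ∨ |m| = |n| ∧ 2 ≤ |m|) :
    ∃ (s : G → ZMod m.natAbs × Bool) (lev : G → ℤ), (∀ g, (s (g * a)).1 = (s g).1 + 1) ∧
      (∀ g, (s (g * a)).2 = (s g).2) ∧ (∀ g, (s g).2 = true → n ∣ m) ∧
      (∀ g, IsUp (s g) ↔ ¬ IsDown (s (g * b))) ∧ (∀ g, lev (g * a) = lev g) ∧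
      (∀ g, IsUp (s g) → lev (g * b) = lev g + 1) ∧
      ∀ g, ¬ IsUp (s g) → lev g = lev (g * b) + 1 := by
  classical
  obtain ⟨X, α, β, μ, ⟨x₀⟩, hα, h1, h2, hdvd, hedge⟩ := exists_marking_action h
  have hmn : m ∣ n := dvd_of_abs_eq (h.imp And.left And.left)
  let α' : Equiv.Perm (X × ℤ) := α.prodCongr (Equiv.refl ℤ)
  let β' : Equiv.Perm (X × ℤ) :=
    Equiv.prodShear β fun x => Equiv.addRight (if IsUp (μ x) then 1 else -1)
  have hpow : ∀ (k : ℕ) (x : X × ℤ), (α' ^ k) x = ((α ^ k) x.1, x.2) := fun k => by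
    induction k with
    | zero => exact fun x => rfl
    | succ k ih => exact fun x => by rw [pow_succ, pow_succ, Equiv.Perm.mul_apply, ih]; rfl
  have hα' : α' ^ m.natAbs = 1 := by
    ext x : 1
    rw [hpow, hα]
    rfl
  have hz : ∀ k : ℤ, m ∣ k → α' ^ k = 1 := fun k hk => by
    obtain ⟨t, rfl⟩ := Int.natAbs_dvd.2 hk
    rw [zpow_mul, zpow_natCast, hα', one_zpow]
  obtain ⟨π, -, ha, hb, -⟩ := hBS.exists_orbitMap α' β'
    (by rw [hz m dvd_rfl, hz n hmn, one_mul, mul_one]) (x₀, 0)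
  refine ⟨fun g => μ (π g).1, fun g => (π g).2, fun g => ?_, fun g => ?_, fun g => hdvd _,
    fun g => ?_, fun g => ?_, fun g hg => ?_, fun g hg => ?_⟩
  · simp only [ha]; exact h1 _
  · simp only [ha]; exact h2 _
  · simp only [hb]; exact hedge _
  · simp only [ha]; rfl
  · simp only [hb]
    change (π g).2 + (if IsUp (μ (π g).1) then 1 else -1) = _
    rw [if_pos hg]
  · simp only [hb]
    change _ = (π g).2 + (if IsUp (μ (π g).1) then 1 else -1) + 1
    rw [if_neg hg]
    ring

lemma abs_carry_le {u v m n : ℤ} (hu : 0 < u ∧ u ≤ 3) (hv : 0 < v ∧ v ≤ 3) {x y : ℝ}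
    (h : u * m * x = v * n * y) : |u * m * ⌊x⌋ - v * n * ⌊y⌋| ≤ 3 * (|m| + |n|) := by
  have h1 : (u * m * ⌊x⌋ - v * n * ⌊y⌋ : ℝ) = v * n * Int.fract y - u * m * Int.fract x := by
    rw [← Int.self_sub_floor, ← Int.self_sub_floor]
    linarith
  have h2 : ∀ (u m : ℤ) (x : ℝ), 0 < u ∧ u ≤ 3 → |(u * m * Int.fract x : ℝ)| ≤ 3 * |(m : ℝ)| := by
    intro u m x hu
    rw [abs_mul, abs_mul, abs_of_nonneg (Int.fract_nonneg x),
      abs_of_pos (by exact_mod_cast hu.1 : (0 : ℝ) < u)]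
    have hu3 : (u : ℝ) ≤ 3 := by exact_mod_cast hu.2
    have hu0 : (0 : ℝ) < u := by exact_mod_cast hu.1
    calc (u : ℝ) * |(m : ℝ)| * Int.fract x ≤ u * |(m : ℝ)| * 1 := by
          gcongr
          exact (Int.fract_lt_one x).le
      _ ≤ 3 * |(m : ℝ)| := by rw [mul_one]; gcongr
  have h3 : |(u * m * ⌊x⌋ - v * n * ⌊y⌋ : ℝ)| ≤ 3 * (|(m : ℝ)| + |(n : ℝ)|) := by
    rw [h1]
    have := abs_sub (v * n * Int.fract y : ℝ) (u * m * Int.fract x)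
    linarith [h2 u m x hu, h2 v n y hv]
  exact_mod_cast h3

lemma floor_add_sub_floor_mem {x d : ℝ} (hd : 1 ≤ d ∧ d ≤ 6) :
    1 ≤ ⌊x + d⌋ - ⌊x⌋ ∧ ⌊x + d⌋ - ⌊x⌋ ≤ 6 := by
  have h1 : ⌊x + 1⌋ ≤ ⌊x + d⌋ := Int.floor_le_floor (by linarith)
  have h2 : ⌊x + d⌋ ≤ ⌊x + (6 : ℤ)⌋ := Int.floor_le_floor (by push_cast; linarith)
  rw [Int.floor_add_one] at h1
  rw [Int.floor_add_intCast] at h2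
  constructor <;> linarith

lemma ratio_le_three (e : Bool) : ratioNum e ≤ 3 ∧ ratioDen e ≤ 3 := by cases e <;> decide

/-- Sturmian sequences along the rows of `G` form a tiling. -/
lemma IsBS.exists_isTiling {G : Type} [Group G] {m n : ℤ} {a b : G} (hBS : IsBS m n a b)
    (hm : m ≠ 0) (hn : n ≠ 0) (h : |m| = 1 ∧ 2 ≤ |n| ∨ |m| = |n| ∧ 2 ≤ |m|) :
    ∃ s e y κ, IsTiling m n a b (3 * (|m| + |n|)) s e y κ := by
  classical
  obtain ⟨s, lev, h1, h2, hdvd, hedge, hla, hup, hdown⟩ := hBS.exists_marking h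
  obtain ⟨δ, q, hδ, hq⟩ := exists_density
  obtain ⟨c, -, hca, hcb⟩ := hBS.exists_affine hm hn
  have hmn : m ∣ n := dvd_of_abs_eq (h.imp And.left And.left)
  have hn' : (n : ℝ) ≠ 0 := by exact_mod_cast hn
  have hc : ∀ g, n * (c g * (m / n)) = m * c g := fun g => by field_simp
  let e : G → Bool := fun g => q (lev g)
  let F : G → ℤ := fun g => ⌊c g * δ (lev g)⌋
  let κ : G → ℤ := fun g =>
    if IsUp (s g) then ratioNum (e g) * m * F g - ratioDen (e g) * n * F (g * b)
    else ratioDen (e (g * b)) * m * F g - ratioNum (e (g * b)) * n * F (g * b)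
  have hs : ∀ g, s (g * a ^ n) = s g := fun g => by
    refine Prod.ext ?_ (map_mul_zpow_of_invariant (f := fun g => (s g).2) h2 g n)
    rw [map_mul_zpow_of_map_mul (c := fun g => (s g).1) h1,
      (ZMod.intCast_zmod_eq_zero_iff_dvd _ _).2 (Int.natAbs_dvd.2 hmn), add_zero]
  have he : ∀ g (t : ℤ), e (g * a ^ t) = e g := fun g t =>
    congrArg q (map_mul_zpow_of_invariant hla g t)
  have hcomm : ∀ g, g * a ^ n * b = g * b * a ^ m := fun g => by
    have := hBS.zpow_mul_comm 1
    rw [mul_one, mul_one] at this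
    rw [mul_assoc, this, mul_assoc]
  have hF : ∀ g k, signedSum (fun i => F (g * a ^ i * a) - F (g * a ^ i)) k =
      F (g * a ^ k) - F g := fun g k =>
    (eq_signedSum (f := fun k => F (g * a ^ k) - F g) (by simp) (fun k => by
      rw [zpow_add_one, ← mul_assoc]; ring) k).symm
  refine ⟨s, e, fun g => F (g * a) - F g, κ, h1, h2, fun g => congrArg q (hla g), hdvd, fun g => ?_,
    fun g => ?_, fun g => ?_, fun g hg => ?_, fun g hg => ?_⟩
  · rw [hedge]
    exact (em _).symm
  · simp only [F, hla, hca, add_mul, one_mul]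
    exact floor_add_sub_floor_mem (hδ _)
  · simp only [κ]
    split_ifs with hg
    · refine abs_carry_le ⟨ratioNum_pos _, (ratio_le_three _).1⟩
        ⟨ratioDen_pos _, (ratio_le_three _).2⟩ ?_
      have := hq (lev g)
      rw [← hup g hg] at this
      rw [hcb]
      linear_combination m * c g * this - ratioDen (e g) * δ (lev (g * b)) * hc g
    · refine abs_carry_le ⟨ratioDen_pos _, (ratio_le_three _).2⟩
        ⟨ratioNum_pos _, (ratio_le_three _).1⟩ ?_
      have := hq (lev (g * b))
      rw [← hdown g hg] at this
      rw [hcb]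
      linear_combination - m * c g * this - ratioNum (e (g * b)) * δ (lev (g * b)) * hc g
  · simp only [κ, hs, if_pos hg, hcomm, he, hF]
    ring
  · have hg' : ¬ IsUp (s g) := fun h => (hedge g).1 h hg
    simp only [κ, hs, if_neg hg', hcomm, he, hF]
    ring

/-! ### The subshift of tilings -/

lemma isLocal_signedSum {G A : Type} {f : ℤ → (G → A) → ℤ} (hf : ∀ i, IsLocal (f i)) (k : ℤ) :
    IsLocal (fun z => signedSum (fun i => f i z) k) :=
  .comp₂ (· - ·) (.sum _ fun i => hf i) (.sum _ fun i => hf (-1 - i))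

lemma IsBS.hasStrongSFT {G : Type} [Group G] {m n : ℤ} {a b : G} (hBS : IsBS m n a b)
    (hm : m ≠ 0) (hn : n ≠ 0) (h : |m| = 1 ∧ 2 ≤ |n| ∨ |m| = |n| ∧ 2 ≤ |m|) :
    HasStrongSFT G := by
  have : NeZero m.natAbs := ⟨Int.natAbs_ne_zero.2 hm⟩
  obtain ⟨K, hK⟩ : ∃ K, K = 3 * (|m| + |n|) := ⟨_, rfl⟩
  let A := (ZMod m.natAbs × Bool) × Bool × Set.Icc (1 : ℤ) 6 × Set.Icc (-K) K
  let s : A → ZMod m.natAbs × Bool := fun t => t.1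
  let e : A → Bool := fun t => t.2.1
  let y : A → ℤ := fun t => t.2.2.1
  let κ : A → ℤ := fun t => t.2.2.2
  let P : (G → A) → Prop := fun z =>
    (s (z a)).1 = (s (z 1)).1 + 1 ∧ (s (z a)).2 = (s (z 1)).2 ∧ e (z a) = e (z 1) ∧
    ((s (z 1)).2 = true → n ∣ m) ∧ (IsUp (s (z 1)) ∨ IsDown (s (z b))) ∧
    (IsUp (s (z 1)) → κ (z (a ^ n)) - κ (z 1) =
      ratioNum (e (z 1)) * m * signedSum (fun i => y (z (a ^ i))) n -
        ratioDen (e (z 1)) * n * signedSum (fun i => y (z (b * a ^ i))) m) ∧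
    (IsDown (s (z b)) → κ (z (a ^ n)) - κ (z 1) =
      ratioDen (e (z b)) * m * signedSum (fun i => y (z (a ^ i))) n -
        ratioNum (e (z b)) * n * signedSum (fun i => y (z (b * a ^ i))) m)
  have hloc : IsLocal P := by
    have hsum : ∀ (w : G) (k : ℤ), IsLocal fun z : G → A =>
        signedSum (fun i => y (z (w * a ^ i))) k :=
      fun w k => isLocal_signedSum (fun i => .comp y (.eval (w * a ^ i))) k
    have hsum₁ : IsLocal (fun z : G → A => signedSum (fun i => y (z (a ^ i))) n) :=
      isLocal_signedSum (fun i => .comp y (.eval (a ^ i))) n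
    refine .and ?_ (.and ?_ (.and ?_ (.and ?_ (.and ?_ (.and ?_ ?_)))))
    · exact .comp₂ (fun p q => (s p).1 = (s q).1 + 1) (.eval a) (.eval 1)
    · exact .comp₂ (fun p q => (s p).2 = (s q).2) (.eval a) (.eval 1)
    · exact .comp₂ (fun p q => e p = e q) (.eval a) (.eval 1)
    · exact .comp (fun p => (s p).2 = true → n ∣ m) (.eval 1)
    · exact .comp₂ (fun p q => IsUp (s p) ∨ IsDown (s q)) (.eval 1) (.eval b)
    · exact .comp₂ (fun (p : A × A) (q : ℤ × ℤ) => IsUp (s p.2) → κ p.1 - κ p.2 =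
        ratioNum (e p.2) * m * q.1 - ratioDen (e p.2) * n * q.2)
        (.comp₂ Prod.mk (.eval (a ^ n)) (.eval 1)) (.comp₂ Prod.mk hsum₁ (hsum b m))
    · exact .comp₂ (fun (p : A × A × A) (q : ℤ × ℤ) => IsDown (s p.2.2) → κ p.1 - κ p.2.1 =
        ratioDen (e p.2.2) * m * q.1 - ratioNum (e p.2.2) * n * q.2)
        (.comp₂ Prod.mk (.eval (a ^ n)) (.comp₂ Prod.mk (.eval 1) (.eval b)))
        (.comp₂ Prod.mk hsum₁ (hsum b m))
  refine hasStrongSFT_of_isLocal hloc ?_ fun x hx g hg => ?_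
  · obtain ⟨s, e, y, κ, T⟩ := hBS.exists_isTiling hm hn h
    rw [← hK] at T
    refine ⟨fun g => (s g, e g, ⟨y g, T.y_mem g⟩, ⟨κ g, abs_le.1 (T.carry_le g)⟩), fun g => ?_⟩
    simp only [P, mul_one, ← mul_assoc]
    exact ⟨T.fst_mul g, T.snd_mul g, T.ratio_mul g, T.dvd g, T.edge g, T.up g, T.down g⟩
  · simp only [P, mul_one, ← mul_assoc] at hx
    have T : IsTiling m n a b K (fun g => s (x g)) (fun g => e (x g)) (fun g => y (x g))
        (fun g => κ (x g)) :=
      ⟨fun g => (hx g).1, fun g => (hx g).2.1, fun g => (hx g).2.2.1, fun g => (hx g).2.2.2.1,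
        fun g => (hx g).2.2.2.2.1, fun g => (x g).2.2.1.2, fun g => abs_le.2 (x g).2.2.2.2,
        fun g => (hx g).2.2.2.2.2.1, fun g => (hx g).2.2.2.2.2.2⟩
    exact T.eq_one_of_symm hBS hm hn (h.imp_right And.left) (fun k => congrArg s (hg k))
      (fun k => congrArg y (hg k))

/-- A residually finite Baumslag–Solitar group `BS(m,n)` with `|m| ≥ 2` or `|n| ≥ 2`
admits a strongly aperiodic SFT as well as a weakly-but-not-strongly aperiodic SFT. -/
theorem residually_finite_BS_strongly_and_weakly_not_strongly (m n : ℤ)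
    (hm : m ≠ 0) (hn : n ≠ 0) (hbig : 2 ≤ |m| ∨ 2 ≤ |n|)
    (hrf : |m| = 1 ∨ |n| = 1 ∨ |m| = |n|) :
    (∃ (A : Type) (_ : Fintype A) (F : Set (Pattern (BS m n) A)),
      F.Finite ∧ (SFT F).Nonempty ∧
      ∀ x ∈ SFT F, ∀ g : BS m n, (fun h => x (g⁻¹ * h)) = x → g = 1) ∧
    (∃ (A : Type) (_ : Fintype A) (F : Set (Pattern (BS m n) A)),
      F.Finite ∧ (SFT F).Nonempty ∧
      (∀ x ∈ SFT F, {y : BS m n → A | ∃ g : BS m n, y = fun h => x (g⁻¹ * h)}.Infinite) ∧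
      (∃ x ∈ SFT F, ∃ g : BS m n, g ≠ 1 ∧ (fun h => x (g⁻¹ * h)) = x)) := by
  have hBS := isBS_presentedGroup m n
  rcases hrf with h1 | h1 | h1
  · have h2 : 2 ≤ |n| := hbig.resolve_left (by omega)
    exact ⟨hBS.hasStrongSFT hm hn (Or.inl ⟨h1, h2⟩), hBS.hasWeakNotStrongSFT_of_abs_eq_one h1 h2⟩
  · have h2 : 2 ≤ |m| := hbig.resolve_right (by omega)
    exact ⟨hBS.swap.hasStrongSFT hn hm (Or.inl ⟨h1, h2⟩),
      hBS.swap.hasWeakNotStrongSFT_of_abs_eq_one h1 h2⟩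
  · have h2 : 2 ≤ |m| := hbig.elim id fun h => h1 ▸ h
    exact ⟨hBS.hasStrongSFT hm hn (Or.inr ⟨h1, h2⟩), hBS.hasWeakNotStrongSFT_of_abs_eq h1 h2⟩
end

section
/- For all integers m,n ≥ 1, the Baumslag–Solitar group BS(m,n) admits a weakly aperiodic subshift of finite type: there exist a finite alphabet A and a finite set F of forbidden patterns over BS(m,n) such that the SFT X_F is nonempty and every configuration in X_F has infinite orbit under the shift action of BS(m,n). -/
/-- A condition on configurations which only depends on a finite window, imposed at every
position, defines a subshift of finite type. -/
theorem exists_finite_SFT_eq {G A : Type} [Group G] [Finite A] (S : Finset G)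
    (R : (G → A) → Prop) (hR : ∀ z z' : G → A, (∀ s ∈ S, z s = z' s) → R z → R z') :
    ∃ F : Set (Pattern G A), F.Finite ∧ ∀ x, x ∈ SFT F ↔ ∀ g : G, R fun h => x (g * h) := by
  refine ⟨Pattern.mk S '' {d | ∃ z : G → A, (∀ s : S, z s = d s) ∧ ¬ R z},
    (Set.toFinite _).image _, fun x => ⟨fun hx g => ?_, ?_⟩⟩
  · by_contra h
    refine hx ⟨S, fun s => x (g * s)⟩ ⟨_, ⟨fun h => x (g * h), fun _ => rfl, h⟩, rfl⟩ ⟨g⁻¹, ?_⟩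
    intro s
    simp
  · rintro hx _ ⟨d, ⟨z, hz, hn⟩, rfl⟩ ⟨g, hg⟩
    refine hn (hR _ _ (fun s hs => ?_) (hx g⁻¹))
    exact (hg ⟨s, hs⟩).trans (hz ⟨s, hs⟩).symm

/-- A configuration with finite orbit is invariant under inserting elements of some normal
subgroup of finite index. -/
theorem exists_normal_finiteIndex_of_finite_orbit {G A : Type} [Group G] (x : G → A)
    (hx : {y : G → A | ∃ g : G, y = fun h => x (g⁻¹ * h)}.Finite) :
    ∃ N : Subgroup G, N.Normal ∧ N.FiniteIndex ∧
      ∀ k ∈ N, ∀ h h' : G, x (h * k * h') = x (h * h') := by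
  let _ : MulAction G (G → A) := arrowAction
  have hfin : (MulAction.orbit G x).Finite := by
    refine hx.subset ?_
    rintro _ ⟨g, rfl⟩
    exact ⟨g, rfl⟩
  have : Finite (MulAction.orbit G x) := hfin
  have hfi : (MulAction.stabilizer G x).FiniteIndex := by
    have : Finite (G ⧸ MulAction.stabilizer G x) :=
      Finite.of_equiv _ (MulAction.orbitEquivQuotientStabilizer G x)
    exact Subgroup.finiteIndex_of_finite_quotient
  refine ⟨(MulAction.stabilizer G x).normalCore, inferInstance, inferInstance, ?_⟩
  intro k hk h h'
  have h1 : h * k⁻¹ * h⁻¹ ∈ MulAction.stabilizer G x :=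
    Subgroup.normalCore_le _ ((inferInstance :
      (MulAction.stabilizer G x).normalCore.Normal).conj_mem _ (inv_mem hk) h)
  have h2 : x ((h * k⁻¹ * h⁻¹)⁻¹ * (h * h')) = x (h * h') := congrFun h1 (h * h')
  rw [← h2]
  congr 1
  group

namespace BS

/-- The generator `a` of `BS(m,n)`. -/
def a (m n : ℤ) : BS m n := PresentedGroup.of 0

/-- The generator `b` of `BS(m,n)`. -/
def b (m n : ℤ) : BS m n := PresentedGroup.of 1

theorem b_mul_a_pow (m n : ℕ) : b m n * a m n ^ m = a m n ^ n * b m n := by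
  have h : PresentedGroup.mk (BSrel m n) (FreeGroup.of 1 * FreeGroup.of 0 ^ (m : ℤ) *
      (FreeGroup.of 1)⁻¹ * (FreeGroup.of 0 ^ (n : ℤ))⁻¹) = 1 :=
    PresentedGroup.one_of_mem rfl
  simp only [map_mul, map_inv, map_pow, zpow_natCast] at h
  rw [mul_inv_eq_one, mul_inv_eq_iff_eq_mul] at h
  exact h

theorem a_pow_mul_b (m n i : ℕ) :
    a m n ^ (n * i) * b m n = b m n * a m n ^ (m * i) := by
  induction i with
  | zero => simp
  | succ i ih =>
    rw [mul_add, mul_one, add_comm, pow_add, mul_assoc, ih, ← mul_assoc, ← b_mul_a_pow,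
      mul_assoc, ← pow_add, mul_add, mul_one, add_comm]

/-- The permutation of the set of (level, position) pairs induced by right multiplication
by `a`. -/
def stepA : Equiv.Perm (ℤ × ℚ) :=
  (Equiv.refl ℤ).prodCongr (Equiv.addRight 1)

/-- The permutation of the set of (level, position) pairs induced by right multiplication
by `b`. -/
def stepB (c : ℚ) (hc : c ≠ 0) : Equiv.Perm (ℤ × ℚ) :=
  (Equiv.addRight 1).prodCongr (Equiv.mulLeft₀ c hc)

theorem stepA_pow_apply (i : ℕ) (s : ℤ × ℚ) : (stepA ^ i) s = (s.1, s.2 + i) := by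
  induction i with
  | zero => simp
  | succ i ih =>
    rw [pow_succ', Equiv.Perm.mul_apply, ih]
    simp [stepA, add_assoc]

/-- Every element of `BS(m,n)` has a level in `ℤ` and a position in `ℚ`, compatible with right
multiplication by the generators. -/
theorem exists_level_position (m n : ℕ) (hm : 1 ≤ m) (hn : 1 ≤ n) :
    ∃ (l : BS m n → ℤ) (u : BS m n → ℚ), (∀ g, l (g * a m n) = l g) ∧
      (∀ g, u (g * a m n) = u g + 1) ∧ (∀ g, l (g * b m n) = l g + 1) ∧
      (∀ g, u (g * b m n) = m / n * u g) := by
  have hn' : (n : ℚ) ≠ 0 := by positivity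
  have hc : (m / n : ℚ) ≠ 0 := by positivity
  let f : Fin 2 → (Equiv.Perm (ℤ × ℚ))ᵐᵒᵖ :=
    ![MulOpposite.op stepA, MulOpposite.op (stepB (m / n) hc)]
  have hf : ∀ r ∈ BSrel m n, FreeGroup.lift f r = 1 := by
    rintro _ rfl
    simp only [map_mul, map_inv, map_pow, FreeGroup.lift_apply_of, zpow_natCast]
    rw [mul_inv_eq_one, mul_inv_eq_iff_eq_mul]
    apply MulOpposite.unop_injective
    ext s : 1
    simp only [f, Matrix.cons_val_zero, Matrix.cons_val_one, MulOpposite.unop_mul,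
      MulOpposite.unop_pow, MulOpposite.unop_op, Equiv.Perm.mul_apply, stepA_pow_apply]
    simp only [stepB, Equiv.prodCongr_apply, Prod.map, Equiv.mulLeft₀_apply,
      Equiv.coe_addRight]
    congr 1
    field_simp
  let φ := PresentedGroup.toGroup hf
  have ha : φ (a m n) = MulOpposite.op stepA := PresentedGroup.toGroup.of hf
  have hb : φ (b m n) = MulOpposite.op (stepB (m / n) hc) := PresentedGroup.toGroup.of hf
  refine ⟨fun g => ((φ g).unop (0, 0)).1, fun g => ((φ g).unop (0, 0)).2, ?_, ?_, ?_, ?_⟩ <;>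
    intro g <;> simp [map_mul, ha, hb, stepA, stepB]

end BS

/-- There is a bi-infinite sequence in `[1,3)` whose consecutive ratios are `2` or `2/3`. -/
theorem exists_bounded_orbit :
    ∃ (α : ℤ → ℚ) (r : ℤ → ℤ), (∀ k, 1 ≤ α k ∧ α k < 3) ∧ (∀ k, r k = 1 ∨ r k = 3) ∧
      ∀ k, 3 * α (k + 1) = 2 * r k * α k := by
  have h : ∀ k : ℤ, ∃ l : ℤ, (3 : ℚ) ^ l ≤ 2 ^ k ∧ (2 : ℚ) ^ k < 3 ^ (l + 1) := fun k => by
    obtain ⟨l, hl⟩ := exists_mem_Ico_zpow (x := (2 : ℚ) ^ k) (y := 3) (by positivity) (by norm_num)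
    exact ⟨l, hl.1, hl.2⟩
  choose l hl hl' using h
  have hstep : ∀ k, l (k + 1) = l k ∨ l (k + 1) = l k + 1 := by
    intro k
    have h1 : l k < l (k + 1) + 1 := by
      rw [← zpow_lt_zpow_iff_right₀ (by norm_num : (1 : ℚ) < 3)]
      calc (3 : ℚ) ^ l k ≤ 2 ^ k := hl k
        _ ≤ 2 ^ (k + 1) := zpow_le_zpow_right₀ (by norm_num) (by lia)
        _ < _ := hl' _
    have h2 : l (k + 1) < l k + 1 + 1 := by
      rw [← zpow_lt_zpow_iff_right₀ (by norm_num : (1 : ℚ) < 3)]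
      calc (3 : ℚ) ^ l (k + 1) ≤ 2 ^ (k + 1) := hl _
        _ = 2 ^ k * 2 := zpow_add_one₀ (by norm_num) _
        _ < 3 ^ (l k + 1) * 3 := by
          have := hl' k
          have : (0 : ℚ) < 2 ^ k := by positivity
          linarith
        _ = _ := (zpow_add_one₀ (by norm_num) _).symm
    lia
  refine ⟨fun k => 2 ^ k / 3 ^ l k, fun k => if l (k + 1) = l k then 3 else 1,
    fun k => ⟨?_, ?_⟩, fun k => ?_, fun k => ?_⟩
  · rw [one_le_div (by positivity)]
    exact hl k
  · rw [div_lt_iff₀ (by positivity), mul_comm, ← zpow_add_one₀ (by norm_num)]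
    exact hl' k
  · dsimp only
    split_ifs <;> simp
  · dsimp only
    rw [zpow_add_one₀ (by norm_num)]
    rcases hstep k with h | h
    · rw [if_pos h, h]
      push_cast
      ring
    · rw [if_neg (by lia), h, zpow_add_one₀ (by norm_num)]
      push_cast
      field_simp

/-- Balanced representations of `α` and `α'` with `3 α' = 2 r α`, read on intervals of lengths
`n` and `m`, are related by carries in a bounded range. -/
theorem carry_mem_Icc (m n : ℕ) (hn : 1 ≤ n) (r : ℤ) (hr : r = 1 ∨ r = 3) (α α' u : ℚ)
    (h : 3 * α' = 2 * r * α) :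
    2 * r * m * ⌊α * u⌋ - 3 * n * ⌊α' * (m / n * u)⌋ ∈ Set.Icc (-6 * m : ℤ) (3 * n) := by
  have hn' : (n : ℚ) ≠ 0 := by positivity
  have hm0 : (0 : ℚ) ≤ m := by positivity
  have hn0 : (0 : ℚ) ≤ n := by positivity
  have key : (2 * r * m * ⌊α * u⌋ - 3 * n * ⌊α' * (m / n * u)⌋ : ℚ) =
      3 * (n * Int.fract (α' * (m / n * u))) - 2 * r * (m * Int.fract (α * u)) := by
    have e : 3 * n * (α' * (m / n * u)) = 2 * r * m * (α * u) := by
      field_simp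
      linear_combination (m * u) * h
    unfold Int.fract
    linear_combination -e
  have f1 := mul_nonneg hm0 (Int.fract_nonneg (α * u))
  have f2 := mul_le_mul_of_nonneg_left (Int.fract_lt_one (α * u)).le hm0
  have f3 := mul_nonneg hn0 (Int.fract_nonneg (α' * (m / n * u)))
  have f4 := mul_le_mul_of_nonneg_left (Int.fract_lt_one (α' * (m / n * u))).le hn0
  constructor
  · rw [← Int.cast_le (R := ℚ)]
    push_cast
    rw [key]
    rcases hr with rfl | rfl <;> push_cast <;> linarith
  · rw [← Int.cast_le (R := ℚ)]
    push_cast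
    rw [key]
    rcases hr with rfl | rfl <;> push_cast <;> linarith

theorem floor_increment_mem_Icc (α u : ℚ) (h1 : 1 ≤ α) (h3 : α < 3) :
    ⌊α * (u + 1)⌋ - ⌊α * u⌋ ∈ Set.Icc (1 : ℤ) 3 := by
  rw [mul_add, mul_one]
  constructor
  · have : ⌊α * u⌋ + 1 ≤ ⌊α * u + α⌋ := by
      rw [← Int.floor_add_one]
      exact Int.floor_le_floor (by linarith)
    lia
  · have : ⌊α * u + α⌋ ≤ ⌊α * u⌋ + 3 := by
      have := Int.floor_le_floor (show α * u + α ≤ α * u + (3 : ℤ) by push_cast; linarith)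
      rwa [Int.floor_add_intCast] at this
    lia

/-- Summing a `p`-periodic function over `p` consecutive blocks of length `n`. -/
theorem sum_blocks_of_periodic (f : ℕ → ℤ) (p : ℕ) (hf : f.Periodic p) (n : ℕ) :
    ∑ i ∈ Finset.range p, ∑ j ∈ Finset.range n, f (n * i + j) =
      n * ∑ i ∈ Finset.range p, f i := by
  have h1 : ∀ k, ∑ i ∈ Finset.range k, ∑ j ∈ Finset.range n, f (n * i + j) =
      ∑ i ∈ Finset.range (n * k), f i := by
    intro k
    induction k with
    | zero => simp
    | succ k ih => rw [Finset.sum_range_succ, ih, mul_add, mul_one, Finset.sum_range_add]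
  have h2 : ∀ k : ℕ, ∑ i ∈ Finset.range (k * p), f i = k * ∑ i ∈ Finset.range p, f i := by
    intro k
    induction k with
    | zero => simp
    | succ k ih =>
      have : ∀ i, f (k * p + i) = f i := fun i => by
        rw [add_comm]
        exact hf.nat_mul k i
      rw [add_mul, one_mul, Finset.sum_range_add, ih]
      simp only [this]
      push_cast
      ring
  rw [h1, h2]

open BS in
/-- The local rule: the three components of a symbol are a digit, a multiplier and a carry; the
multiplier is constant along `a`, and the digits above are obtained from the digits below by
multiplication by `2/3` of the multiplier. -/
def multiplicationRule (m n : ℕ) (z : BS m n → ℤ × ℤ × ℤ) : Prop :=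
  (z (a m n)).2.1 = (z 1).2.1 ∧
  (z (a m n ^ n)).2.2 - (z 1).2.2 =
    2 * (z 1).2.1 * m * ∑ i ∈ Finset.range n, (z (a m n ^ i)).1 -
      3 * n * ∑ i ∈ Finset.range m, (z (b m n * a m n ^ i)).1

open BS in
theorem exists_multiplicationRule (m n : ℕ) (hm : 1 ≤ m) (hn : 1 ≤ n) :
    ∃ z : BS m n → ℤ × ℤ × ℤ,
      (∀ g, z g ∈ Set.Icc ((1, 1, -6 * m) : ℤ × ℤ × ℤ) (3, 3, 3 * n)) ∧
      ∀ g, multiplicationRule m n fun h => z (g * h) := by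
  obtain ⟨l, u, la, ua, lb, ub⟩ := exists_level_position m n hm hn
  obtain ⟨α, r, hα, hr, hs⟩ := exists_bounded_orbit
  have lp : ∀ g i, l (g * a m n ^ i) = l g := fun g i => by
    induction i with
    | zero => simp
    | succ i ih => rw [pow_succ, ← mul_assoc, la, ih]
  have up : ∀ g (i : ℕ), u (g * a m n ^ i) = u g + i := fun g i => by
    induction i with
    | zero => simp
    | succ i ih =>
      rw [pow_succ, ← mul_assoc, ua, ih]
      push_cast
      ring
  have telescope : ∀ (β v : ℚ) (k : ℕ),
      ∑ i ∈ Finset.range k, (⌊β * (v + i + 1)⌋ - ⌊β * (v + i)⌋) =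
        ⌊β * (v + k)⌋ - ⌊β * v⌋ := fun β v k => by
    have := Finset.sum_range_sub (fun i : ℕ => ⌊β * (v + i)⌋) k
    simpa [add_assoc] using this
  refine ⟨fun g => (⌊α (l g) * (u g + 1)⌋ - ⌊α (l g) * u g⌋, r (l g),
    2 * r (l g) * m * ⌊α (l g) * u g⌋ - 3 * n * ⌊α (l g + 1) * (m / n * u g)⌋), ?_, ?_⟩
  · intro g
    have h1 := floor_increment_mem_Icc (α (l g)) (u g) (hα _).1 (hα _).2
    have h2 := carry_mem_Icc m n hn (r (l g)) (hr _) _ _ (u g) (hs (l g))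
    have h3 : 1 ≤ r (l g) ∧ r (l g) ≤ 3 := by rcases hr (l g) with h | h <;> lia
    exact ⟨⟨h1.1, h3.1, h2.1⟩, ⟨h1.2, h3.2, h2.2⟩⟩
  · intro g
    refine ⟨by simp only [la, mul_one], ?_⟩
    simp only [mul_one, ← mul_assoc g, lp, up, lb, ub, telescope]
    have e : (m / n * (u g + n) : ℚ) = m / n * u g + m := by
      have : (n : ℚ) ≠ 0 := by positivity
      field_simp
    rw [e]
    ring

open BS in
/-- A configuration with positive digits obeying the multiplication rule has infinite orbit. -/
theorem false_of_multiplicationRule (m n : ℕ) (hm : 1 ≤ m) (hn : 1 ≤ n)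
    (z : BS m n → ℤ × ℤ × ℤ) (hpos : ∀ g, 0 < (z g).1)
    (hz : ∀ g, multiplicationRule m n fun h => z (g * h))
    (N : Subgroup (BS m n)) [N.Normal] [N.FiniteIndex]
    (hN : ∀ k ∈ N, ∀ h h' : BS m n, z (h * k * h') = z (h * h')) : False := by
  set p := N.index
  have hp0 : p ≠ 0 := Subgroup.FiniteIndex.index_ne_zero
  have hap : ∀ g, z (g * a m n ^ p) = z g := fun g => by
    simpa using hN _ (N.pow_index_mem (a m n)) g 1
  have hbp : ∀ h, z (b m n ^ p * h) = z h := fun h => by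
    simpa using hN _ (N.pow_index_mem (b m n)) 1 h
  have hr : ∀ g i, (z (g * a m n ^ i)).2.1 = (z g).2.1 := fun g i => by
    induction i with
    | zero => simp
    | succ i ih =>
      rw [pow_succ, ← mul_assoc, ← ih]
      simpa using (hz (g * a m n ^ i)).1
  have hper : ∀ g, (fun i : ℕ => (z (g * a m n ^ i)).1).Periodic p := fun g i => by
    dsimp only
    rw [pow_add, ← mul_assoc, hap]
  let S : ℕ → ℤ := fun k => ∑ i ∈ Finset.range p, (z (b m n ^ k * a m n ^ i)).1
  have hS : ∀ k, 3 * S (k + 1) = 2 * (z (b m n ^ k)).2.1 * S k := by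
    intro k
    have hc : ∑ i ∈ Finset.range p, ((z (b m n ^ k * a m n ^ (n * (i + 1)))).2.2 -
        (z (b m n ^ k * a m n ^ (n * i))).2.2) = 0 := by
      rw [Finset.sum_range_sub fun i => (z (b m n ^ k * a m n ^ (n * i))).2.2]
      have : ∀ j, z (b m n ^ k * a m n ^ (j * p)) = z (b m n ^ k) := fun j => by
        induction j with
        | zero => simp
        | succ j ih => rw [add_mul, one_mul, pow_add, ← mul_assoc, hap, ih]
      rw [this]
      simp
    have hrule : ∀ i, (z (b m n ^ k * a m n ^ (n * (i + 1)))).2.2 -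
        (z (b m n ^ k * a m n ^ (n * i))).2.2 =
        2 * (z (b m n ^ k)).2.1 * m *
          ∑ j ∈ Finset.range n, (z (b m n ^ k * a m n ^ (n * i + j))).1 -
        3 * n * ∑ j ∈ Finset.range m, (z (b m n ^ (k + 1) * a m n ^ (m * i + j))).1 := by
      intro i
      have h := (hz (b m n ^ k * a m n ^ (n * i))).2
      have e : ∀ j, b m n ^ k * a m n ^ (n * i) * (b m n * a m n ^ j) =
          b m n ^ (k + 1) * a m n ^ (m * i + j) := fun j => by
        rw [mul_assoc, ← mul_assoc (a m n ^ (n * i)), a_pow_mul_b, pow_succ, pow_add]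
        simp only [mul_assoc]
      simp only [e, mul_one, hr] at h
      simp only [mul_assoc (b m n ^ k), ← pow_add] at h
      exact h
    simp only [hrule, Finset.sum_sub_distrib, ← Finset.mul_sum] at hc
    rw [sum_blocks_of_periodic (fun i => (z (b m n ^ k * a m n ^ i)).1) p (hper _),
      sum_blocks_of_periodic (fun i => (z (b m n ^ (k + 1) * a m n ^ i)).1) p (hper _)] at hc
    have hmn : (m * n : ℤ) ≠ 0 := by positivity
    apply mul_left_cancel₀ hmn
    simp only [S]
    linear_combination -hc
  have hpow : ∀ k, ∃ T : ℤ, 3 ^ (k + 1) * S (k + 1) = 2 * T * S 0 := by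
    intro k
    induction k with
    | zero => exact ⟨_, by simpa using hS 0⟩
    | succ k ih =>
      obtain ⟨T, hT⟩ := ih
      refine ⟨2 * (z (b m n ^ (k + 1))).2.1 * T, ?_⟩
      rw [pow_succ, mul_assoc, hS]
      linear_combination 2 * (z (b m n ^ (k + 1))).2.1 * hT
  have hS0 : 0 < S 0 :=
    Finset.sum_pos (fun i _ => hpos _) (Finset.nonempty_range_iff.2 hp0)
  have hSp : S p = S 0 := by simp only [S, hbp, pow_zero, one_mul]
  obtain ⟨T, hT⟩ := hpow (p - 1)
  rw [Nat.sub_add_cancel (Nat.pos_of_ne_zero hp0), hSp] at hT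
  have hodd : Odd ((3 : ℤ) ^ p) := Odd.pow (by decide)
  rw [mul_right_cancel₀ hS0.ne' hT] at hodd
  exact Int.not_odd_iff_even.2 (even_two_mul T) hodd

/-- For all `m, n ≥ 1`, the group `BS(m,n)` admits a weakly aperiodic SFT. -/
theorem BSmn_admits_weakly_aperiodic_SFT (m n : ℤ) (hm : 1 ≤ m) (hn : 1 ≤ n) :
    ∃ (A : Type) (_ : Fintype A) (F : Set (Pattern (BS m n) A)),
      F.Finite ∧ (SFT F).Nonempty ∧
      ∀ x ∈ SFT F, {y : BS m n → A | ∃ g : BS m n, y = fun h => x (g⁻¹ * h)}.Infinite := by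
  classical
  lift m to ℕ using by lia
  lift n to ℕ using by lia
  norm_cast at hm hn
  let A : Type := Set.Icc ((1, 1, -6 * m) : ℤ × ℤ × ℤ) (3, 3, 3 * n)
  let S : Finset (BS m n) := {1, BS.a m n} ∪
    (Finset.range (n + 1)).image (fun i => BS.a m n ^ i) ∪
    (Finset.range m).image (fun i => BS.b m n * BS.a m n ^ i)
  have : Fintype A := Fintype.ofFinite _
  obtain ⟨F, hF, hFx⟩ := exists_finite_SFT_eq (A := A) S
    (fun z => multiplicationRule m n fun h => (z h : ℤ × ℤ × ℤ)) (by
      rintro z z' hzz ⟨h1, h2⟩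
      have e1 : z 1 = z' 1 := hzz _ (by simp [S])
      have e2 : z (BS.a m n) = z' (BS.a m n) := hzz _ (by simp [S])
      have e3 : ∀ i ≤ n, z (BS.a m n ^ i) = z' (BS.a m n ^ i) := fun i hi =>
        hzz _ (Finset.mem_union_left _ (Finset.mem_union_right _
          (Finset.mem_image_of_mem _ (Finset.mem_range.2 (by lia)))))
      have e4 : ∀ i < m, z (BS.b m n * BS.a m n ^ i) = z' (BS.b m n * BS.a m n ^ i) :=
        fun i hi => hzz _ (Finset.mem_union_right _
          (Finset.mem_image_of_mem (fun i => BS.b m n * BS.a m n ^ i) (Finset.mem_range.2 hi)))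
      refine ⟨by dsimp only at h1 ⊢; rw [← e1, ← e2, h1], ?_⟩
      dsimp only at h2 ⊢
      rw [← e1, ← e3 n le_rfl, h2]
      congr 2
      · exact Finset.sum_congr rfl fun i hi => by rw [e3 i (Finset.mem_range.1 hi).le]
      · exact Finset.sum_congr rfl fun i hi => by rw [e4 i (Finset.mem_range.1 hi)])
  refine ⟨A, this, F, hF, ?_, fun x hx hfin => ?_⟩
  · obtain ⟨z, hz, hrule⟩ := exists_multiplicationRule m n hm hn
    exact ⟨fun g => ⟨z g, hz g⟩, (hFx _).2 hrule⟩
  · obtain ⟨N, _, _, hN⟩ := exists_normal_finiteIndex_of_finite_orbit x hfin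
    exact false_of_multiplicationRule m n hm hn (fun g => (x g : ℤ × ℤ × ℤ))
      (fun g => (x g).2.1.1) ((hFx x).1 hx) N fun k hk h h' => by rw [hN k hk]
end

section
/- For all integers m,n ≥ 2, the element p = b a b⁻¹ a b a⁻¹ b⁻¹ a⁻¹ is not the identity element of the Baumslag–Solitar group BS(m,n). -/
/-- The generator `a` of `BS(m,n)`. -/
def BSa (m n : ℤ) : BS m n := PresentedGroup.of 0

/-- The generator `b` of `BS(m,n)`. -/
def BSb (m n : ℤ) : BS m n := PresentedGroup.of 1

namespace BS

open HNNExtension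

/-- On an infinite cyclic group, taking `k`-th powers is injective for `k ≠ 0`. -/
theorem zpowGroupHom_injective {k : ℤ} (hk : k ≠ 0) :
    Function.Injective (zpowGroupHom k : Multiplicative ℤ →* Multiplicative ℤ) :=
  zpow_left_injective hk

/-- A generator of an infinite cyclic group is not a `k`-th power for `k ≥ 2`. -/
theorem ofAdd_one_notMem_range_zpowGroupHom {k : ℤ} (hk : 2 ≤ k) :
    Multiplicative.ofAdd (1 : ℤ) ∉
      (zpowGroupHom k : Multiplicative ℤ →* Multiplicative ℤ).range := by
  rintro ⟨x, hx⟩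
  have h : k * x.toAdd = 1 := by simpa using congrArg Multiplicative.toAdd hx
  have := Int.le_of_dvd one_pos ⟨_, h.symm⟩
  omega

/-- The isomorphism `a ^ m ↦ a ^ n` between subgroups of the infinite cyclic group. -/
noncomputable def powEquiv {m n : ℤ} (hm : m ≠ 0) (hn : n ≠ 0) :
    (zpowGroupHom m : Multiplicative ℤ →* Multiplicative ℤ).range ≃*
      (zpowGroupHom n : Multiplicative ℤ →* Multiplicative ℤ).range :=
  (MonoidHom.ofInjective (zpowGroupHom_injective hm)).symm.trans
    (MonoidHom.ofInjective (zpowGroupHom_injective hn))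

theorem powEquiv_apply {m n : ℤ} (hm : m ≠ 0) (hn : n ≠ 0) (x : Multiplicative ℤ) :
    (powEquiv hm hn ⟨x ^ m, MonoidHom.mem_range.2 ⟨x, rfl⟩⟩ : Multiplicative ℤ) = x ^ n := by
  have h : (⟨x ^ m, MonoidHom.mem_range.2 ⟨x, rfl⟩⟩ : (zpowGroupHom m).range) =
      MonoidHom.ofInjective (zpowGroupHom_injective hm) x := rfl
  rw [h, powEquiv, MulEquiv.trans_apply, MulEquiv.symm_apply_apply]
  rfl

/-- The homomorphism from `BS(m,n)` to the corresponding HNN extension of an infinite cyclic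
group. -/
noncomputable def toHNN {m n : ℤ} (hm : m ≠ 0) (hn : n ≠ 0) :
    BS m n →* HNNExtension (Multiplicative ℤ) _ _ (powEquiv hm hn) :=
  PresentedGroup.toGroup (f := ![of (Multiplicative.ofAdd 1), t]) <| by
    rintro _ rfl
    have h := equiv_eq_conj (φ := powEquiv hm hn)
      ⟨Multiplicative.ofAdd 1 ^ m, MonoidHom.mem_range.2 ⟨_, rfl⟩⟩
    rw [powEquiv_apply, map_zpow] at h
    simp [h]

theorem toHNN_a {m n : ℤ} (hm : m ≠ 0) (hn : n ≠ 0) :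
    toHNN hm hn (BSa m n) = of (Multiplicative.ofAdd 1) :=
  PresentedGroup.toGroup.of _

theorem toHNN_b {m n : ℤ} (hm : m ≠ 0) (hn : n ≠ 0) : toHNN hm hn (BSb m n) = t :=
  PresentedGroup.toGroup.of _

end BS

/-- For `m, n ≥ 2`, the element `p = b a b⁻¹ a b a⁻¹ b⁻¹ a⁻¹` is nontrivial in `BS(m,n)`. -/
theorem p_ne_one (m n : ℤ) (hm : 2 ≤ m) (hn : 2 ≤ n) :
    BSb m n * BSa m n * (BSb m n)⁻¹ * BSa m n * BSb m n * (BSa m n)⁻¹ * (BSb m n)⁻¹ *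
      (BSa m n)⁻¹ ≠ 1 := by
  have hm0 : m ≠ 0 := by omega
  have hn0 : n ≠ 0 := by omega
  have hA := BS.ofAdd_one_notMem_range_zpowGroupHom hm
  have hB := BS.ofAdd_one_notMem_range_zpowGroupHom hn
  intro h
  let a := Multiplicative.ofAdd (1 : ℤ)
  let w : HNNExtension.NormalWord.ReducedWord (Multiplicative ℤ)
      (zpowGroupHom m).range (zpowGroupHom n).range :=
    { head := 1
      toList := [(1, a), (-1, a), (1, a⁻¹), (-1, a⁻¹)]
      chain := by
        simp only [List.isChain_cons_cons, List.isChain_singleton, and_true,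
          HNNExtension.toSubgroup_one, HNNExtension.toSubgroup_neg_one, inv_mem_iff]
        exact ⟨fun h => (hA h).elim, fun h => (hB h).elim, fun h => (hA h).elim⟩ }
  have hw : w.prod (BS.powEquiv hm0 hn0) = 1 := by
    rw [← map_one (BS.toHNN hm0 hn0), ← h]
    simp [w, a, HNNExtension.NormalWord.ReducedWord.prod, BS.toHNN_a, BS.toHNN_b, mul_assoc]
  have hnil := HNNExtension.ReducedWord.toList_eq_nil_of_mem_of_range _ w (hw ▸ one_mem _)
  exact List.cons_ne_nil _ _ hnil
end
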